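/- There exists k₀ such that for every integer k ≥ k₀ the following holds: let G be a graph containing no cycle of length 4, with average degree d := d(G) ≥ k^{2500}, and containing no clique on k vertices. Then G contains an induced proper balanced subdivision of K_h for some integer h ≥ d^{1/50000}. -/

import Mathlib

open Finset

/-- The average degree `2|E|/|V|` of a finite simple graph. -/
noncomputable def avgDeg {V : Type*} [Fintype V] (G : SimpleGraph V) : ℝ :=
  2 * G.edgeSet.ncard / Fintype.card V

/-- The degree of a vertex. -/
noncomputable def deg {V : Type*} (G : SimpleGraph V) (v : V) : ℕ :=
  (G.neighborSet v).ncard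

/-- `G` contains `K_{s,s}` as a (not necessarily induced) subgraph. -/
def HasKssSubgraph {V : Type*} (G : SimpleGraph V) (s : ℕ) : Prop :=
  ∃ f : completeBipartiteGraph (Fin s) (Fin s) →g G, Function.Injective f

/-- `G` contains no cycle of length 4, even as a non-induced subgraph. -/
def C4Free {V : Type*} (G : SimpleGraph V) : Prop :=
  ¬ ∃ a b c d : V, a ≠ b ∧ a ≠ c ∧ a ≠ d ∧ b ≠ c ∧ b ≠ d ∧ c ≠ d ∧
      G.Adj a b ∧ G.Adj b c ∧ G.Adj c d ∧ G.Adj d a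

/-- The balanced subdivision of `K_h` in which every edge of `K_h` is replaced by a
path with exactly `ℓ` edges (intended for `ℓ ≥ 2`): branch vertices are `Fin h`,
and each pair `a < b` gets a path of `ℓ - 1` new internal vertices. -/
def balancedSubdivision (h ℓ : ℕ) :
    SimpleGraph (Fin h ⊕ ({p : Fin h × Fin h // p.1 < p.2} × Fin (ℓ - 1))) :=
  SimpleGraph.fromRel (fun x y =>
    match x, y with
    | Sum.inl u, Sum.inr ⟨⟨⟨a, b⟩, _⟩, i⟩ => (u = a ∧ (i : ℕ) = 0) ∨ (u = b ∧ (i : ℕ) = ℓ - 2)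
    | Sum.inr ⟨e, i⟩, Sum.inr ⟨e', j⟩ => e = e' ∧ (j : ℕ) = (i : ℕ) + 1
    | _, _ => False)

/-- `G` contains an induced proper balanced subdivision of `K_h`. -/
def HasInducedBalancedSubdivision {V : Type*} (G : SimpleGraph V) (h : ℕ) : Prop :=
  ∃ ℓ : ℕ, 2 ≤ ℓ ∧ Nonempty (balancedSubdivision h ℓ ↪g G)

/-- The number of edges of `G` with one endpoint in `A` and the other in `B`
(for disjoint `A`, `B`). -/
noncomputable def crossEdges {V : Type*} (G : SimpleGraph V) (A B : Set V) : ℕ :=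
  Set.ncard {p : V × V | p.1 ∈ A ∧ p.2 ∈ B ∧ G.Adj p.1 p.2}

/-- `G` is `d`-degenerate: every (induced) subgraph has a vertex of degree at most `d`. -/
def Degenerate {V : Type*} (G : SimpleGraph V) (d : ℕ) : Prop :=
  ∀ s : Finset V, s.Nonempty → ∃ v ∈ s, ((s : Set V) ∩ G.neighborSet v).ncard ≤ d

/-- The 1-subdivision of the multihypergraph with hyperedges `edges e`, `e : E`,
on vertex set `V`. -/
def oneSubdivision {E V : Type*} (edges : E → Finset V) : SimpleGraph (E ⊕ V) :=
  SimpleGraph.fromRel (fun x y =>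
    match x, y with
    | Sum.inl a, Sum.inr b => b ∈ edges a
    | _, _ => False)

/-- The 1-subdivision of a simple graph `G`. -/
def graphOneSubdivision {W : Type*} (G : SimpleGraph W) : SimpleGraph (G.edgeSet ⊕ W) :=
  SimpleGraph.fromRel (fun x y =>
    match x, y with
    | Sum.inl e, Sum.inr w => w ∈ (e : Sym2 W)
    | _, _ => False)

/-- `I` is an independent set of `G`. -/
def IndepSet {V : Type*} (G : SimpleGraph V) (I : Set V) : Prop :=
  I.Pairwise fun u v => ¬ G.Adj u v

/-- `G` has a clique on `k` vertices. -/
def HasClique {V : Type*} (G : SimpleGraph V) (k : ℕ) : Prop :=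
  ∃ t : Finset V, G.IsNClique k t

namespace InducedSubdivision

open scoped Classical

section Growth

variable {V : Type*} [Fintype V]

/-- The external neighbourhood of a set of vertices. -/
noncomputable def nbrs (G : SimpleGraph V) (X : Finset V) : Finset V :=
  univ.filter fun y => y ∉ X ∧ ∃ x ∈ X, G.Adj x y

/-- The vertices reachable from `A` in at most `t` steps, where every step avoids `B`. -/
noncomputable def ball (G : SimpleGraph V) (B A : Finset V) : ℕ → Finset V
  | 0 => A
  | t + 1 => ball G B A t ∪ (nbrs G (ball G B A t) \ B)

variable {G : SimpleGraph V} {A A' B B' X : Finset V}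

lemma mem_nbrs {y : V} : y ∈ nbrs G X ↔ y ∉ X ∧ ∃ x ∈ X, G.Adj x y := by
  simp [nbrs]

lemma ball_subset_succ (t : ℕ) : ball G B A t ⊆ ball G B A (t + 1) :=
  subset_union_left

lemma ball_mono {t t' : ℕ} (h : t ≤ t') : ball G B A t ⊆ ball G B A t' :=
  monotone_nat_of_le_succ (f := ball G B A) (fun t => ball_subset_succ t) h

lemma subset_ball (t : ℕ) : A ⊆ ball G B A t :=
  ball_mono (Nat.zero_le t)

lemma mem_ball_self (u : V) (t : ℕ) : u ∈ ball G B {u} t :=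
  subset_ball t (mem_singleton_self u)

lemma mem_ball_succ_of_adj {t : ℕ} {x y : V} (hx : x ∈ ball G B A t) (h : G.Adj x y)
    (hy : y ∉ B) : y ∈ ball G B A (t + 1) := by
  by_cases hyX : y ∈ ball G B A t
  · exact ball_subset_succ t hyX
  · exact mem_union_right _ (mem_sdiff.2 ⟨mem_nbrs.2 ⟨hyX, x, hx, h⟩, hy⟩)

lemma mem_ball_succ {t : ℕ} {y : V} (h : y ∈ ball G B A (t + 1)) :
    y ∈ ball G B A t ∨ (y ∉ B ∧ ∃ x ∈ ball G B A t, G.Adj x y) := by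
  rcases mem_union.1 h with h | h
  · exact Or.inl h
  · obtain ⟨h1, h2⟩ := mem_sdiff.1 h
    exact Or.inr ⟨h2, (mem_nbrs.1 h1).2⟩

lemma ball_anti (hB : B ⊆ B') (hA : A' ⊆ A) (t : ℕ) : ball G B' A' t ⊆ ball G B A t := by
  induction t with
  | zero => exact hA
  | succ t ih =>
    intro y hy
    rcases mem_ball_succ hy with h | ⟨h, x, hx, hxy⟩
    · exact ball_subset_succ t (ih h)
    · exact mem_ball_succ_of_adj (ih hx) hxy fun hb => h (hB hb)

lemma mem_or_notMem_of_mem_ball {t : ℕ} {y : V} (h : y ∈ ball G B A t) : y ∈ A ∨ y ∉ B := by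
  induction t with
  | zero => exact Or.inl h
  | succ t ih =>
    rcases mem_ball_succ h with h | h
    · exact ih h
    · exact Or.inr h.1

lemma notMem_of_mem_ball {t : ℕ} {u y : V} (hu : u ∉ B) (h : y ∈ ball G B {u} t) : y ∉ B := by
  rcases mem_or_notMem_of_mem_ball h with h | h
  · rwa [mem_singleton.1 h]
  · exact h

lemma ball_add (s t : ℕ) : ball G B A (s + t) = ball G B (ball G B A s) t := by
  induction t with
  | zero => rfl
  | succ t ih => rw [← add_assoc]; simp only [ball, ih]

lemma mem_ball_trans {s t : ℕ} {x y z : V} (h : y ∈ ball G B {x} s) (h' : z ∈ ball G B {y} t) :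
    z ∈ ball G B {x} (s + t) := by
  rw [ball_add]
  exact ball_anti subset_rfl (singleton_subset_iff.2 h) t h'

lemma mem_ball_symm {t : ℕ} {x y : V} (hx : x ∉ B) (h : y ∈ ball G B {x} t) :
    x ∈ ball G B {y} t := by
  induction t generalizing y with
  | zero => rw [mem_singleton.1 h]; exact mem_ball_self _ _
  | succ t ih =>
    rcases mem_ball_succ h with h | ⟨h, z, hz, hzy⟩
    · exact ball_subset_succ t (ih h)
    · have h1 : z ∈ ball G B {y} 1 :=
        mem_ball_succ_of_adj (mem_ball_self y 0) hzy.symm (notMem_of_mem_ball hx hz)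
      rw [add_comm]
      exact mem_ball_trans h1 (ih hz)

lemma card_ball_succ (t : ℕ) :
    (ball G B A (t + 1)).card = (ball G B A t).card + (nbrs G (ball G B A t) \ B).card := by
  refine card_union_of_disjoint (disjoint_left.2 fun y hy hy' => ?_)
  exact (mem_nbrs.1 (mem_sdiff.1 hy').1).1 hy

lemma exists_walk_of_mem_ball {t : ℕ} {x y : V} (h : y ∈ ball G B {x} t) :
    ∃ w : G.Walk x y, w.length ≤ t ∧ ∀ v ∈ w.support, v ∈ ball G B {x} t := by
  induction t generalizing y with
  | zero =>
    obtain rfl := mem_singleton.1 h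
    exact ⟨.nil, by simp, by simp [mem_ball_self]⟩
  | succ t ih =>
    rcases mem_ball_succ h with h' | ⟨h', z, hz, hzy⟩
    · obtain ⟨w, hw, hs⟩ := ih h'
      exact ⟨w, by omega, fun v hv => ball_subset_succ t (hs v hv)⟩
    · obtain ⟨w, hw, hs⟩ := ih hz
      refine ⟨w.concat hzy, by simpa using hw, fun v hv => ?_⟩
      rw [SimpleGraph.Walk.support_concat, List.mem_append, List.mem_singleton] at hv
      rcases hv with hv | rfl
      · exact ball_subset_succ t (hs v hv)
      · exact h

/-- Two vertices whose balls each contain more than half of all vertices are joined by a path. -/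
lemma exists_path_of_large_balls {x y : V} {t : ℕ}
    (hx : Fintype.card V < 2 * (ball G B {x} t).card)
    (hy : Fintype.card V < 2 * (ball G B {y} t).card) :
    ∃ p : G.Walk x y, p.IsPath ∧ p.length ≤ 2 * t ∧
      ∀ v ∈ p.support, v = x ∨ v = y ∨ v ∉ B := by
  have : ¬ Disjoint (ball G B {x} t) (ball G B {y} t) := by
    intro hd
    have h1 := card_union_of_disjoint hd
    have h2 := card_le_univ (ball G B {x} t ∪ ball G B {y} t)
    omega
  obtain ⟨z, hz1, hz2⟩ := not_disjoint_iff.1 this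
  obtain ⟨w1, hw1, hs1⟩ := exists_walk_of_mem_ball hz1
  obtain ⟨w2, hw2, hs2⟩ := exists_walk_of_mem_ball hz2
  refine ⟨(w1.append w2.reverse).bypass, SimpleGraph.Walk.bypass_isPath _, ?_, fun v hv => ?_⟩
  · refine (SimpleGraph.Walk.length_bypass_le_length _).trans ?_
    simp only [SimpleGraph.Walk.length_append, SimpleGraph.Walk.length_reverse]
    omega
  · have := SimpleGraph.Walk.support_bypass_subset_support _ hv
    rw [SimpleGraph.Walk.mem_support_append_iff, SimpleGraph.Walk.support_reverse,
      List.mem_reverse] at this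
    rcases this with h | h
    · rcases mem_or_notMem_of_mem_ball (hs1 v h) with h | h
      · exact Or.inl (mem_singleton.1 h)
      · exact Or.inr (Or.inr h)
    · rcases mem_or_notMem_of_mem_ball (hs2 v h) with h | h
      · exact Or.inr (Or.inl (mem_singleton.1 h))
      · exact Or.inr (Or.inr h)

/-- Sublinear vertex expansion of all sets of at most half of the vertices. -/
def Expands (G : SimpleGraph V) : Prop :=
  ∀ (X : Finset V) (L : ℕ), X.Nonempty → X.card ≤ 2 ^ L → 2 * X.card ≤ Fintype.card V →
    X.card ≤ 8 * (L + 2) ^ 2 * (nbrs G X).card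

/-- The time within which balls grow to size `2 ^ l`. -/
def growthTime (l : ℕ) : ℕ := 16 * (l + 3) ^ 3

lemma growthTime_mono {l l' : ℕ} (h : l ≤ l') : growthTime l ≤ growthTime l' := by
  unfold growthTime; gcongr

lemma one_le_growthTime (l : ℕ) : 1 ≤ growthTime l := by
  unfold growthTime
  have : 0 < (l + 3) ^ 3 := by positivity
  omega

/-- The blocked set `B` takes away at most half of the expansion of the balls up to time `R`. -/
def Thin (G : SimpleGraph V) (B A : Finset V) (l₀ R : ℕ) : Prop :=
  ∀ t < R, ∀ l, l₀ ≤ l → t < growthTime (l + 1) →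
    16 * (l + 3) ^ 2 * (nbrs G (ball G B A t) ∩ B).card ≤ 2 ^ l

lemma le_card_nbrs_sdiff (hE : Expands G) {l : ℕ} (h1 : 2 ^ l ≤ X.card)
    (h2 : X.card ≤ 2 ^ (l + 1)) (h3 : 2 * X.card ≤ Fintype.card V)
    (h4 : 16 * (l + 3) ^ 2 * (nbrs G X ∩ B).card ≤ 2 ^ l) :
    2 ^ l ≤ 16 * (l + 3) ^ 2 * (nbrs G X \ B).card := by
  have hX : X.Nonempty := card_pos.1 (lt_of_lt_of_le (by positivity) h1)
  have h5 := hE X (l + 1) hX h2 h3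
  have h6 := card_sdiff_add_card_inter (nbrs G X) B
  rw [← h6] at h5
  have e : 8 * (l + 1 + 2) ^ 2 * ((nbrs G X \ B).card + (nbrs G X ∩ B).card) * 2 =
      16 * (l + 3) ^ 2 * (nbrs G X \ B).card + 16 * (l + 3) ^ 2 * (nbrs G X ∩ B).card := by ring
  omega

/-- Balls around which the blocked set is thin grow quickly. -/
lemma le_card_ball (hE : Expands G) {l₀ R : ℕ} (h1 : 2 ^ l₀ ≤ (ball G B A 1).card)
    (hT : Thin G B A l₀ R) {l : ℕ} (hl : l₀ ≤ l) :
    ∀ t ≤ R, growthTime l ≤ t →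
      2 ^ l ≤ (ball G B A t).card ∨ Fintype.card V < 2 * (ball G B A t).card := by
  induction l, hl using Nat.le_induction with
  | base =>
    intro t _ ht
    exact Or.inl (h1.trans (card_le_card (ball_mono ((one_le_growthTime l₀).trans ht))))
  | succ l hl ih =>
    intro t htR ht
    set m := 16 * (l + 3) ^ 2 with hm
    have hgt : growthTime l + m ≤ growthTime (l + 1) := by
      simp only [growthTime, hm]; nlinarith [sq_nonneg l]
    have key : ∀ j ≤ m, 2 ^ l * (m + j) ≤ m * (ball G B A (growthTime l + j)).card ∨
        2 ^ (l + 1) ≤ (ball G B A (growthTime l + j)).card ∨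
        Fintype.card V < 2 * (ball G B A (growthTime l + j)).card := by
      intro j
      induction j with
      | zero =>
        intro _
        rcases ih (growthTime l) (by omega) le_rfl with h | h
        · left; rw [add_zero, add_zero, mul_comm]; gcongr
        · exact Or.inr (Or.inr h)
      | succ j ihj =>
        intro hj
        have hmono := card_le_card (ball_subset_succ (G := G) (B := B) (A := A) (growthTime l + j))
        rcases ihj (by omega) with h | h | h
        · by_cases hc : 2 ^ (l + 1) ≤ (ball G B A (growthTime l + j)).card
          · exact Or.inr (Or.inl (hc.trans hmono))
          by_cases hc' : Fintype.card V < 2 * (ball G B A (growthTime l + j)).card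
          · exact Or.inr (Or.inr (by rw [← add_assoc]; omega))
          have h0 : 2 ^ l ≤ (ball G B A (growthTime l + j)).card := by
            rcases ih (growthTime l + j) (by omega) (by omega) with h | h
            · exact h
            · exact absurd h hc'
          have := le_card_nbrs_sdiff (B := B) hE h0 (by omega) (by omega)
            (hT _ (by omega) l hl (by omega))
          left
          have e : 2 ^ l * (m + (j + 1)) = 2 ^ l * (m + j) + 2 ^ l := by ring
          rw [← add_assoc (growthTime l), card_ball_succ, e, mul_add m]
          exact add_le_add h this
        · exact Or.inr (Or.inl (h.trans hmono))
        · exact Or.inr (Or.inr (by rw [← add_assoc]; omega))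
    have hmono := card_le_card (ball_mono (G := G) (B := B) (A := A) (hgt.trans ht))
    rcases key m le_rfl with h | h | h
    · left
      refine le_trans ?_ hmono
      have hm0 : 0 < m := by positivity
      have : m * 2 ^ (l + 1) ≤ m * (ball G B A (growthTime l + m)).card := by
        refine le_trans (le_of_eq ?_) h
        ring
      exact Nat.le_of_mul_le_mul_left this hm0
    · exact Or.inl (h.trans hmono)
    · exact Or.inr (by omega)

lemma ball_gt_half (hE : Expands G) {l₀ y : ℕ} (h1 : 2 ^ l₀ ≤ (ball G B A 1).card)
    (hy : Fintype.card V ≤ 2 ^ y) (hl : l₀ ≤ y) (hT : Thin G B A l₀ (growthTime y)) :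
    Fintype.card V < 2 * (ball G B A (growthTime y)).card := by
  have h0 : 0 < (ball G B A 1).card := lt_of_lt_of_le (by positivity) h1
  obtain ⟨v, -⟩ := card_pos.1 h0
  have : 0 < Fintype.card V := Fintype.card_pos_iff.2 ⟨v⟩
  rcases le_card_ball hE h1 hT hl _ le_rfl le_rfl with h | h <;> omega

lemma nbrs_sdiff_nonempty (hE : Expands G) {l₀ R : ℕ} (h1 : 2 ^ l₀ ≤ (ball G B A 1).card)
    (hT : Thin G B A l₀ R) {t : ℕ} (ht : 1 ≤ t) (htR : t < R)
    (hn : 2 * (ball G B A t).card ≤ Fintype.card V) :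
    (nbrs G (ball G B A t) \ B).Nonempty := by
  set X := ball G B A t with hX
  have h2 : 2 ^ l₀ ≤ X.card := h1.trans (card_le_card (ball_mono ht))
  have hX0 : X.card ≠ 0 := by have : 0 < 2 ^ l₀ := by positivity
                              omega
  have hl : l₀ ≤ Nat.log 2 X.card := Nat.le_log_of_pow_le (by norm_num) h2
  have hlt : X.card < 2 ^ (Nat.log 2 X.card + 1) := Nat.lt_pow_succ_log_self (by norm_num) _
  have hle : 2 ^ Nat.log 2 X.card ≤ X.card := Nat.pow_log_le_self 2 hX0
  have htl : t < growthTime (Nat.log 2 X.card + 1) := by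
    by_contra hc
    rcases le_card_ball hE h1 hT (Nat.le_succ_of_le hl) t htR.le (not_lt.1 hc) with h | h
    · exact absurd hlt (not_lt.2 h)
    · exact absurd hn (not_le.2 h)
  have := le_card_nbrs_sdiff (B := B) hE hle hlt.le hn (hT t htR _ hl htl)
  have h0 : 0 < 2 ^ Nat.log 2 X.card := by positivity
  rw [nonempty_iff_ne_empty]
  intro he
  rw [he] at this
  simp only [card_empty, mul_zero] at this
  omega

end Growth

section Linking

variable {V : Type*}

/-- The edges of the complete graph on `Fin h`, oriented upwards. -/
abbrev Pairs (h : ℕ) : Type := {p : Fin h × Fin h // p.1 < p.2}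

lemma card_pairs_le (h : ℕ) : Fintype.card (Pairs h) ≤ h ^ 2 := by
  refine (Fintype.card_subtype_le _).trans ?_
  simp [sq]

/-- For each pair, a sequence of `r + 1` vertices from one branch vertex to the other, such that
all the vertices involved are distinct. -/
structure IsRouting {h : ℕ} (φ : Fin h → V) (g : Pairs h → ℕ → V) (r : ℕ) : Prop where
  branch_inj : Function.Injective φ
  start_eq : ∀ e, g e 0 = φ e.1.1
  end_eq : ∀ e, g e r = φ e.1.2
  ne_branch : ∀ e i, 0 < i → i < r → ∀ k, g e i ≠ φ k
  inner_inj : ∀ e e' i i', 0 < i → i < r → 0 < i' → i' < r → g e i = g e' i' → e = e' ∧ i = i'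

/-- `H` contains a subdivision of the complete graph on `h` vertices in which every edge is
replaced by a path with `ℓ` edges. -/
def BalSub (H : SimpleGraph V) (h ℓ : ℕ) : Prop :=
  ∃ (φ : Fin h → V) (f : Pairs h → ℕ → V), IsRouting φ f ℓ ∧
    ∀ e, ∀ i < ℓ, H.Adj (f e i) (f e (i + 1))

/-- `S` contains the interior of a path with `n` edges from `x` to `y`, and it is small. -/
def Link (H : SimpleGraph V) (x y : V) (n : ℕ) (S : Finset V) : Prop :=
  S.card ≤ n + 1 ∧ ∃ p : H.Walk x y, p.IsPath ∧ p.length = n ∧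
    ∀ v ∈ p.support, v = x ∨ v = y ∨ v ∈ S

lemma exists_link {H : SimpleGraph V} {x y : V} {p : H.Walk x y} (hp : p.IsPath) :
    ∃ S, Link H x y p.length S ∧ ∀ v ∈ S, v ∈ p.support ∧ v ≠ x ∧ v ≠ y := by
  refine ⟨(p.support.toFinset.erase x).erase y, ⟨?_, p, hp, rfl, fun v hv => ?_⟩, fun v hv => ?_⟩
  · refine (card_le_card ((erase_subset _ _).trans (erase_subset _ _))).trans ?_
    exact (List.toFinset_card_le _).trans_eq p.length_support
  · by_cases h1 : v = x
    · exact Or.inl h1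
    by_cases h2 : v = y
    · exact Or.inr (Or.inl h2)
    exact Or.inr (Or.inr (by simp [h1, h2, hv]))
  · simp only [mem_erase, List.mem_toFinset] at hv
    exact ⟨hv.2.2, hv.2.1, hv.1⟩

lemma Link.symm {H : SimpleGraph V} {x y : V} {n : ℕ} {S : Finset V} (h : Link H x y n S) :
    Link H y x n S := by
  obtain ⟨h1, p, hp, hl, hs⟩ := h
  refine ⟨h1, p.reverse, hp.reverse, by simpa using hl, fun v hv => ?_⟩
  rw [SimpleGraph.Walk.support_reverse, List.mem_reverse] at hv
  have := hs v hv
  tauto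

lemma isPath_append {H : SimpleGraph V} {x y z : V} {p : H.Walk x y} {q : H.Walk y z}
    (hp : p.IsPath) (hq : q.IsPath) (h : ∀ v ∈ p.support, v ∈ q.support → v = y) :
    (p.append q).IsPath := by
  rw [SimpleGraph.Walk.isPath_def, SimpleGraph.Walk.support_append]
  refine List.Nodup.append hp.support_nodup hq.support_nodup.tail fun v hv hv' => ?_
  have hvy := h v hv (List.mem_of_mem_tail hv')
  have := hq.support_nodup
  rw [← SimpleGraph.Walk.cons_tail_support, List.nodup_cons] at this
  exact this.1 (hvy ▸ hv')

/-- Concatenation of a chain of links. -/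
lemma exists_concat_path {H : SimpleGraph V} {g : ℕ → V} {r : ℕ} {w : ℕ → ℕ} {S : ℕ → Finset V}
    (hg : ∀ i ≤ r, ∀ j ≤ r, g i = g j → i = j)
    (hS : ∀ i < r, ∀ j < r, i ≠ j → Disjoint (S i) (S j))
    (hSg : ∀ i < r, ∀ j ≤ r, g j ∉ S i)
    (hP : ∀ k < r, Link H (g k) (g (k + 1)) (w k) (S k)) (m : ℕ) (hm : m ≤ r) :
    ∃ p : H.Walk (g 0) (g m), p.IsPath ∧ p.length = ∑ k ∈ range m, w k ∧
      ∀ v ∈ p.support, (∃ k ≤ m, v = g k) ∨ ∃ k < m, v ∈ S k := by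
  induction m with
  | zero => exact ⟨.nil, by simp, by simp, by simp⟩
  | succ m ih =>
    obtain ⟨p, hp, hl, hs⟩ := ih (by omega)
    obtain ⟨-, q, hq, hql, hqs⟩ := hP m hm
    refine ⟨p.append q, isPath_append hp hq fun v hv hv' => ?_, ?_, fun v hv => ?_⟩
    · rcases hs v hv with ⟨k, hk, rfl⟩ | ⟨k, hk, hvk⟩ <;> rcases hqs _ hv' with h | h | h
      · exact h
      · have := hg k (by omega) (m + 1) hm h
        omega
      · exact absurd h (hSg m hm k (by omega))
      · exact h
      · exact absurd (h ▸ hvk) (hSg k (by omega) (m + 1) hm)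
      · exact absurd h (disjoint_left.1 (hS k (by omega) m hm (by omega)) hvk)
    · rw [SimpleGraph.Walk.length_append, hl, hql, sum_range_succ]
    · rw [SimpleGraph.Walk.mem_support_append_iff] at hv
      rcases hv with hv | hv
      · rcases hs v hv with ⟨k, hk, h⟩ | ⟨k, hk, h⟩
        · exact Or.inl ⟨k, by omega, h⟩
        · exact Or.inr ⟨k, by omega, h⟩
      · rcases hqs v hv with h | h | h
        · exact Or.inl ⟨m, by omega, h⟩
        · exact Or.inl ⟨m + 1, le_rfl, h⟩
        · exact Or.inr ⟨m, by omega, h⟩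

lemma IsRouting.inj {h r : ℕ} {φ : Fin h → V} {g : Pairs h → ℕ → V} (R : IsRouting φ g r)
    (e : Pairs h) {i j : ℕ} (hi : i ≤ r) (hj : j ≤ r) (hij : g e i = g e j) : i = j := by
  have key : ∀ i j, i < j → j ≤ r → g e i ≠ g e j := by
    intro i j hlt hj hij
    rcases Nat.eq_zero_or_pos i with rfl | hi0
    · rcases hj.eq_or_lt with rfl | hj
      · rw [R.start_eq, R.end_eq] at hij
        exact e.2.ne (R.branch_inj hij)
      · rw [R.start_eq] at hij
        exact R.ne_branch e j hlt hj _ hij.symm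
    · rcases hj.eq_or_lt with rfl | hj
      · rw [R.end_eq] at hij
        exact R.ne_branch e i hi0 hlt _ hij
      · have := (R.inner_inj e e i j hi0 (by omega) (by omega) hj hij).2
        omega
  rcases lt_trichotomy i j with h | h | h
  · exact absurd hij (key i j h hj)
  · exact h
  · exact absurd hij.symm (key j i h hi)

/-- Replacing the steps of a routing by disjoint links of constant total length gives a
balanced subdivision. -/
lemma IsRouting.balSub {H : SimpleGraph V} {h r Λ : ℕ} {φ : Fin h → V} {g : Pairs h → ℕ → V}
    (R : IsRouting φ g r) {w : Pairs h → ℕ → ℕ} {S : Pairs h → ℕ → Finset V}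
    (hP : ∀ e, ∀ k < r, Link H (g e k) (g e (k + 1)) (w e k) (S e k))
    (hS : ∀ e e', ∀ k < r, ∀ k' < r, (e ≠ e' ∨ k ≠ k') → Disjoint (S e k) (S e' k'))
    (hSg : ∀ e e', ∀ k < r, ∀ k' ≤ r, g e' k' ∉ S e k)
    (hSφ : ∀ e, ∀ k < r, ∀ x, φ x ∉ S e k)
    (hw : ∀ e, ∑ k ∈ range r, w e k = Λ) : BalSub H h Λ := by
  have hp : ∀ e, ∃ p : H.Walk (g e 0) (g e r), p.IsPath ∧ p.length = Λ ∧
      ∀ v ∈ p.support, (∃ k ≤ r, v = g e k) ∨ ∃ k < r, v ∈ S e k := by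
    intro e
    obtain ⟨p, h1, h2, h3⟩ := exists_concat_path (fun i hi j hj hij => R.inj e hi hj hij)
      (fun i hi j hj hij => hS e e i hi j hj (Or.inr hij)) (fun i hi j hj => hSg e e i hi j hj)
      (hP e) r le_rfl
    exact ⟨p, h1, by rw [h2, hw], h3⟩
  choose p hpath hlen hsupp using hp
  have hinner : ∀ e i, 0 < i → i < Λ → (∃ k, 0 < k ∧ k < r ∧ (p e).getVert i = g e k) ∨
      ∃ k < r, (p e).getVert i ∈ S e k := by
    intro e i hi0 hi
    rcases hsupp e _ ((p e).getVert_mem_support i) with ⟨k, hk, hk'⟩ | h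
    · left
      refine ⟨k, Nat.pos_of_ne_zero ?_, lt_of_le_of_ne hk ?_, hk'⟩
      · rintro rfl
        have := ((hpath e).getVert_eq_start_iff (i := i) (by rw [hlen]; omega)).1 hk'
        omega
      · rintro rfl
        have := ((hpath e).getVert_eq_end_iff (i := i) (by rw [hlen]; omega)).1 hk'
        rw [hlen] at this
        omega
    · exact Or.inr h
  refine ⟨φ, fun e i => (p e).getVert i, ⟨R.branch_inj, ?_, ?_, ?_, ?_⟩, ?_⟩
  · intro e
    simp [R.start_eq]
  · intro e
    show (p e).getVert Λ = _
    rw [← hlen e, SimpleGraph.Walk.getVert_length, R.end_eq]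
  · intro e i hi0 hi x hx
    rcases hinner e i hi0 hi with ⟨k, hk0, hk, h⟩ | ⟨k, hk, h⟩
    · exact R.ne_branch e k hk0 hk x (h ▸ hx)
    · exact hSφ e k hk x (hx ▸ h)
  · intro e e' i i' hi0 hi hi0' hi' (heq : (p e).getVert i = (p e').getVert i')
    have hee : e = e' := by
      rcases hinner e i hi0 hi with ⟨k, hk0, hk, h⟩ | ⟨k, hk, h⟩ <;>
        rcases hinner e' i' hi0' hi' with ⟨k', hk0', hk', h'⟩ | ⟨k', hk', h'⟩
      · exact (R.inner_inj e e' k k' hk0 hk hk0' hk' (by rw [← h, ← h', heq])).1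
      · rw [← heq, h] at h'
        exact absurd h' (hSg e' e k' hk' k hk.le)
      · rw [heq, h'] at h
        exact absurd h (hSg e e' k hk k' hk'.le)
      · by_contra hne
        rw [heq] at h
        exact disjoint_left.1 (hS e e' k hk k' hk' (Or.inl hne)) h h'
    subst hee
    refine ⟨rfl, (hpath e).getVert_injOn ?_ ?_ heq⟩ <;> simp only [Set.mem_ofPred_eq, hlen] <;> omega
  · intro e i hi
    exact (p e).adj_getVert_succ (by rw [hlen]; exact hi)

/-- Greedy choice of pairwise disjoint small sets. -/
lemma exists_disjoint_family {ι : Type*} [Fintype ι] {Good : ι → Finset V → Prop}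
    {prot : ι → Finset V} {k m : ℕ} (hm : Fintype.card ι * k ≤ m)
    (hG : ∀ i (W : Finset V), W.card ≤ m → Disjoint W (prot i) →
      ∃ S, Good i S ∧ S.card ≤ k ∧ Disjoint S W ∧ ∀ j ≠ i, Disjoint S (prot j)) :
    ∃ S : ι → Finset V, (∀ i, Good i (S i)) ∧ ∀ i j, i ≠ j → Disjoint (S i) (S j) := by
  have key : ∀ T : Finset ι, ∃ S : ι → Finset V, (∀ i ∈ T, Good i (S i) ∧ (S i).card ≤ k ∧
      ∀ j ≠ i, Disjoint (S i) (prot j)) ∧ ∀ i ∈ T, ∀ j ∈ T, i ≠ j → Disjoint (S i) (S j) := by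
    intro T
    induction T using Finset.induction_on with
    | empty => exact ⟨fun _ => ∅, by simp, by simp⟩
    | insert a T ha ih =>
      obtain ⟨S, h1, h2⟩ := ih
      have hW : (T.biUnion S).card ≤ m := by
        refine (card_biUnion_le_card_mul T S k fun i hi => (h1 i hi).2.1).trans (le_trans ?_ hm)
        gcongr
        exact card_le_univ T
      have hd : Disjoint (T.biUnion S) (prot a) := by
        rw [disjoint_biUnion_left]
        exact fun i hi => (h1 i hi).2.2 a (by rintro rfl; exact ha hi)
      obtain ⟨S', g1, g2, g3, g4⟩ := hG a _ hW hd
      rw [disjoint_biUnion_right] at g3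
      have hne : ∀ i ∈ T, i ≠ a := by rintro i hi rfl; exact ha hi
      refine ⟨Function.update S a S', ?_, ?_⟩
      · intro i hi
        rcases mem_insert.1 hi with rfl | hi
        · simpa using ⟨g1, g2, g4⟩
        · simpa [hne i hi] using h1 i hi
      · intro i hi j hj hij
        rcases mem_insert.1 hi with hia | hi' <;> rcases mem_insert.1 hj with hja | hj'
        · exact absurd (hia.trans hja.symm) hij
        · simpa [hia, hne j hj'] using g3 j hj'
        · simpa [hja, hne i hi'] using (g3 i hi').symm
        · simpa [hne i hi', hne j hj'] using h2 i hi' j hj' hij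
  obtain ⟨S, h1, h2⟩ := key univ
  exact ⟨S, fun i => (h1 i (mem_univ i)).1, fun i j => h2 i (mem_univ i) j (mem_univ j)⟩

/-- If all small sets can be avoided with some parameter, then a single parameter works for all
slightly smaller sets. -/
lemma exists_robust {P : ℕ → Finset V → Prop} (hmono : ∀ n W W', W ⊆ W' → P n W' → P n W)
    {A : Finset V} {m m' τ : ℕ} (hm : (τ + 1) * m' ≤ m)
    (hP : ∀ W : Finset V, W.card ≤ m → Disjoint W A → ∃ n ≤ τ, P n W) :
    ∃ n ≤ τ, ∀ W : Finset V, W.card ≤ m' → Disjoint W A → P n W := by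
  by_contra! hc
  choose! W hW1 hW2 hW3 using hc
  obtain ⟨n, hn, h⟩ := hP ((range (τ + 1)).biUnion W) (by
      refine (card_biUnion_le_card_mul _ _ m' fun i hi => hW1 i ?_).trans (by simpa using hm)
      have := mem_range.1 hi
      omega) (by
      rw [disjoint_biUnion_left]
      intro i hi
      have := mem_range.1 hi
      exact hW2 i (by omega))
  exact hW3 n hn (hmono n _ _ (subset_biUnion_of_mem W (mem_range.2 (by omega))) h)

end Linking

section DependentChoice

variable {V : Type*}

/-- A symmetric relation with few related pairs has a large independent set. -/
lemma exists_indep {Y : Finset V} {B : V → V → Prop} (hsymm : ∀ x y, B x y → B y x)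
    (hirr : ∀ x, ¬ B x x) {k h : ℕ} (hB : ∑ x ∈ Y, (Y.filter (B x)).card ≤ k * Y.card)
    (hY : 2 * (2 * k + 1) * h ≤ Y.card) :
    ∃ I ⊆ Y, I.card = h ∧ ∀ x ∈ I, ∀ y ∈ I, ¬ B x y := by
  set Y' := Y.filter fun x => (Y.filter (B x)).card ≤ 2 * k with hY'
  have h1 : Y.card ≤ 2 * Y'.card := by
    have h2 : (Y \ Y').card * (2 * k + 1) ≤ k * Y.card := by
      refine le_trans ?_ ((sum_le_sum_of_subset (sdiff_subset (s := Y) (t := Y'))).trans hB)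
      rw [← smul_eq_mul]
      refine card_nsmul_le_sum _ _ _ fun x hx => ?_
      simp only [hY', mem_sdiff, mem_filter, not_and, not_le] at hx
      exact hx.2 hx.1
    have h3 : (Y \ Y').card + Y'.card = Y.card := card_sdiff_add_card_eq_card (filter_subset _ Y)
    by_contra hc
    have h4 : Y.card + 1 ≤ 2 * (Y \ Y').card := by omega
    nlinarith
  obtain ⟨I, hI, hmax⟩ := exists_max_image
    (Y'.powerset.filter fun I => ∀ x ∈ I, ∀ y ∈ I, ¬ B x y) card ⟨∅, by simp⟩
  simp only [mem_filter, mem_powerset] at hI hmax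
  have hcov : Y' ⊆ I.biUnion fun x => insert x (Y.filter (B x)) := by
    intro y hy
    by_contra hc
    simp only [mem_biUnion, mem_insert, mem_filter, not_exists, not_and, not_or] at hc
    have hyI : y ∉ I := fun hyI => (hc y hyI).1 rfl
    have hyY : y ∈ Y := (mem_filter.1 hy).1
    have := hmax (insert y I) ⟨insert_subset hy hI.1, fun x hx z hz => by
      rcases mem_insert.1 hx with hx | hx <;> rcases mem_insert.1 hz with hz | hz
      · rw [hx, hz]
        exact hirr _
      · rw [hx]
        exact fun hb => (hc z hz).2 hyY (hsymm _ _ hb)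
      · rw [hz]
        exact (hc x hx).2 hyY
      · exact hI.2 x hx z hz⟩
    rw [card_insert_of_notMem hyI] at this
    omega
  have hcard : Y'.card ≤ I.card * (2 * k + 1) := by
    refine (card_le_card hcov).trans (card_biUnion_le_card_mul _ _ _ fun x hx => ?_)
    exact (card_insert_le _ _).trans (Nat.succ_le_succ (mem_filter.1 (hI.1 hx)).2)
  have hhI : h ≤ I.card := by
    have : (2 * (2 * k + 1)) * h ≤ (2 * (2 * k + 1)) * I.card := by nlinarith
    exact Nat.le_of_mul_le_mul_left this (by positivity)
  obtain ⟨J, hJ, hJc⟩ := exists_subset_card_eq hhI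
  exact ⟨J, hJ.trans (hI.1.trans (filter_subset _ _)), hJc,
    fun x hx y hy => hI.2 x (hJ hx) y (hJ hy)⟩

/-- Dependent random choice. -/
lemma exists_rich_set {Q : Finset V} {R : V → V → Prop} {h T K : ℕ} (hT : 0 < T) (hK : 0 < K)
    (hh : 0 < h) (hR : Q.card * (Q.card - 1) ≤ T * ∑ v ∈ Q, (Q.filter (R v)).card)
    (hQ : 8 * T * (8 * T * K + 1) * h ≤ Q.card) :
    ∃ I ⊆ Q, I.card = h ∧ ∀ x ∈ I, ∀ y ∈ I, x ≠ y →
      K ≤ (Q.filter fun z => R z x ∧ R z y).card := by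
  set N := Q.card with hN
  have hN2 : 2 ≤ N := by
    have : 1 ≤ T * (8 * T * K + 1) * h := by
      have : 0 < T * (8 * T * K + 1) * h := by positivity
      omega
    nlinarith
  obtain ⟨B, hB⟩ : ∃ B : V → V → Prop, ∀ x y, B x y ↔
      x ≠ y ∧ (Q.filter fun z => R z x ∧ R z y).card < K := ⟨_, fun _ _ => Iff.rfl⟩
  set D : V → Finset V := fun v => Q.filter (R v) with hD
  have hbad : ∑ v ∈ Q, ∑ x ∈ D v, ((D v).filter (B x)).card ≤ K * N ^ 2 := by
    have e : ∀ v, ∑ x ∈ D v, ((D v).filter (B x)).card =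
        ∑ x ∈ Q, ∑ y ∈ Q, if (R v x ∧ R v y) ∧ B x y then 1 else 0 := by
      intro v
      simp only [hD, sum_filter, card_filter]
      refine sum_congr rfl fun x _ => ?_
      by_cases hx : R v x
      · simp only [hx, if_true, true_and]
        refine sum_congr rfl fun y _ => ?_
        by_cases hy : R v y <;> simp [hy]
      · simp [hx]
    simp only [e]
    rw [sum_comm]
    have : ∀ x ∈ Q, ∑ v ∈ Q, ∑ y ∈ Q, (if (R v x ∧ R v y) ∧ B x y then 1 else 0) ≤ N * K := by
      intro x _
      rw [sum_comm]
      refine sum_le_card_nsmul _ _ _ fun y _ => ?_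
      by_cases hb : B x y
      · simp only [hb, and_true]
        rw [← card_filter]
        exact ((hB x y).1 hb).2.le
      · simp [hb]
    refine (sum_le_card_nsmul _ _ _ this).trans (le_of_eq ?_)
    simp only [smul_eq_mul, ← hN]
    ring
  have hex : ∃ v ∈ Q, (4 * T * K) * N + 4 * T * ∑ x ∈ D v, ((D v).filter (B x)).card ≤
      4 * T * (4 * T * K) * (D v).card := by
    by_contra! hc
    have hlt := sum_lt_sum_of_nonempty (card_pos.1 (by omega)) hc
    rw [← mul_sum, sum_add_distrib, ← mul_sum _ _ (4 * T), sum_const, smul_eq_mul, ← hN] at hlt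
    have h1 : N ^ 2 ≤ 2 * (N * (N - 1)) := by
      obtain ⟨M, hM⟩ := Nat.exists_eq_add_of_le hN2
      rw [hM, show 2 + M - 1 = M + 1 by omega]
      nlinarith
    have h2 : (16 * T * K) * N ^ 2 ≤ (32 * T * K) * (T * ∑ v ∈ Q, (D v).card) := by
      calc (16 * T * K) * N ^ 2 ≤ (16 * T * K) * (2 * (N * (N - 1))) := by gcongr
        _ = (32 * T * K) * (N * (N - 1)) := by ring
        _ ≤ _ := by gcongr
    have h3 := Nat.mul_le_mul_left (4 * T) hbad
    nlinarith
  obtain ⟨v, -, hv⟩ := hex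
  have hTK : 0 < 4 * T * K := by positivity
  have h1 : N ≤ 4 * T * (D v).card := by
    have : (4 * T * K) * N ≤ (4 * T * K) * (4 * T * (D v).card) :=
      (Nat.le_add_right _ _).trans (hv.trans (le_of_eq (by ring)))
    exact Nat.le_of_mul_le_mul_left this hTK
  have h2 : ∑ x ∈ D v, ((D v).filter (B x)).card ≤ (4 * T * K) * (D v).card := by
    have : (4 * T) * ∑ x ∈ D v, ((D v).filter (B x)).card ≤
        (4 * T) * ((4 * T * K) * (D v).card) :=
      (Nat.le_add_left _ _).trans (hv.trans (le_of_eq (by ring)))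
    exact Nat.le_of_mul_le_mul_left this (by positivity)
  obtain ⟨I, hI, hIc, hind⟩ := exists_indep (h := h) (B := B) (Y := D v) (k := 4 * T * K)
    (fun x y => by
      rw [hB, hB]
      exact fun ⟨a, b⟩ => ⟨a.symm, by simpa only [and_comm] using b⟩)
    (fun x hx => ((hB x x).1 hx).1 rfl) h2 (by
      have : (4 * T) * (2 * (2 * (4 * T * K) + 1) * h) ≤ (4 * T) * (D v).card := by
        refine le_trans (le_of_eq ?_) (hQ.trans h1)
        ring
      exact Nat.le_of_mul_le_mul_left this (by positivity))
  refine ⟨I, hI.trans (filter_subset _ _), hIc, fun x hx y hy hxy => ?_⟩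
  by_contra hc
  exact hind x hx y hy ((hB x y).2 ⟨hxy, not_le.1 hc⟩)

/-- The number of pairwise robustly linked vertices that force a balanced subdivision. -/
def hubCount (τ h : ℕ) : ℕ := 2 ^ 8 * (τ + 1) ^ 2 * h ^ 3

/-- The number of vertices that the links between hubs have to avoid. -/
def avoidCount (τ h : ℕ) : ℕ := 2 * (τ + 1) ^ 2 * h ^ 2

lemma BalSub.one_le {H : SimpleGraph V} {h ℓ : ℕ} (hh : 2 ≤ h) (hb : BalSub H h ℓ) : 1 ≤ ℓ := by
  obtain ⟨φ, f, R, -⟩ := hb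
  by_contra hc
  obtain rfl : ℓ = 0 := by omega
  have e : Pairs h := ⟨(⟨0, by omega⟩, ⟨1, by omega⟩), by simp⟩
  exact e.2.ne (R.branch_inj ((R.start_eq e).symm.trans (R.end_eq e)))

/-- Many vertices that are pairwise linked by short paths avoiding any small set yield a
balanced subdivision. -/
theorem balSub_of_hubs {H : SimpleGraph V} {h τ : ℕ} (hh : 2 ≤ h) {Q : Finset V}
    (hQ : hubCount τ h ≤ Q.card)
    (hlink : ∀ z ∈ Q, ∀ z' ∈ Q, z ≠ z' → ∀ W : Finset V, W.card ≤ avoidCount τ h →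
      ∃ n ≤ τ, ∃ S, Link H z z' n S ∧ Disjoint S W ∧ Disjoint S Q) :
    ∃ ℓ, BalSub H h ℓ := by
  set m := 2 * h ^ 2 * (τ + 1) with hm
  obtain ⟨R, hRdef⟩ : ∃ R : ℕ → V → V → Prop, ∀ n z z', R n z z' ↔ ∀ W : Finset V,
      W.card ≤ m → ∃ S, Link H z z' n S ∧ Disjoint S W ∧ Disjoint S Q :=
    ⟨_, fun _ _ _ => Iff.rfl⟩
  have hRsymm : ∀ n z z', R n z z' → R n z' z := by
    intro n z z' h2
    rw [hRdef] at h2 ⊢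
    intro W hW
    obtain ⟨S, hS, hS'⟩ := h2 W hW
    exact ⟨S, hS.symm, hS'⟩
  have hrob : ∀ z ∈ Q, ∀ z' ∈ Q, z ≠ z' → ∃ n ≤ τ, R n z z' := by
    intro z hz z' hz' hne
    obtain ⟨n, hn, h⟩ := exists_robust (A := ∅) (m := avoidCount τ h) (m' := m) (τ := τ)
      (P := fun n W => ∃ S, Link H z z' n S ∧ Disjoint S W ∧ Disjoint S Q)
      (fun n W W' hWW ⟨S, h1, h2, h3⟩ => ⟨S, h1, h2.mono_right hWW, h3⟩)
      (by rw [avoidCount, hm]; apply le_of_eq; ring)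
      (fun W hW _ => hlink z hz z' hz' hne W hW)
    exact ⟨n, hn, (hRdef n z z').2 fun W hW => h W hW (by simp)⟩
  have hcount : Q.card * (Q.card - 1) ≤ ∑ n ∈ range (τ + 1), ∑ v ∈ Q, (Q.filter (R n v)).card := by
    rw [sum_comm, ← smul_eq_mul]
    refine card_nsmul_le_sum _ _ _ fun z hz => ?_
    refine le_trans ?_ (card_biUnion_le (s := range (τ + 1)) (t := fun n => Q.filter (R n z)))
    rw [← card_erase_of_mem hz]
    refine card_le_card fun z' hz' => ?_
    obtain ⟨n, hn, h⟩ := hrob z hz z' (mem_of_mem_erase hz') (ne_of_mem_erase hz').symm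
    exact mem_biUnion.2 ⟨n, mem_range.2 (by omega), mem_filter.2 ⟨mem_of_mem_erase hz', h⟩⟩
  obtain ⟨n, hn, hnmax⟩ := exists_max_image (range (τ + 1))
    (fun n => ∑ v ∈ Q, (Q.filter (R n v)).card) ⟨0, by simp⟩
  have hn' : n ≤ τ := by have := mem_range.1 hn; omega
  have hR : Q.card * (Q.card - 1) ≤ (τ + 1) * ∑ v ∈ Q, (Q.filter (R n v)).card := by
    refine hcount.trans ((sum_le_card_nsmul _ _ _ hnmax).trans (by simp))
  obtain ⟨I, hIQ, hIc, hI⟩ := exists_rich_set (h := h) (K := 3 * h ^ 2) (T := τ + 1) (by omega)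
    (by positivity) (by omega) hR (by
      refine le_trans ?_ hQ
      rw [hubCount]
      have : 1 ≤ (τ + 1) * h ^ 2 := by have : 0 < (τ + 1) * h ^ 2 := by positivity
                                       omega
      calc 8 * (τ + 1) * (8 * (τ + 1) * (3 * h ^ 2) + 1) * h
          ≤ 8 * (τ + 1) * (8 * (τ + 1) * (3 * h ^ 2) + (τ + 1) * h ^ 2) * h := by gcongr
        _ = 200 * ((τ + 1) ^ 2 * h ^ 3) := by ring
        _ ≤ 256 * ((τ + 1) ^ 2 * h ^ 3) := by gcongr; norm_num
        _ = _ := by ring)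
  let φ : Fin h → V := fun i => ((I.equivFinOfCardEq hIc).symm i : V)
  have hφI : ∀ i, φ i ∈ I := fun i => ((I.equivFinOfCardEq hIc).symm i).2
  have hφinj : Function.Injective φ := fun i j hij => by
    simpa [φ, Subtype.ext_iff] using hij
  obtain ⟨M, hM, hMd⟩ := exists_disjoint_family (ι := Pairs h) (prot := fun _ => (∅ : Finset V))
    (Good := fun e S => ∃ z, S = {z} ∧ z ∈ Q ∧ z ∉ I ∧ R n z (φ e.1.1) ∧ R n z (φ e.1.2))
    (k := 1) (m := h ^ 2) (by simpa using card_pairs_le h) (by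
      intro e W hW _
      have h1 := hI _ (hφI e.1.1) _ (hφI e.1.2) (fun h => e.2.ne (hφinj h))
      have h2 : (W ∪ I).card < (Q.filter fun z => R n z (φ e.1.1) ∧ R n z (φ e.1.2)).card := by
        have := card_union_le W I
        nlinarith
      obtain ⟨z, hz, hz'⟩ := exists_mem_notMem_of_card_lt_card h2
      simp only [mem_union, not_or] at hz'
      obtain ⟨hzQ, hz1, hz2⟩ := mem_filter.1 hz
      exact ⟨{z}, ⟨z, rfl, hzQ, hz'.2, hz1, hz2⟩, by simp, by simpa using hz'.1, by simp⟩)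
  choose z hMz hzQ hzI hz1 hz2 using hM
  have hzinj : ∀ e e', z e = z e' → e = e' := by
    intro e e' hee
    by_contra hne
    have := hMd e e' hne
    rw [hMz, hMz, hee] at this
    simp at this
  let g : Pairs h → ℕ → V := fun e k => if k = 0 then φ e.1.1 else if k = 1 then z e else φ e.1.2
  have hgQ : ∀ e k, g e k ∈ Q := by
    intro e k
    simp only [g]
    split_ifs
    exacts [hIQ (hφI _), hzQ e, hIQ (hφI _)]
  have hg : IsRouting φ g 2 := by
    refine ⟨hφinj, fun e => rfl, fun e => rfl, ?_, ?_⟩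
    · intro e i h0 h2 k
      obtain rfl : i = 1 := by omega
      intro (h : z e = φ k)
      exact hzI e (h ▸ hφI k)
    · intro e e' i i' h0 h2 h0' h2' h
      obtain rfl : i = 1 := by omega
      obtain rfl : i' = 1 := by omega
      exact ⟨hzinj e e' h, rfl⟩
  have hgR : ∀ e, ∀ k < 2, R n (g e k) (g e (k + 1)) := by
    intro e k hk
    interval_cases k
    · exact hRsymm _ _ _ (hz1 e)
    · exact hz2 e
  obtain ⟨S, hS, hSd⟩ := exists_disjoint_family (ι := Pairs h × Fin 2)
    (prot := fun _ => (∅ : Finset V)) (k := τ + 1) (m := m)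
    (Good := fun i S => Link H (g i.1 i.2) (g i.1 (i.2 + 1)) n S ∧ Disjoint S Q) (by
      rw [Fintype.card_prod, Fintype.card_fin, hm]
      have := card_pairs_le h
      nlinarith) (by
      intro i W hW _
      obtain ⟨S, h1, h2, h3⟩ := (hRdef _ _ _).1 (hgR i.1 i.2 i.2.2) W hW
      exact ⟨S, ⟨h1, h3⟩, h1.1.trans (by omega), h2, by simp⟩)
  refine ⟨2 * n, hg.balSub (w := fun _ _ => n) (S := fun e k => if hk : k < 2 then S (e, ⟨k, hk⟩)
    else ∅) ?_ ?_ ?_ ?_ ?_⟩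
  · intro e k hk
    simp only [hk, dif_pos]
    exact (hS (e, ⟨k, hk⟩)).1
  · intro e e' k hk k' hk' hne
    simp only [hk, hk', dif_pos]
    refine hSd _ _ fun he => ?_
    simp only [Prod.mk.injEq, Fin.mk.injEq] at he
    tauto
  · intro e e' k hk k' _ hmem
    simp only [hk, dif_pos] at hmem
    exact disjoint_left.1 (hS _).2 hmem (hgQ _ _)
  · intro e k hk x hmem
    simp only [hk, dif_pos] at hmem
    exact disjoint_left.1 (hS _).2 hmem (hIQ (hφI x))
  · intro e
    simp

end DependentChoice

section Legs

variable {V : Type*}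

/-- A colouring of the ordered pairs of a large set is constant on a large product. -/
lemma exists_homogeneous {ι C A B : Type*} [Fintype ι] [Fintype C] [Nonempty C] [Fintype A]
    [Fintype B] (χ : ι → ι → C)
    (hcard : Fintype.card C * Fintype.card B + Fintype.card C *
      (Fintype.card C * Fintype.card B) ^ Fintype.card B * Fintype.card A ≤ Fintype.card ι) :
    ∃ (c : C) (L : A → ι) (R : B → ι), Function.Injective L ∧ Function.Injective R ∧
      (∀ a b, L a ≠ R b) ∧ ∀ a b, χ (L a) (R b) = c := by
  obtain ⟨X, -, hX⟩ := exists_subset_card_eq (s := (univ : Finset ι))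
    (n := Fintype.card C * Fintype.card B) (by rw [card_univ]; omega)
  have hmaj : ∀ i, ∃ (c : C) (R : B ↪ X), ∀ b, χ i (R b) = c := by
    intro i
    obtain ⟨c, -, hc⟩ := exists_le_card_fiber_of_mul_le_card_of_maps_to
      (s := (univ : Finset X)) (t := (univ : Finset C)) (f := fun x => χ i x)
      (n := Fintype.card B) (fun _ _ => mem_univ _) univ_nonempty (by simp [hX])
    obtain ⟨R, hR⟩ := Function.Embedding.exists_of_card_le_finset hc
    exact ⟨c, R, fun b => (mem_filter.1 (hR ⟨b, rfl⟩)).2⟩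
  choose col R hR using hmaj
  obtain ⟨⟨c, R₀⟩, -, hc⟩ := exists_le_card_fiber_of_mul_le_card_of_maps_to
    (s := (univ \ X : Finset ι)) (t := (univ : Finset (C × (B → X))))
    (f := fun i => (col i, (R i : B → X))) (n := Fintype.card A) (fun _ _ => mem_univ _)
    ⟨(Classical.arbitrary C, Classical.choice (by
      by_cases hB : Nonempty B
      · refine ⟨fun _ => Classical.choice ?_⟩
        rw [← Fintype.card_pos_iff, Fintype.card_coe, hX]
        exact Nat.mul_pos Fintype.card_pos Fintype.card_pos
      · exact ⟨fun b => absurd ⟨b⟩ hB⟩)), mem_univ _⟩ (by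
      rw [card_sdiff_of_subset (subset_univ X), card_univ, card_univ, Fintype.card_prod,
        Fintype.card_fun, Fintype.card_coe, hX]
      omega)
  obtain ⟨L, hL⟩ := Function.Embedding.exists_of_card_le_finset hc
  have hL' : ∀ a, L a ∉ X ∧ col (L a) = c ∧ (R (L a) : B → X) = R₀ := by
    intro a
    have := hL ⟨a, rfl⟩
    simpa using this
  by_cases hA : Nonempty A
  · obtain ⟨a₀⟩ := hA
    refine ⟨c, L, fun b => R₀ b, L.injective, ?_, ?_, ?_⟩
    · intro b b' hbb
      rw [← (hL' a₀).2.2] at hbb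
      exact (R (L a₀)).injective (Subtype.ext hbb)
    · intro a b h
      exact (hL' a).1 (h ▸ (R₀ b).2)
    · intro a b
      rw [← (hL' a).2.2, hR, (hL' a).2.1]
  · obtain ⟨f⟩ : Nonempty (B ↪ ι) := by
      refine Function.Embedding.nonempty_of_card_le ?_
      exact (Nat.le_mul_of_pos_left _ Fintype.card_pos).trans (le_of_add_le_left hcard)
    exact ⟨c, L, f, L.injective, f.injective, fun a => absurd ⟨a⟩ hA, fun a => absurd ⟨a⟩ hA⟩

lemma sum_range_two_mul (f : ℕ → ℕ) (h : ℕ) :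
    ∑ k ∈ range (2 * h), f k =
      ∑ j ∈ range h, f (2 * j) + ∑ j ∈ range h, f (2 * j + 1) := by
  induction h with
  | zero => simp
  | succ h ih =>
    rw [show 2 * (h + 1) = 2 * h + 1 + 1 by ring, sum_range_succ, sum_range_succ, ih,
      sum_range_succ, sum_range_succ]
    ring

/-- The number of colours of the link lengths between two units. -/
def colourCount (τ h : ℕ) : ℕ := ((τ + 1) ^ h) ^ h

/-- The number of units that force a balanced subdivision. -/
def unitCount (τ h : ℕ) : ℕ :=
  colourCount τ h * h ^ 3 + colourCount τ h * (colourCount τ h * h ^ 3) ^ h ^ 3 * (2 * h ^ 3)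

/-- The number of vertices that the links between units have to avoid. -/
def unitAvoidCount (τ h : ℕ) : ℕ := 2 * (τ + 1) ^ 2 * h ^ 3

/-- The leg of the left unit that is used by the link number `k`. -/
def outLeg {h : ℕ} [NeZero h] (e : Pairs h) (k : ℕ) : Fin h :=
  (if k % 2 = 0 then e.1.2 else e.1.1) + Fin.ofNat h ((k + 1) / 2)

/-- The left unit that is used by the link number `k`. -/
def leftNode {h : ℕ} (e : Pairs h) (J : ℕ) : Fin h ⊕ (Pairs h × Fin h) :=
  if J = 0 then Sum.inl e.1.1 else if hJ : J < h then Sum.inr (e, ⟨J, hJ⟩) else Sum.inl e.1.2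

lemma leg_inj {h : ℕ} [NeZero h] {e e' : Pairs h} {k k' : ℕ} (hk : k < 2 * h) (hk' : k' < 2 * h)
    (hn : leftNode e ((k + 1) / 2) = leftNode e' ((k' + 1) / 2)) (hl : outLeg e k = outLeg e' k') :
    e = e' ∧ k = k' := by
  have hz : ∀ J, J ≤ h → (J = 0 ∨ ¬ J < h) → Fin.ofNat h J = 0 := by
    intro J hJ h'
    apply Fin.ext
    rcases h' with rfl | h'
    · simp
    · obtain rfl : J = h := by omega
      simp
  have hne := e.2.ne
  have hne' := e'.2.ne
  have hlt := e.2
  have hlt' := e'.2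
  unfold leftNode at hn
  unfold outLeg at hl
  by_cases h1 : (k + 1) / 2 = 0
  · have ek : k = 0 := by omega
    rw [if_pos h1] at hn
    subst ek
    by_cases h2 : (k' + 1) / 2 = 0
    · have ek' : k' = 0 := by omega
      rw [if_pos h2] at hn
      subst ek'
      simp only [Sum.inl.injEq] at hn
      simp only [if_true, Nat.zero_mod, add_left_inj] at hl
      exact ⟨Subtype.ext (Prod.ext hn hl), rfl⟩
    · rw [if_neg h2] at hn
      by_cases h3 : (k' + 1) / 2 < h
      · rw [dif_pos h3] at hn; simp at hn
      · rw [dif_neg h3] at hn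
        have ek' : k' % 2 ≠ 0 := by omega
        rw [if_neg ek', hz _ (by omega) (Or.inl h1), hz _ (by omega) (Or.inr h3)] at hl
        simp only [Sum.inl.injEq] at hn
        simp only [if_true, Nat.zero_mod, add_zero] at hl
        rw [hn, hl] at hlt
        exact absurd hlt (not_lt.2 hlt'.le)
  · rw [if_neg h1] at hn
    by_cases h2 : (k + 1) / 2 < h
    · rw [dif_pos h2] at hn
      by_cases h3 : (k' + 1) / 2 = 0
      · rw [if_pos h3] at hn; simp at hn
      rw [if_neg h3] at hn
      by_cases h4 : (k' + 1) / 2 < h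
      · rw [dif_pos h4] at hn
        simp only [Sum.inr.injEq, Prod.mk.injEq, Fin.mk.injEq] at hn
        obtain ⟨rfl, hJ⟩ := hn
        rw [hJ, add_left_inj] at hl
        refine ⟨rfl, ?_⟩
        by_contra hkk
        split_ifs at hl with h5 h6 h6
        · omega
        · exact hne hl.symm
        · exact hne hl
        · omega
      · rw [dif_neg h4] at hn; simp at hn
    · have ek : k % 2 ≠ 0 := by omega
      rw [dif_neg h2] at hn
      rw [if_neg ek, hz _ (by omega) (Or.inr h2)] at hl
      by_cases h3 : (k' + 1) / 2 = 0
      · have ek' : k' % 2 = 0 := by omega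
        rw [if_pos h3] at hn
        rw [if_pos ek', hz _ (by omega) (Or.inl h3)] at hl
        simp only [Sum.inl.injEq] at hn
        simp only [add_zero] at hl
        rw [hn, hl] at hlt
        exact absurd hlt (not_lt.2 hlt'.le)
      · rw [if_neg h3] at hn
        by_cases h4 : (k' + 1) / 2 < h
        · rw [dif_pos h4] at hn; simp at hn
        · have ek' : k' % 2 ≠ 0 := by omega
          rw [dif_neg h4] at hn
          rw [if_neg ek', hz _ (by omega) (Or.inr h4)] at hl
          simp only [Sum.inl.injEq] at hn
          simp only [add_zero] at hl
          exact ⟨Subtype.ext (Prod.ext hl hn), by omega⟩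

lemma sum_outLeg {h : ℕ} [NeZero h] (lam : Fin h → ℕ → ℕ) (e : Pairs h) :
    ∑ k ∈ range (2 * h), lam (outLeg e k) (k % 2) = ∑ a, lam a 0 + ∑ a, lam a 1 := by
  rw [sum_range_two_mul, sum_range, sum_range]
  congr 1
  · rw [← Equiv.sum_comp (Equiv.addLeft e.1.2) fun a => lam a 0]
    refine sum_congr rfl fun j _ => ?_
    have : (2 * (j : ℕ) + 1) / 2 = j := by omega
    simp [outLeg, this]
  · rw [← Equiv.sum_comp ((Equiv.addRight (1 : Fin h)).trans (Equiv.addLeft e.1.1))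
      fun a => lam a 1]
    refine sum_congr rfl fun j _ => ?_
    have h1 : (2 * (j : ℕ) + 1 + 1) / 2 = j + 1 := by omega
    have h2 : (2 * (j : ℕ) + 1) % 2 = 1 := by omega
    have h3 : Fin.ofNat h (j + 1 : ℕ) = j + 1 := by
      apply Fin.ext
      simp [Fin.val_add]
    simp only [outLeg, h1, h2, h3]
    simp

/-- Many units, any two of which are robustly linked through any choice of their legs, yield a
balanced subdivision. -/
theorem balSub_of_units {H : SimpleGraph V} {h τ : ℕ} (hh : 2 ≤ h) {ι : Type*} [Fintype ι]
    (hι : unitCount τ h ≤ Fintype.card ι) {c : ι → V} {prot : ι → Fin h → Finset V}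
    (hc : Function.Injective c)
    (hlink : ∀ i x, i ≠ x → ∀ (a b : Fin h) (W : Finset V), W.card ≤ unitAvoidCount τ h →
      Disjoint W (prot i a ∪ prot x b) → ∃ n ≤ τ, ∃ S, Link H (c i) (c x) n S ∧ Disjoint S W ∧
        (∀ j, c j ∉ S) ∧
        ∀ j d, (j, d) ≠ (i, a) → (j, d) ≠ (x, b) → Disjoint S (prot j d)) :
    ∃ ℓ, BalSub H h ℓ := by
  have : NeZero h := ⟨by omega⟩
  set m := 2 * h ^ 3 * (τ + 1) with hm
  obtain ⟨P, hP⟩ : ∃ P : ι → Fin h → ι → Fin h → ℕ → Finset V → Prop, ∀ i a x b n W,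
      P i a x b n W ↔ ∃ S, Link H (c i) (c x) n S ∧ Disjoint S W ∧ (∀ j, c j ∉ S) ∧
        ∀ j d, (j, d) ≠ (i, a) → (j, d) ≠ (x, b) → Disjoint S (prot j d) :=
    ⟨_, fun _ _ _ _ _ _ => Iff.rfl⟩
  have hrob : ∀ i x a b, ∃ n : Fin (τ + 1), i ≠ x → ∀ W : Finset V, W.card ≤ m →
      Disjoint W (prot i a ∪ prot x b) → P i a x b n W := by
    intro i x a b
    by_cases hix : i = x
    · exact ⟨0, fun h => absurd hix h⟩
    obtain ⟨n, hn, h⟩ := exists_robust (A := prot i a ∪ prot x b) (m := unitAvoidCount τ h)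
      (m' := m) (τ := τ) (P := P i a x b)
      (fun n W W' hWW => by
        rw [hP, hP]
        exact fun ⟨S, h1, h2, h3⟩ => ⟨S, h1, h2.mono_right hWW, h3⟩)
      (by rw [unitAvoidCount, hm]; apply le_of_eq; ring)
      (fun W hW hd => by
        obtain ⟨n, hn, h⟩ := hlink i x hix a b W hW hd
        exact ⟨n, hn, (hP _ _ _ _ _ _).2 h⟩)
    exact ⟨⟨n, by omega⟩, fun _ => h⟩
  choose lam hlam using hrob
  have hB : Fintype.card (Pairs h × Fin h) ≤ h ^ 3 := by
    rw [Fintype.card_prod, Fintype.card_fin, pow_succ]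
    exact Nat.mul_le_mul_right _ (card_pairs_le h)
  have hA : Fintype.card (Fin h ⊕ (Pairs h × Fin h)) ≤ 2 * h ^ 3 := by
    rw [Fintype.card_sum, Fintype.card_fin]
    have : h ≤ h ^ 3 := Nat.le_self_pow (by norm_num) h
    omega
  have hC : Fintype.card (Fin h → Fin h → Fin (τ + 1)) = colourCount τ h := by
    simp [colourCount]
  obtain ⟨μ, L, R, hL, hR, hLR, hμ⟩ := exists_homogeneous (A := Fin h ⊕ (Pairs h × Fin h))
    (B := Pairs h × Fin h) (C := Fin h → Fin h → Fin (τ + 1)) lam (by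
      refine le_trans ?_ hι
      rw [hC, unitCount]
      have : 1 ≤ colourCount τ h := Nat.one_le_iff_ne_zero.2 (by unfold colourCount; positivity)
      have : 1 ≤ colourCount τ h * h ^ 3 := Nat.mul_pos this (by positivity)
      gcongr)
  let zero : Fin h := ⟨0, by omega⟩
  let one : Fin h := ⟨1, by omega⟩
  let inLeg : ℕ → Fin h := fun k => if k = 0 then zero else one
  let g : Pairs h → ℕ → V := fun e k =>
    if hk : k % 2 = 1 ∧ k / 2 < h then c (R (e, ⟨k / 2, hk.2⟩)) else c (L (leftNode e (k / 2)))
  have hgodd : ∀ e k (hk : k % 2 = 1) (hk' : k / 2 < h), g e k = c (R (e, ⟨k / 2, hk'⟩)) :=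
    fun e k hk hk' => dif_pos ⟨hk, hk'⟩
  have hgeven : ∀ e k, k % 2 = 0 → g e k = c (L (leftNode e (k / 2))) :=
    fun e k hk => dif_neg fun h => by omega
  have hleft : ∀ e k, 0 < k → k < 2 * h → k % 2 = 0 →
      ∃ hJ : k / 2 < h, leftNode e (k / 2) = Sum.inr (e, ⟨k / 2, hJ⟩) := by
    intro e k h0 h1 h2
    have hJ : k / 2 < h := by omega
    refine ⟨hJ, ?_⟩
    rw [leftNode, if_neg (by omega), dif_pos hJ]
  have hgc : ∀ e k, ∃ j, g e k = c j := by
    intro e k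
    simp only [g]
    split_ifs <;> exact ⟨_, rfl⟩
  have hrout : IsRouting (fun x => c (L (Sum.inl x))) g (2 * h) := by
    refine ⟨fun x y hxy => by simpa using hL (hc hxy), ?_, ?_, ?_, ?_⟩
    · intro e
      rw [hgeven e 0 rfl]
      simp [leftNode]
    · intro e
      rw [hgeven e _ (by omega), show 2 * h / 2 = h by omega, leftNode, if_neg (by omega),
        dif_neg (by omega)]
    · intro e i h0 hi x hx
      rcases Nat.mod_two_eq_zero_or_one i with h2 | h2
      · obtain ⟨hJ, hJ'⟩ := hleft e i h0 hi h2
        rw [hgeven e i h2, hJ'] at hx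
        simpa using hL (hc hx)
      · rw [hgodd e i h2 (by omega)] at hx
        exact hLR _ _ (hc hx).symm
    · intro e e' i i' h0 hi h0' hi' heq
      rcases Nat.mod_two_eq_zero_or_one i with h2 | h2 <;>
        rcases Nat.mod_two_eq_zero_or_one i' with h2' | h2'
      · obtain ⟨hJ, hJe⟩ := hleft e i h0 hi h2
        obtain ⟨hJ', hJe'⟩ := hleft e' i' h0' hi' h2'
        rw [hgeven e i h2, hgeven e' i' h2', hJe, hJe'] at heq
        have := hL (hc heq)
        simp only [Sum.inr.injEq, Prod.mk.injEq, Fin.mk.injEq] at this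
        exact ⟨this.1, by omega⟩
      · rw [hgeven e i h2, hgodd e' i' h2' (by omega)] at heq
        exact absurd (hc heq) (hLR _ _)
      · rw [hgeven e' i' h2', hgodd e i h2 (by omega)] at heq
        exact absurd (hc heq).symm (hLR _ _)
      · rw [hgodd e i h2 (by omega), hgodd e' i' h2' (by omega)] at heq
        have := hR (hc heq)
        simp only [Prod.mk.injEq, Fin.mk.injEq] at this
        exact ⟨this.1, by omega⟩
  -- the data of the link number `k`
  let lu : Pairs h × Fin (2 * h) → ι := fun i => L (leftNode i.1 ((i.2 + 1) / 2))
  let ru : Pairs h × Fin (2 * h) → ι := fun i => R (i.1, ⟨i.2 / 2, by omega⟩)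
  let w : Pairs h → ℕ → ℕ := fun e k => μ (outLeg e k) (inLeg (k % 2))
  obtain ⟨S, hS, hSd⟩ := exists_disjoint_family (ι := Pairs h × Fin (2 * h)) (k := τ + 1) (m := m)
    (prot := fun i => prot (lu i) (outLeg i.1 i.2) ∪ prot (ru i) (inLeg (i.2 % 2)))
    (Good := fun i S => Link H (c (lu i)) (c (ru i)) (w i.1 i.2) S ∧ ∀ j, c j ∉ S) (by
      rw [Fintype.card_prod, Fintype.card_fin, hm]
      refine Nat.mul_le_mul_right _ ?_
      calc Fintype.card (Pairs h) * (2 * h) ≤ h ^ 2 * (2 * h) :=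
            Nat.mul_le_mul_right _ (card_pairs_le h)
        _ = 2 * h ^ 3 := by ring) (by
      intro i W hW hd
      have h1 := hlam (lu i) (ru i) (outLeg i.1 i.2) (inLeg (i.2 % 2)) (hLR _ _) W hW hd
      rw [hμ, hP] at h1
      obtain ⟨S, h1, h2, h3, h4⟩ := h1
      refine ⟨S, ⟨h1, h3⟩, h1.1.trans ?_, h2, fun j hj => ?_⟩
      · have := (μ (outLeg i.1 i.2) (inLeg (i.2 % 2))).2
        omega
      · have hleft : (lu j, outLeg j.1 j.2) ≠ (lu i, outLeg i.1 i.2) := by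
          intro he
          simp only [Prod.mk.injEq] at he
          obtain ⟨e1, e2⟩ := leg_inj j.2.2 i.2.2 (hL he.1) he.2
          exact hj (Prod.ext e1 (Fin.ext e2))
        have hright : (ru j, inLeg (j.2 % 2)) ≠ (ru i, inLeg (i.2 % 2)) := by
          intro he
          simp only [Prod.mk.injEq] at he
          have e1 := hR he.1
          simp only [Prod.mk.injEq, Fin.mk.injEq] at e1
          refine hj (Prod.ext e1.1 (Fin.ext ?_))
          have e2 := he.2
          simp only [inLeg, zero, one] at e2
          split_ifs at e2 with h5 h6 h6
          · omega
          · simp at e2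
          · simp at e2
          · omega
        rw [disjoint_union_right]
        refine ⟨h4 _ _ hleft ?_, h4 _ _ ?_ hright⟩
        · intro he
          exact hLR _ _ (congrArg Prod.fst he)
        · intro he
          exact hLR _ _ (congrArg Prod.fst he).symm)
  refine ⟨∑ a, (μ a (inLeg 0) : ℕ) + ∑ a, (μ a (inLeg 1) : ℕ), hrout.balSub (w := w)
    (S := fun e k => if hk : k < 2 * h then S (e, ⟨k, hk⟩) else ∅) ?_ ?_ ?_ ?_ ?_⟩
  · intro e k hk
    simp only [hk, dif_pos]
    have h1 := (hS (e, ⟨k, hk⟩)).1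
    rcases Nat.mod_two_eq_zero_or_one k with h2 | h2
    · rw [hgeven e k h2, hgodd e (k + 1) (by omega) (by omega)]
      have e1 : (k + 1) / 2 = k / 2 := by omega
      simp only [lu, ru, e1] at h1 ⊢
      exact h1
    · rw [hgodd e k h2 (by omega), hgeven e (k + 1) (by omega)]
      exact h1.symm
  · intro e e' k hk k' hk' hne
    simp only [hk, hk', dif_pos]
    refine hSd _ _ fun he => ?_
    simp only [Prod.mk.injEq, Fin.mk.injEq] at he
    tauto
  · intro e e' k hk k' _ hmem
    simp only [hk, dif_pos] at hmem
    obtain ⟨j, hj⟩ := hgc e' k'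
    rw [hj] at hmem
    exact (hS _).2 j hmem
  · intro e k hk x hmem
    simp only [hk, dif_pos] at hmem
    exact (hS _).2 _ hmem
  · intro e
    exact sum_outLeg (fun a b => (μ a (inLeg b) : ℕ)) e

end Legs

section Extraction

/-- The number of ordered pairs of adjacent vertices in `T`. -/
noncomputable def orderedEdges {V : Type*} (G : SimpleGraph V) (T : Finset V) : ℕ :=
  ((T ×ˢ T).filter fun p => G.Adj p.1 p.2).card

lemma orderedEdges_induce {V : Type*} (G : SimpleGraph V) {S : Set V} (T : Finset S) :
    orderedEdges (G.induce S) T = orderedEdges G (T.map (Function.Embedding.subtype _)) := by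
  unfold orderedEdges
  refine card_bij (fun p _ => (p.1.1, p.2.1)) ?_ ?_ ?_
  · intro p hp
    simpa using hp
  · intro p _ q _ h
    simp only [Prod.mk.injEq] at h
    exact Prod.ext (Subtype.ext h.1) (Subtype.ext h.2)
  · intro p hp
    simp only [mem_filter, mem_product, mem_map, Function.Embedding.subtype_apply] at hp
    obtain ⟨⟨⟨a, ha, ha'⟩, ⟨b, hb, hb'⟩⟩, hab⟩ := hp
    refine ⟨(a, b), ?_, Prod.ext ha' hb'⟩
    simp only [mem_filter, mem_product, ha, hb, SimpleGraph.comap_adj, true_and]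
    rw [← ha', ← hb'] at hab
    exact hab

/-- A bounded increasing weight whose increments beat the sublinear expansion. -/
noncomputable def weight (t : ℝ) : ℝ := 2 - 1 / (1 + Real.logb 2 t)

lemma weight_mono {s t : ℝ} (hs : 1 ≤ s) (hst : s ≤ t) : weight s ≤ weight t := by
  have h1 : 0 ≤ Real.logb 2 s := Real.logb_nonneg (by norm_num) hs
  have h2 : Real.logb 2 s ≤ Real.logb 2 t :=
    Real.logb_le_logb_of_le (by norm_num) (by linarith) hst
  unfold weight
  gcongr

lemma one_le_weight {t : ℝ} (ht : 1 ≤ t) : 1 ≤ weight t := by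
  have h1 : 0 ≤ Real.logb 2 t := Real.logb_nonneg (by norm_num) ht
  have : 1 / (1 + Real.logb 2 t) ≤ 1 := by
    rw [div_le_one (by linarith)]
    linarith
  unfold weight
  linarith

lemma weight_le_two {t : ℝ} (ht : 1 ≤ t) : weight t ≤ 2 := by
  have h1 : 0 ≤ Real.logb 2 t := Real.logb_nonneg (by norm_num) ht
  have : 0 ≤ 1 / (1 + Real.logb 2 t) := by positivity
  unfold weight
  linarith

lemma weight_gap {x : ℝ} {L : ℕ} (hx : 1 ≤ x) (hL : x ≤ 2 ^ L) :
    1 / (2 * ((L : ℝ) + 2) ^ 2) ≤ weight (2 * x) - weight (5 / 4 * x) := by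
  set a := Real.logb 2 x with ha
  have ha0 : 0 ≤ a := Real.logb_nonneg (by norm_num) hx
  have haL : a ≤ L := by
    rw [ha, Real.logb_le_iff_le_rpow (by norm_num) (by linarith)]
    exact_mod_cast hL
  have h2 : Real.logb 2 (2 * x) = 1 + a := by
    rw [Real.logb_mul (by norm_num) (by linarith), Real.logb_self_eq_one (by norm_num)]
  have h3 : Real.logb 2 (5 / 4 * x) = Real.logb 2 (5 / 4) + a :=
    Real.logb_mul (by norm_num) (by linarith)
  set b := Real.logb 2 (5 / 4) with hb
  have hb0 : 0 ≤ b := Real.logb_nonneg (by norm_num) (by norm_num)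
  have hb1 : b ≤ 1 / 2 := by
    have : 2 * b ≤ 1 := by
      have e : 2 * b = Real.logb 2 ((5 / 4 : ℝ) ^ 2) := by
        rw [Real.logb_pow, hb]; norm_num
      rw [e, Real.logb_le_iff_le_rpow (by norm_num) (by norm_num)]
      norm_num
    linarith
  unfold weight
  rw [h2, h3]
  have e : (2 - 1 / (1 + (1 + a))) - (2 - 1 / (1 + (b + a))) =
      (1 - b) / ((2 + a) * (1 + b + a)) := by
    have : 1 + (1 + a) ≠ 0 := by positivity
    have : 1 + (b + a) ≠ 0 := by positivity
    have : 2 + a ≠ 0 := by positivity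
    have : 1 + b + a ≠ 0 := by positivity
    field_simp
    ring
  rw [e, div_le_div_iff₀ (by positivity) (by positivity)]
  have : (2 + a) * (1 + b + a) ≤ ((L : ℝ) + 2) * (L + 2) := by
    exact mul_le_mul (by linarith) (by linarith) (by linarith) (by positivity)
  nlinarith [sq_nonneg ((L : ℝ) + 2)]

variable {V : Type*} [Fintype V]

/-- The neighbourhood of a vertex, as a finite set. -/
noncomputable def nbhd (G : SimpleGraph V) (v : V) : Finset V := univ.filter (G.Adj v)

lemma mem_nbhd {G : SimpleGraph V} {v w : V} : w ∈ nbhd G v ↔ G.Adj v w := by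
  simp [nbhd]

lemma orderedEdges_univ_le (G : SimpleGraph V) (X : Finset V) :
    orderedEdges G univ ≤ orderedEdges G (univ \ X) + orderedEdges G (X ∪ nbrs G X) := by
  unfold orderedEdges
  refine le_trans (card_le_card fun p hp => ?_) (card_union_le _ _)
  have hadj := (mem_filter.1 hp).2
  simp only [mem_union, mem_filter, mem_product, mem_sdiff, mem_univ, true_and, mem_nbrs, hadj,
    and_true]
  by_cases h1 : p.1 ∈ X <;> by_cases h2 : p.2 ∈ X
  · exact Or.inr ⟨Or.inl h1, Or.inl h2⟩
  · exact Or.inr ⟨Or.inl h1, Or.inr ⟨h2, p.1, h1, hadj⟩⟩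
  · exact Or.inr ⟨Or.inr ⟨h1, p.2, h2, hadj.symm⟩, Or.inl h2⟩
  · exact Or.inl ⟨h1, h2⟩

lemma orderedEdges_univ_le_erase (G : SimpleGraph V) (v : V) :
    orderedEdges G univ ≤ orderedEdges G (univ.erase v) + 2 * (nbhd G v).card := by
  unfold orderedEdges
  have : (univ ×ˢ univ : Finset (V × V)).filter (fun p => G.Adj p.1 p.2) ⊆
      (((univ.erase v) ×ˢ (univ.erase v)).filter fun p => G.Adj p.1 p.2) ∪
      ((nbhd G v).image (fun y => (v, y)) ∪
        (nbhd G v).image (fun y => (y, v))) := by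
    intro p hp
    have hadj := (mem_filter.1 hp).2
    obtain ⟨x, y⟩ := p
    simp only [mem_union, mem_filter, mem_product, mem_erase, mem_univ, and_true, hadj, mem_image, mem_nbhd,
      Prod.mk.injEq]
    by_cases h1 : x = v
    · subst h1
      exact Or.inr (Or.inl ⟨y, hadj, rfl, rfl⟩)
    by_cases h2 : y = v
    · subst h2
      exact Or.inr (Or.inr ⟨x, hadj.symm, rfl, rfl⟩)
    · exact Or.inl ⟨h1, h2⟩
  refine (card_le_card this).trans ((card_union_le _ _).trans ?_)
  have h1 := card_union_le ((nbhd G v).image (fun y => (v, y)))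
    ((nbhd G v).image (fun y => (y, v)))
  have h2 := card_image_le (s := nbhd G v) (f := fun y => (v, y))
  have h3 := card_image_le (s := nbhd G v) (f := fun y => (y, v))
  omega

variable {G : SimpleGraph V} {Φ : ℝ}

lemma expands_of_optimal (hΦ : 0 < Φ)
    (huniv : Φ * (Fintype.card V * weight (Fintype.card V)) ≤ orderedEdges G univ)
    (hle : ∀ T : Finset V, T.Nonempty → (orderedEdges G T : ℝ) ≤ Φ * (T.card * weight T.card)) :
    Expands G := by
  intro X L hX hXL hXn
  set x := X.card with hx
  set ν := (nbrs G X).card with hν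
  set n := Fintype.card V with hn
  have hx1 : 1 ≤ x := card_pos.2 hX
  by_cases hc : x ≤ 4 * ν
  · refine hc.trans (Nat.mul_le_mul_right _ ?_)
    nlinarith [Nat.zero_le L]
  have hsd : (univ \ X).card = n - x := by rw [card_sdiff_of_subset (subset_univ X), card_univ]
  have hun : (X ∪ nbrs G X).card = x + ν := by
    refine card_union_of_disjoint (disjoint_left.2 fun y hy hy' => (mem_nbrs.1 hy').1 hy)
  have h1 := hle (univ \ X) (card_pos.1 (by rw [hsd]; omega))
  have h2 := hle (X ∪ nbrs G X) (hX.mono subset_union_left)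
  have h3 : (orderedEdges G univ : ℝ) ≤ orderedEdges G (univ \ X) +
      orderedEdges G (X ∪ nbrs G X) := by exact_mod_cast orderedEdges_univ_le G X
  rw [hsd, Nat.cast_sub (by omega)] at h1
  rw [hun, Nat.cast_add] at h2
  have h4 : (n : ℝ) * weight n ≤ (n - x) * weight (n - x) + (x + ν) * weight (x + ν) := by
    have : Φ * (n * weight n) ≤ Φ * ((n - x) * weight (n - x) + (x + ν) * weight (x + ν)) := by
      linarith
    exact le_of_mul_le_mul_left this hΦ
  have hx1' : (1 : ℝ) ≤ x := by exact_mod_cast hx1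
  have hxn' : 2 * (x : ℝ) ≤ n := by exact_mod_cast hXn
  have hν' : 4 * (ν : ℝ) ≤ x := by
    have : 4 * ν ≤ x := by omega
    exact_mod_cast this
  have hν0 : (0 : ℝ) ≤ ν := by positivity
  have h5 : weight ((n : ℝ) - x) ≤ weight n := weight_mono (by linarith) (by linarith)
  have h6 : weight ((x : ℝ) + ν) ≤ weight (5 / 4 * x) := weight_mono (by linarith) (by linarith)
  have h7 : weight (2 * (x : ℝ)) ≤ weight n := weight_mono (by linarith) hxn'
  have h8 : weight ((x : ℝ) + ν) ≤ 2 := weight_le_two (by linarith)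
  have h9 := weight_gap (x := x) (L := L) hx1' (by exact_mod_cast hXL)
  have h10 : (x : ℝ) * (1 / (2 * ((L : ℝ) + 2) ^ 2)) ≤ 2 * ν := by
    have h11 : (n - x : ℝ) * weight (n - x) ≤ (n - x) * weight n := by
      apply mul_le_mul_of_nonneg_left h5; linarith
    have h12 : (x : ℝ) * (1 / (2 * ((L : ℝ) + 2) ^ 2)) ≤ x * (weight n - weight (x + ν)) := by
      apply mul_le_mul_of_nonneg_left _ (by linarith); linarith
    have h13 : (ν : ℝ) * weight (x + ν) ≤ ν * 2 := mul_le_mul_of_nonneg_left h8 hν0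
    linarith
  rw [mul_one_div, div_le_iff₀ (by positivity)] at h10
  have : (x : ℝ) ≤ 8 * ((L : ℝ) + 2) ^ 2 * ν := by nlinarith [sq_nonneg ((L : ℝ) + 2)]
  exact_mod_cast this

lemma le_degree_of_optimal (hΦ : 0 < Φ)
    (huniv : Φ * (Fintype.card V * weight (Fintype.card V)) ≤ orderedEdges G univ)
    (hle : ∀ T : Finset V, T.Nonempty → (orderedEdges G T : ℝ) ≤ Φ * (T.card * weight T.card))
    (v : V) : Φ ≤ 2 * (nbhd G v).card := by
  set n := Fintype.card V with hn
  have hn1 : 1 ≤ n := Fintype.card_pos_iff.2 ⟨v⟩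
  have hn1' : (1 : ℝ) ≤ n := by exact_mod_cast hn1
  have h1 : (orderedEdges G univ : ℝ) ≤ orderedEdges G (univ.erase v) +
      2 * (nbhd G v).card := by exact_mod_cast orderedEdges_univ_le_erase G v
  have h2 : (orderedEdges G (univ.erase v) : ℝ) ≤ Φ * ((n - 1) * weight n) := by
    have hw := one_le_weight hn1'
    rcases (univ.erase v).eq_empty_or_nonempty with he | he
    · rw [he]
      have : orderedEdges G (∅ : Finset V) = 0 := by simp [orderedEdges]
      rw [this, Nat.cast_zero]
      exact mul_nonneg hΦ.le (mul_nonneg (by linarith) (by linarith))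
    · have hc : (univ.erase v).card = n - 1 := by rw [card_erase_of_mem (mem_univ v), card_univ]
      have h3 := hle _ he
      have h4 : 1 ≤ n - 1 := by rw [← hc]; exact card_pos.2 he
      rw [hc, Nat.cast_sub hn1, Nat.cast_one] at h3
      have h4' : (1 : ℝ) ≤ n - 1 := by
        have : ((1 : ℕ) : ℝ) ≤ ((n - 1 : ℕ) : ℝ) := by exact_mod_cast h4
        rwa [Nat.cast_sub hn1, Nat.cast_one] at this
      refine h3.trans (mul_le_mul_of_nonneg_left ?_ hΦ.le)
      exact mul_le_mul_of_nonneg_left (weight_mono h4' (by linarith)) (by linarith)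
  have hw := one_le_weight hn1'
  nlinarith

/-- Every graph has an expanding induced subgraph of large minimum degree. -/
theorem exists_expander (G : SimpleGraph V) {D : ℕ} (hD : 0 < D) [Nonempty V]
    (hG : D * Fintype.card V ≤ orderedEdges G univ) :
    ∃ S : Finset V, S.Nonempty ∧ Expands (G.induce (S : Set V)) ∧
      ∀ v, D ≤ 4 * (nbhd (G.induce (S : Set V)) v).card := by
  obtain ⟨S, hS, hmax⟩ := exists_max_image (univ.filter fun S : Finset V => S.Nonempty)
    (fun S => (orderedEdges G S : ℝ) / (S.card * weight S.card))
    ⟨univ, by simp⟩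
  simp only [mem_filter, mem_univ, true_and] at hS hmax
  set Φ := (orderedEdges G S : ℝ) / (S.card * weight S.card) with hΦdef
  have hpos : ∀ T : Finset V, T.Nonempty → (0 : ℝ) < T.card * weight T.card := by
    intro T hT
    have h1 : (1 : ℝ) ≤ T.card := by exact_mod_cast card_pos.2 hT
    have h2 := one_le_weight h1
    positivity
  have hΦD : (D : ℝ) ≤ 2 * Φ := by
    have h1 := hmax univ univ_nonempty
    have h2 : (1 : ℝ) ≤ (univ : Finset V).card := by exact_mod_cast card_pos.2 univ_nonempty
    have h3 := weight_le_two h2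
    rw [div_le_iff₀ (hpos univ univ_nonempty)] at h1
    have h4 : (D : ℝ) * (univ : Finset V).card ≤ orderedEdges G univ := by
      rw [card_univ]; exact_mod_cast hG
    have h0 : 0 ≤ Φ := div_nonneg (by positivity) (hpos S hS).le
    have h5 : (D : ℝ) * (univ : Finset V).card ≤ (2 * Φ) * (univ : Finset V).card := by
      calc _ ≤ _ := h4
        _ ≤ _ := h1
        _ ≤ Φ * ((univ : Finset V).card * 2) := by gcongr
        _ = _ := by ring
    exact le_of_mul_le_mul_right h5 (by linarith)
  have hΦ : 0 < Φ := by
    have : (1 : ℝ) ≤ D := by exact_mod_cast hD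
    linarith
  have hcardS : Fintype.card (S : Set V) = S.card := by simp
  have huniv : Φ * (Fintype.card (S : Set V) * weight (Fintype.card (S : Set V))) ≤
      orderedEdges (G.induce (S : Set V)) univ := by
    rw [orderedEdges_induce, hcardS, hΦdef, div_mul_cancel₀ _ (hpos S hS).ne']
    refine le_of_eq (congrArg (fun T => (orderedEdges G T : ℝ)) ?_)
    ext v
    simp
  have hle : ∀ T : Finset (S : Set V), T.Nonempty →
      (orderedEdges (G.induce (S : Set V)) T : ℝ) ≤ Φ * (T.card * weight T.card) := by
    intro T hT
    have h1 := hmax (T.map (Function.Embedding.subtype _)) (hT.map)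
    rw [div_le_iff₀ (hpos _ hT.map), card_map] at h1
    rw [orderedEdges_induce]
    exact h1
  refine ⟨S, hS, expands_of_optimal hΦ huniv hle, fun v => ?_⟩
  have h1 := le_degree_of_optimal hΦ huniv hle v
  have h2 : (D : ℝ) ≤ 4 * (nbhd (G.induce (S : Set V)) v).card := by linarith
  exact_mod_cast h2

lemma BalSub.of_induce {V : Type*} {G : SimpleGraph V} {S : Set V} {h ℓ : ℕ}
    (hb : BalSub (G.induce S) h ℓ) : BalSub G h ℓ := by
  obtain ⟨φ, f, R, hf⟩ := hb
  refine ⟨fun x => φ x, fun e i => f e i, ⟨fun x y hxy => R.branch_inj (Subtype.ext hxy), ?_, ?_,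
    ?_, ?_⟩, fun e i hi => hf e i hi⟩
  · exact fun e => congrArg Subtype.val (R.start_eq e)
  · exact fun e => congrArg Subtype.val (R.end_eq e)
  · exact fun e i h0 hi k hk => R.ne_branch e i h0 hi k (Subtype.ext hk)
  · exact fun e e' i i' h0 hi h0' hi' h => R.inner_inj e e' i i' h0 hi h0' hi' (Subtype.ext h)

end Extraction

section Hubs

variable {V : Type*}

/-- A maximal separated set. -/
lemma exists_separated {X : Finset V} {N : V → V → Prop} (hsymm : ∀ x ∈ X, ∀ y, N x y → N y x)
    (hrefl : ∀ x, N x x) {k : ℕ} (hk : ∀ x ∈ X, (X.filter (N x)).card ≤ k) :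
    ∃ P ⊆ X, (∀ x ∈ P, ∀ y ∈ P, x ≠ y → ¬ N x y) ∧ X.card ≤ P.card * k := by
  obtain ⟨P, hP, hmax⟩ := exists_max_image
    (X.powerset.filter fun P => ∀ x ∈ P, ∀ y ∈ P, x ≠ y → ¬ N x y) card ⟨∅, by simp⟩
  simp only [mem_filter, mem_powerset] at hP hmax
  refine ⟨P, hP.1, hP.2, ?_⟩
  have hcov : X ⊆ P.biUnion fun x => X.filter (N x) := by
    intro y hy
    by_contra hc
    simp only [mem_biUnion, mem_filter, not_exists, not_and] at hc
    have hyP : y ∉ P := fun hyP => hc y hyP hy (hrefl y)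
    have := hmax (insert y P) ⟨insert_subset hy hP.1, fun x hx z hz hxz => by
      rcases mem_insert.1 hx with hx | hx <;> rcases mem_insert.1 hz with hz | hz
      · exact absurd (hx.trans hz.symm) hxz
      · rw [hx]
        exact fun hn => hc z hz hy (hsymm y hy z hn)
      · rw [hz]
        exact hc x hx hy
      · exact hP.2 x hx z hz hxz⟩
    rw [card_insert_of_notMem hyP] at this
    omega
  exact (card_le_card hcov).trans (card_biUnion_le_card_mul _ _ _ fun x hx => hk x (hP.1 hx))


/-- The vertices of `B` that have a neighbour in `X`. -/
noncomputable def touch (G : SimpleGraph V) (X B : Finset V) : Finset V :=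
  B.filter fun y => ∃ x ∈ X, G.Adj x y

variable {G : SimpleGraph V} {B B' X X' Z : Finset V}

lemma mem_touch {y : V} : y ∈ touch G X B ↔ y ∈ B ∧ ∃ x ∈ X, G.Adj x y := by
  simp [touch]

lemma touch_mono (hX : X ⊆ X') (hB : B ⊆ B') : touch G X B ⊆ touch G X' B' := by
  intro y hy
  obtain ⟨h1, x, hx, h2⟩ := mem_touch.1 hy
  exact mem_touch.2 ⟨hB h1, x, hX hx, h2⟩

lemma touch_subset : touch G X B ⊆ B := filter_subset _ _

lemma touch_union : touch G X (B ∪ B') = touch G X B ∪ touch G X B' := filter_union _ _ _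

variable [Fintype V]

lemma nbrs_inter_subset_touch : nbrs G X ∩ B ⊆ touch G X B := by
  intro y hy
  obtain ⟨h1, h2⟩ := mem_inter.1 hy
  exact mem_touch.2 ⟨h2, (mem_nbrs.1 h1).2⟩

lemma thin_of_touch {A : Finset V} {l₀ R : ℕ} (h : ∀ t < R, ∀ l, l₀ ≤ l → t < growthTime (l + 1) →
    16 * (l + 3) ^ 2 * (touch G (ball G B A t) B).card ≤ 2 ^ l) : Thin G B A l₀ R :=
  fun t ht l hl htl => (Nat.mul_le_mul_left _ (card_le_card nbrs_inter_subset_touch)).trans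
    (h t ht l hl htl)

lemma card_nbhd_le_ball_one (v : V) :
    (nbhd G v).card ≤ (ball G B {v} 1).card + (touch G {v} B).card := by
  refine (card_le_card fun w hw => ?_).trans (card_union_le _ _)
  have hw' := mem_nbhd.1 hw
  by_cases hB : w ∈ B
  · exact mem_union_right _ (mem_touch.2 ⟨hB, v, mem_singleton_self v, hw'⟩)
  · exact mem_union_left _ (mem_ball_succ_of_adj (mem_ball_self v 0) hw' hB)

/-- A polynomial inequality that persists under increasing the exponent. -/
lemma sq_mul_le_two_pow {b l l' : ℕ} (h : 16 * (l + 3) ^ 2 * b ≤ 2 ^ l) (hl : l ≤ l') :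
    16 * (l' + 3) ^ 2 * b ≤ 2 ^ l' := by
  induction l', hl using Nat.le_induction with
  | base => exact h
  | succ l' _ ih =>
    have : (l' + 1 + 3) ^ 2 ≤ 2 * (l' + 3) ^ 2 := by nlinarith
    calc 16 * (l' + 1 + 3) ^ 2 * b ≤ 16 * (2 * (l' + 3) ^ 2) * b := by gcongr
      _ = 2 * (16 * (l' + 3) ^ 2 * b) := by ring
      _ ≤ 2 * 2 ^ l' := by gcongr
      _ = 2 ^ (l' + 1) := by ring

/-- Many vertices of high degree in an expander yield a balanced subdivision. -/
theorem balSub_of_high_degree (hE : Expands G) {h y l τ b : ℕ} (hh : 2 ≤ h)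
    (hy : Fintype.card V ≤ 2 ^ y) (hτ : τ = 2 * growthTime y)
    (hb : b = hubCount τ h + avoidCount τ h) (hl : 16 * (l + 3) ^ 2 * b ≤ 2 ^ l)
    {Q₀ : Finset V} (hQ₀ : hubCount τ h ≤ Q₀.card)
    (hdeg : ∀ v ∈ Q₀, 2 ^ l + b ≤ (nbhd G v).card) : ∃ ℓ, BalSub G h ℓ := by
  obtain ⟨Q, hQQ, hQ⟩ := exists_subset_card_eq hQ₀
  refine balSub_of_hubs (τ := τ) hh hQ.ge fun z hz z' hz' hne W hW => ?_
  set B := W ∪ Q with hB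
  have hBc : B.card ≤ b := by
    refine (card_union_le W Q).trans ?_
    omega
  have hlarge : ∀ v ∈ Q, Fintype.card V < 2 * (ball G B {v} (growthTime y)).card := by
    intro v hv
    have h1 := hdeg v (hQQ hv)
    have h2 := card_nbhd_le_ball_one (G := G) (B := B) v
    have h3 := card_le_card (touch_subset (G := G) (X := {v}) (B := B))
    have hly : l ≤ y := by
      have : 2 ^ l ≤ 2 ^ y := by
        have := card_le_univ (nbhd G v)
        omega
      exact (Nat.pow_le_pow_iff_right (by norm_num)).1 this
    refine ball_gt_half hE (l₀ := l) (by omega) hy hly (thin_of_touch fun t _ l' hl' _ => ?_)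
    refine le_trans (Nat.mul_le_mul_left _ ?_) (sq_mul_le_two_pow hl hl')
    exact (card_le_card touch_subset).trans hBc
  obtain ⟨p, hp, hpl, hps⟩ := exists_path_of_large_balls (hlarge z hz) (hlarge z' hz')
  obtain ⟨S, hS, hS'⟩ := exists_link hp
  refine ⟨p.length, by omega, S, hS, ?_, ?_⟩ <;> rw [disjoint_left] <;> intro v hv hv' <;>
    obtain ⟨h1, h2, h3⟩ := hS' v hv <;> rcases hps v h1 with h | h | h
  · exact h2 h
  · exact h3 h
  · exact h (mem_union_left _ hv')
  · exact h2 h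
  · exact h3 h
  · exact h (mem_union_right _ hv')

lemma card_ball_le {K : ℕ} (hK : ∀ v ∉ Z, (nbhd G v).card < K) {u : V} (hu : u ∉ Z) (t : ℕ) :
    (ball G Z {u} t).card ≤ K ^ t := by
  induction t with
  | zero => simp [ball]
  | succ t ih =>
    have hsub : ball G Z {u} (t + 1) ⊆
        (ball G Z {u} t).biUnion fun x => insert x (nbhd G x) := by
      intro v hv
      rcases mem_ball_succ hv with h | ⟨-, x, hx, hxv⟩
      · exact mem_biUnion.2 ⟨v, h, mem_insert_self _ _⟩
      · exact mem_biUnion.2 ⟨x, hx, mem_insert_of_mem (mem_nbhd.2 hxv)⟩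
    calc _ ≤ _ := card_le_card hsub
      _ ≤ (ball G Z {u} t).card * K := card_biUnion_le_card_mul _ _ _ fun x hx =>
          (card_insert_le _ _).trans (hK x (notMem_of_mem_ball hu hx))
      _ ≤ K ^ t * K := by gcongr
      _ = _ := by ring

lemma exists_walk_of_touch {t : ℕ} {p z z' : V} (hz : z ∈ touch G (ball G Z {p} t) Z)
    (hz' : z' ∈ touch G (ball G Z {p} t) Z) :
    ∃ w : G.Walk z z', w.IsPath ∧ w.length ≤ 2 * t + 2 ∧
      ∀ v ∈ w.support, v = z ∨ v = z' ∨ v ∈ ball G Z {p} t := by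
  obtain ⟨-, x, hx, hxz⟩ := mem_touch.1 hz
  obtain ⟨-, x', hx', hxz'⟩ := mem_touch.1 hz'
  obtain ⟨w, hw, hs⟩ := exists_walk_of_mem_ball hx
  obtain ⟨w', hw', hs'⟩ := exists_walk_of_mem_ball hx'
  refine ⟨(SimpleGraph.Walk.cons hxz.symm (w.reverse.append (w'.concat hxz'))).bypass,
    SimpleGraph.Walk.bypass_isPath _, ?_, fun v hv => ?_⟩
  · refine (SimpleGraph.Walk.length_bypass_le_length _).trans ?_
    simp only [SimpleGraph.Walk.length_cons, SimpleGraph.Walk.length_append,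
      SimpleGraph.Walk.length_reverse, SimpleGraph.Walk.length_concat]
    omega
  · have := SimpleGraph.Walk.support_bypass_subset_support _ hv
    rw [SimpleGraph.Walk.support_cons, List.mem_cons, SimpleGraph.Walk.mem_support_append_iff,
      SimpleGraph.Walk.support_reverse, List.mem_reverse, SimpleGraph.Walk.support_concat,
      List.mem_append, List.mem_singleton] at this
    rcases this with h | h | h | h
    · exact Or.inl h
    · exact Or.inr (Or.inr (hs v h))
    · exact Or.inr (Or.inr (hs' v h))
    · exact Or.inr (Or.inl h)

/-- The vertices whose balls see many vertices of `Z`. -/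
noncomputable def crowded (G : SimpleGraph V) (Z : Finset V) (h R : ℕ) : Finset V :=
  univ.filter fun v => v ∉ Z ∧ ∃ t ≤ R,
    hubCount (2 * t + 2) h ≤ (touch G (ball G Z {v} t) Z).card

/-- If many balls see many vertices of a small set `Z`, then there is a balanced subdivision. -/
theorem balSub_of_crowded {h K R : ℕ} (hh : 2 ≤ h) (hK : ∀ v ∉ Z, (nbhd G v).card < K)
    (hK0 : 0 < K) (hZ0 : 0 < Z.card)
    (hC : (R + 1) * (Z.card ^ hubCount (2 * R + 2) h * (avoidCount (2 * R + 2) h + 1) *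
      K ^ (2 * R)) ≤ (crowded G Z h R).card) : ∃ ℓ, BalSub G h ℓ := by
  have hf : ∀ v ∈ crowded G Z h R, ∃ t ≤ R,
      hubCount (2 * t + 2) h ≤ (touch G (ball G Z {v} t) Z).card :=
    fun v hv => (mem_filter.1 hv).2.2
  choose! f hfR hf using hf
  obtain ⟨t, ht, hX⟩ := exists_le_card_fiber_of_mul_le_card_of_maps_to
    (s := crowded G Z h R) (t := range (R + 1)) (f := f)
    (n := Z.card ^ hubCount (2 * R + 2) h * (avoidCount (2 * R + 2) h + 1) * K ^ (2 * R))
    (fun v hv => mem_range.2 (Nat.lt_succ_of_le (hfR v hv))) ⟨0, by simp⟩ (by simpa using hC)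
  have htR : t ≤ R := by have := mem_range.1 ht; omega
  set X := (crowded G Z h R).filter fun v => f v = t with hXdef
  have hXmem : ∀ v ∈ X, v ∉ Z ∧ hubCount (2 * t + 2) h ≤ (touch G (ball G Z {v} t) Z).card := by
    intro v hv
    obtain ⟨h1, h2⟩ := mem_filter.1 hv
    have h3 := hf v h1
    rw [h2] at h3
    exact ⟨(mem_filter.1 h1).2.1, h3⟩
  obtain ⟨N, hN⟩ : ∃ N : V → V → Prop, ∀ x y, N x y ↔ y ∈ ball G Z {x} (2 * t) :=
    ⟨_, fun _ _ => Iff.rfl⟩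
  obtain ⟨P, hPX, hP, hPc⟩ := exists_separated (X := X) (N := N) (k := K ^ (2 * R))
    (fun x hx y hy => (hN y x).2 (mem_ball_symm (hXmem x hx).1 ((hN x y).1 hy)))
    (fun x => (hN x x).2 (mem_ball_self x _)) (fun x hx => by
      refine (card_le_card fun y hy => (hN x y).1 (mem_filter.1 hy).2).trans
        ((card_ball_le hK (hXmem x hx).1 (2 * t)).trans ?_)
      gcongr)
  have hPcard : Z.card ^ hubCount (2 * t + 2) h * (avoidCount (2 * t + 2) h + 1) ≤ P.card := by
    have h1 := hX.trans hPc
    have h2 : Z.card ^ hubCount (2 * R + 2) h * (avoidCount (2 * R + 2) h + 1) ≤ P.card :=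
      Nat.le_of_mul_le_mul_right h1 (by positivity)
    refine le_trans ?_ h2
    have e1 : hubCount (2 * t + 2) h ≤ hubCount (2 * R + 2) h := by unfold hubCount; gcongr
    have e2 : avoidCount (2 * t + 2) h ≤ avoidCount (2 * R + 2) h := by unfold avoidCount; gcongr
    gcongr
  have hsub : ∀ v, ∃ Q : Finset V, v ∈ P →
      Q ⊆ touch G (ball G Z {v} t) Z ∧ Q.card = hubCount (2 * t + 2) h := by
    intro v
    by_cases hv : v ∈ P
    · obtain ⟨Q, h1, h2⟩ := exists_subset_card_eq (hXmem v (hPX hv)).2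
      exact ⟨Q, fun _ => ⟨h1, h2⟩⟩
    · exact ⟨∅, fun h => absurd h hv⟩
  choose Qf hQf using hsub
  have hPne : P.Nonempty := by
    refine card_pos.1 (lt_of_lt_of_le ?_ hPcard)
    positivity
  obtain ⟨Q, hQmem, hQc⟩ := exists_le_card_fiber_of_mul_le_card_of_maps_to
    (s := P) (t := Z.powersetCard (hubCount (2 * t + 2) h)) (f := Qf)
    (n := avoidCount (2 * t + 2) h + 1)
    (fun v hv => mem_powersetCard.2 ⟨(hQf v hv).1.trans touch_subset, (hQf v hv).2⟩)
    (by
      obtain ⟨v, hv⟩ := hPne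
      exact ⟨Qf v, mem_powersetCard.2 ⟨(hQf v hv).1.trans touch_subset, (hQf v hv).2⟩⟩) (by
      refine le_trans (Nat.mul_le_mul_right _ ?_) hPcard
      rw [card_powersetCard]
      exact Nat.choose_le_pow _ _)
  obtain ⟨hQZ, hQcard⟩ := mem_powersetCard.1 hQmem
  refine balSub_of_hubs (τ := 2 * t + 2) hh hQcard.ge fun z hz z' hz' hne W hW => ?_
  obtain ⟨p, hp, hpW⟩ : ∃ p ∈ P.filter (fun v => Qf v = Q), Disjoint (ball G Z {p} t) W := by
    by_contra! hc
    have hc' : ∀ p ∈ P.filter (fun v => Qf v = Q), ∃ x, x ∈ ball G Z {p} t ∧ x ∈ W :=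
      fun p hp => not_disjoint_iff.1 (hc p hp)
    choose! f hf1 hf2 using hc'
    have hle : (P.filter fun v => Qf v = Q).card ≤ W.card := by
      refine card_le_card_of_injOn f (fun p hp => hf2 p hp) fun p hp q hq hpq => ?_
      by_contra hne
      have hp' := mem_filter.1 hp
      have hq' := mem_filter.1 hq
      have h1 := hf1 p hp
      have h2 := hf1 q hq
      rw [← hpq] at h2
      refine hP p hp'.1 q hq'.1 hne ((hN p q).2 ?_)
      rw [two_mul]
      exact mem_ball_trans h1 (mem_ball_symm (hXmem q (hPX hq'.1)).1 h2)
    omega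
  obtain ⟨hpP, hpQ⟩ := mem_filter.1 hp
  have hsub := (hQf p hpP).1
  rw [hpQ] at hsub
  obtain ⟨w, hw, hwl, hws⟩ := exists_walk_of_touch (hsub hz) (hsub hz')
  obtain ⟨S, hS, hS'⟩ := exists_link hw
  have hin : ∀ v ∈ S, v ∈ ball G Z {p} t := fun v hv => by
    obtain ⟨h1, h2, h3⟩ := hS' v hv
    have := hws v h1
    tauto
  refine ⟨w.length, hwl, S, hS, disjoint_left.2 fun v hv => disjoint_left.1 hpW (hin v hv),
    disjoint_left.2 fun v hv hvQ => ?_⟩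
  exact notMem_of_mem_ball (hXmem p (hPX hpP)).1 (hin v hv) (hQZ hvQ)

end Hubs

section Spiders

variable {V : Type*} {G : SimpleGraph V} {B Z : Finset V}

/-- The union of the first `a` stems. -/
noncomputable def stems (p : ℕ → ℕ → V) (ρ : ℕ → ℕ) (a : ℕ) : Finset V :=
  (range a).biUnion fun d => (Icc 1 (ρ d)).image (p d)

lemma mem_stems {p : ℕ → ℕ → V} {ρ : ℕ → ℕ} {a : ℕ} {v : V} :
    v ∈ stems p ρ a ↔ ∃ d < a, ∃ j, 1 ≤ j ∧ j ≤ ρ d ∧ p d j = v := by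
  simp [stems, and_assoc]

lemma stems_mono {p : ℕ → ℕ → V} {ρ : ℕ → ℕ} {a a' : ℕ} (h : a ≤ a') :
    stems p ρ a ⊆ stems p ρ a' :=
  biUnion_subset_biUnion_of_subset_left _ (range_mono h)

lemma card_touch_union_le (X B B' : Finset V) :
    (touch G X (B ∪ B')).card ≤ (touch G X B).card + (touch G X B').card := by
  rw [touch_union]
  exact card_union_le _ _

variable [Fintype V]

/-- The sequence `p` follows a shortest path from `u` avoiding `B`, up to distance `ρ`. -/
structure Geodesic (G : SimpleGraph V) (B : Finset V) (u : V) (p : ℕ → V) (ρ : ℕ) : Prop where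
  zero : p 0 = u
  adj : ∀ j < ρ, G.Adj (p j) (p (j + 1))
  mem : ∀ j ≤ ρ, p j ∈ ball G B {u} j
  level : ∀ j ≤ ρ, ∀ i, p j ∈ ball G B {u} i → j ≤ i

lemma exists_geodesic {u y : V} {ρ : ℕ} (hy : y ∈ ball G B {u} ρ)
    (hmin : ∀ i, y ∈ ball G B {u} i → ρ ≤ i) : ∃ p, Geodesic G B u p ρ := by
  suffices ∃ p, Geodesic G B u p ρ ∧ p ρ = y from this.imp fun _ h => h.1
  induction ρ generalizing y with
  | zero =>
    obtain rfl := mem_singleton.1 hy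
    refine ⟨fun _ => y, ⟨rfl, by simp, ?_, ?_⟩, rfl⟩
    · intro j _
      exact mem_ball_self _ _
    · intro j hj i _
      omega
  | succ ρ ih =>
    rcases mem_ball_succ hy with h | ⟨hyB, x, hx, hxy⟩
    · have := hmin ρ h
      omega
    · obtain ⟨p, hp, hpx⟩ := ih hx fun i hi => by
        have := hmin (i + 1) (mem_ball_succ_of_adj hi hxy hyB)
        omega
      refine ⟨fun j => if j ≤ ρ then p j else y, ⟨by simp [hp.zero], ?_, ?_, ?_⟩, by simp⟩
      · intro j hj
        by_cases h : j + 1 ≤ ρ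
        · simp only [h, show j ≤ ρ by omega, if_true]
          exact hp.adj j h
        · obtain rfl : j = ρ := by omega
          simpa [hpx] using hxy
      · intro j hj
        by_cases h : j ≤ ρ
        · simp only [h, if_true]
          exact hp.mem j h
        · obtain rfl : j = ρ + 1 := by omega
          simpa using hy
      · intro j hj i hi
        by_cases h : j ≤ ρ
        · simp only [h, if_true] at hi
          exact hp.level j h i hi
        · obtain rfl : j = ρ + 1 := by omega
          exact hmin i (by simpa using hi)

lemma Geodesic.exists_walk {u : V} {p : ℕ → V} {ρ : ℕ} (hp : Geodesic G B u p ρ) {j : ℕ}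
    (hj : j ≤ ρ) : ∃ w : G.Walk u (p j), w.length ≤ j ∧
      ∀ v ∈ w.support, v = u ∨ v ∈ (Icc 1 ρ).image p := by
  induction j with
  | zero =>
    rw [hp.zero]
    exact ⟨.nil, by simp, by simp⟩
  | succ j ih =>
    obtain ⟨w, hw, hs⟩ := ih (by omega)
    refine ⟨w.concat (hp.adj j hj), by simpa using hw, fun v hv => ?_⟩
    rw [SimpleGraph.Walk.support_concat, List.mem_append, List.mem_singleton] at hv
    rcases hv with hv | rfl
    · exact hs v hv
    · exact Or.inr (mem_image_of_mem _ (mem_Icc.2 ⟨by omega, hj⟩))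

lemma notMem_stems {p : ℕ → ℕ → V} {ρ : ℕ → ℕ} {u : V} {m : ℕ}
    (hp : ∀ d < m, Geodesic G (Z ∪ stems p ρ d) u (p d) (ρ d)) : u ∉ stems p ρ m := by
  intro hu
  obtain ⟨d, hd, j, h1, h2, h3⟩ := mem_stems.1 hu
  have := (hp d hd).level j h2 0 (by rw [h3]; exact mem_ball_self _ _)
  omega

lemma card_touch_stems_le {p : ℕ → ℕ → V} {ρ : ℕ → ℕ} {u : V} {m t : ℕ} (hu : u ∉ Z)
    (hp : ∀ d < m, Geodesic G (Z ∪ stems p ρ d) u (p d) (ρ d)) :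
    (touch G (ball G (Z ∪ stems p ρ m) {u} t) (stems p ρ m)).card ≤ m * (t + 1) := by
  have hsub : touch G (ball G (Z ∪ stems p ρ m) {u} t) (stems p ρ m) ⊆
      (range m).biUnion fun d => (Icc 1 (t + 1)).image (p d) := by
    intro y hy
    obtain ⟨hy, x, hx, hxy⟩ := mem_touch.1 hy
    obtain ⟨d, hd, j, h1, h2, rfl⟩ := mem_stems.1 hy
    have hu' : u ∉ Z ∪ stems p ρ d := by
      rw [mem_union, not_or]
      exact ⟨hu, notMem_stems fun d' hd' => hp d' (hd'.trans hd)⟩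
    have hyB := notMem_of_mem_ball hu' ((hp d hd).mem j h2)
    have hx' := ball_anti (union_subset_union subset_rfl (stems_mono hd.le)) subset_rfl t hx
    have := (hp d hd).level j h2 (t + 1) (mem_ball_succ_of_adj hx' hxy hyB)
    exact mem_biUnion.2 ⟨d, mem_range.2 hd, mem_image_of_mem _ (mem_Icc.2 ⟨h1, this⟩)⟩
  refine (card_le_card hsub).trans ((card_biUnion_le_card_mul _ _ (t + 1) fun d _ => ?_).trans
    (by simp))
  exact card_image_le.trans (by simp)

/-- Vertex `u` is the start of `h` geodesics, each avoiding the previous ones. -/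
lemma exists_geodesics (hE : Expands G) {h l₀ K : ℕ} {κ ρ : ℕ → ℕ} {u : V} (hu : u ∉ Z)
    (hκ : ∀ t ≤ ρ 0, (touch G (ball G Z {u} t) Z).card ≤ κ t)
    (hρ : Antitone ρ) (hρ2 : ∀ a < h, 2 ≤ ρ a)
    (hK : ∀ v ∉ Z, (nbhd G v).card < K) (hn : 2 * K ^ ρ 0 ≤ Fintype.card V)
    (hdeg : 2 ^ l₀ + κ 0 + h ≤ (nbhd G u).card)
    (hl : ∀ l ≥ l₀, ∀ t < growthTime (l + 1), 16 * (l + 3) ^ 2 * (κ t + h * (t + 1)) ≤ 2 ^ l) :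
    ∃ p : ℕ → ℕ → V, ∀ a < h, Geodesic G (Z ∪ stems p ρ a) u (p a) (ρ a) := by
  suffices ∀ m ≤ h, ∃ p : ℕ → ℕ → V, ∀ a < m, Geodesic G (Z ∪ stems p ρ a) u (p a) (ρ a) from
    this h le_rfl
  intro m
  induction m with
  | zero => exact fun _ => ⟨fun _ _ => u, by simp⟩
  | succ m ih =>
    intro hm
    obtain ⟨p, hp⟩ := ih (by omega)
    set B := Z ∪ stems p ρ m with hB
    have hcount : ∀ t ≤ ρ 0, (touch G (ball G B {u} t) B).card ≤ κ t + h * (t + 1) := by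
      intro t ht
      refine (card_touch_union_le _ _ _).trans (Nat.add_le_add ?_ ?_)
      · exact (card_le_card (touch_mono (ball_anti subset_union_left subset_rfl t)
          subset_rfl)).trans (hκ t ht)
      · exact (card_touch_stems_le hu hp).trans (Nat.mul_le_mul_right _ (by omega))
    have h1 : 2 ^ l₀ ≤ (ball G B {u} 1).card := by
      have h2 := card_nbhd_le_ball_one (G := G) (B := B) u
      have h3 := hcount 0 (Nat.zero_le _)
      simp only [ball] at h2 h3 ⊢
      omega
    have hρm := hρ2 m hm
    have hρ0 : ρ m ≤ ρ 0 := hρ (Nat.zero_le m)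
    obtain ⟨y, hy⟩ := nbrs_sdiff_nonempty hE (R := ρ m) (t := ρ m - 1) h1
      (thin_of_touch fun t ht l hl' htl => (Nat.mul_le_mul_left _ (hcount t (by omega))).trans
        (hl l hl' t htl)) (by omega) (by omega) (by
        have h3 := (card_le_card (ball_anti (G := G) (B := Z) (B' := B) subset_union_left
          (subset_refl {u}) (ρ m - 1))).trans (card_ball_le hK hu (ρ m - 1))
        have h4 : K ^ (ρ m - 1) ≤ K ^ ρ 0 := Nat.pow_le_pow_right
          (by have := hK u hu; omega) (by omega)
        omega)
    obtain ⟨hy1, hyB⟩ := mem_sdiff.1 hy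
    obtain ⟨hy1, x, hx, hxy⟩ := mem_nbrs.1 hy1
    have hym := mem_ball_succ_of_adj hx hxy hyB
    rw [show ρ m - 1 + 1 = ρ m by omega] at hym
    obtain ⟨q, hq⟩ := exists_geodesic hym fun i hi => by
      by_contra hc
      exact hy1 (ball_mono (by omega) hi)
    have hst : ∀ a ≤ m, stems (Function.update p m q) ρ a = stems p ρ a := by
      intro a ha
      refine biUnion_congr rfl fun d hd => ?_
      have := mem_range.1 hd
      rw [Function.update_of_ne (by omega)]
    refine ⟨Function.update p m q, fun a ha => ?_⟩
    rw [hst a (by omega)]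
    rcases Nat.lt_succ_iff_lt_or_eq.1 ha with ha | rfl
    · rw [Function.update_of_ne ha.ne]
      exact hp a ha
    · rw [Function.update_self]
      exact hq

/-- A centre `c` with `h` disjoint stems `σ` ending in `e`, around whose ends there is space. -/
structure IsSpider (G : SimpleGraph V) (Z : Finset V) (h D R : ℕ) (c : V) (σ : Fin h → Finset V)
    (e : Fin h → V) : Prop where
  notMem : c ∉ Z
  walk : ∀ a, ∃ w : G.Walk c (e a), w.length ≤ D ∧ ∀ v ∈ w.support, v = c ∨ v ∈ σ a
  stem_subset : ∀ a, σ a ⊆ ball G Z {c} D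
  centre_notMem : ∀ a, c ∉ σ a
  stem_disjoint : ∀ a b, a ≠ b → Disjoint (σ a) (σ b)
  card_stem : ∀ a, (σ a).card ≤ D
  end_mem : ∀ a, e a ∈ σ a
  touch_le : ∀ a, ∀ t < R, (touch G (ball G (Z ∪ insert c (univ.biUnion σ)) {e a} t)
    (insert c (univ.biUnion σ))).card ≤ 1 + h * (2 * t + 3)
  apart : ∀ a b, a ≠ b → Disjoint (ball G (Z ∪ insert c (univ.biUnion σ)) {e a} R)
    (ball G (Z ∪ insert c (univ.biUnion σ)) {e b} R)

section Geodesics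

variable {h R : ℕ} {ρ : ℕ → ℕ} {p : ℕ → ℕ → V} {u : V}

lemma geodesic_notMem (hu : u ∉ Z)
    (hp : ∀ a < h, Geodesic G (Z ∪ stems p ρ a) u (p a) (ρ a)) {a d j : ℕ} (ha : a < h)
    (hd : d ≤ a) (hj : j ≤ ρ a) : p a j ∉ Z ∪ stems p ρ d := by
  have hu' : u ∉ Z ∪ stems p ρ a := by
    rw [mem_union, not_or]
    exact ⟨hu, notMem_stems fun d' hd' => hp d' (hd'.trans ha)⟩
  exact fun hm => notMem_of_mem_ball hu' ((hp a ha).mem j hj)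
    (union_subset_union subset_rfl (stems_mono hd) hm)

lemma geodesic_mem (hp : ∀ a < h, Geodesic G (Z ∪ stems p ρ a) u (p a) (ρ a)) {a d j : ℕ}
    (ha : a < h) (hd : d ≤ a) (hj : j ≤ ρ a) : p a j ∈ ball G (Z ∪ stems p ρ d) {u} j :=
  ball_anti (union_subset_union subset_rfl (stems_mono hd)) subset_rfl j ((hp a ha).mem j hj)

/-- The part of a union of geodesics that is seen by a small ball around the end of one of them. -/
lemma card_touch_geodesics_le (hu : u ∉ Z)
    (hp : ∀ a < h, Geodesic G (Z ∪ stems p ρ a) u (p a) (ρ a))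
    (hρ : ∀ a b, a < b → b < h → ρ b + R < ρ a) {a t : ℕ} (ha : a < h) (ht : t < R)
    (hB : Z ∪ stems p ρ h ⊆ B) :
    (touch G (ball G B {p a (ρ a)} t) (stems p ρ h)).card ≤ h * (2 * t + 3) := by
  have hlev : ∀ d, ∃ r, d ≤ a → p a (ρ a) ∈ ball G (Z ∪ stems p ρ d) {u} r ∧
      ∀ i, p a (ρ a) ∈ ball G (Z ∪ stems p ρ d) {u} i → r ≤ i := by
    intro d
    by_cases hd : d ≤ a
    · have : ∃ r, p a (ρ a) ∈ ball G (Z ∪ stems p ρ d) {u} r :=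
        ⟨ρ a, geodesic_mem hp ha hd le_rfl⟩
      exact ⟨Nat.find this, fun _ => ⟨Nat.find_spec this, fun i hi => Nat.find_min' this hi⟩⟩
    · exact ⟨0, fun h => absurd h hd⟩
  choose r hr using hlev
  have hsub : touch G (ball G B {p a (ρ a)} t) (stems p ρ h) ⊆
      (range h).biUnion fun d => (Icc (r d - (t + 1)) (r d + t + 1)).image (p d) := by
    intro y hy
    obtain ⟨hy, x, hx, hxy⟩ := mem_touch.1 hy
    obtain ⟨d, hd, j, h1, h2, rfl⟩ := mem_stems.1 hy
    have key : ∀ f ≤ a, f ≤ d → p a (ρ a) ∈ ball G (Z ∪ stems p ρ f) {u} (j + 1 + t) := by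
      intro f hf hfd
      have hBf : Z ∪ stems p ρ f ⊆ B :=
        (union_subset_union subset_rfl (stems_mono (hf.trans ha.le))).trans hB
      have hx' := ball_anti hBf subset_rfl t hx
      have hend := geodesic_notMem hu hp ha hf le_rfl
      have hxB := notMem_of_mem_ball hend hx'
      exact mem_ball_trans (mem_ball_succ_of_adj (geodesic_mem hp hd hfd h2) hxy.symm hxB)
        (mem_ball_symm hend hx')
    rcases le_or_gt d a with hda | hda
    · have hBd : Z ∪ stems p ρ d ⊆ B :=
        (union_subset_union subset_rfl (stems_mono hd.le)).trans hB
      have h3 := (hp d hd).level j h2 (r d + t + 1) (mem_ball_succ_of_adj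
        (mem_ball_trans (hr d hda).1 (ball_anti hBd subset_rfl t hx)) hxy
        (geodesic_notMem hu hp hd le_rfl h2))
      have h4 := (hr d hda).2 _ (key d hda le_rfl)
      exact mem_biUnion.2 ⟨d, mem_range.2 hd, mem_image_of_mem _ (mem_Icc.2 ⟨by omega, h3⟩)⟩
    · have h3 := (hp a ha).level (ρ a) le_rfl _ (key a le_rfl hda.le)
      have h4 := hρ a d hda hd
      omega
  refine (card_le_card hsub).trans ((card_biUnion_le_card_mul _ _ (2 * t + 3) fun d _ => ?_).trans
    (by simp))
  refine card_image_le.trans ?_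
  rw [Nat.card_Icc]
  omega

lemma geodesic_ends_apart (hu : u ∉ Z)
    (hp : ∀ a < h, Geodesic G (Z ∪ stems p ρ a) u (p a) (ρ a))
    (hρ : ∀ a b, a < b → b < h → ρ b + 2 * R < ρ a) {a b : ℕ} (hab : a < b) (hb : b < h)
    (hB : Z ∪ stems p ρ h ⊆ B) :
    Disjoint (ball G B {p a (ρ a)} R) (ball G B {p b (ρ b)} R) := by
  rw [disjoint_left]
  intro v hva hvb
  have ha := hab.trans hb
  have hBa : Z ∪ stems p ρ a ⊆ B :=
    (union_subset_union subset_rfl (stems_mono ha.le)).trans hB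
  have h1 := mem_ball_symm (geodesic_notMem hu hp ha le_rfl le_rfl)
    (ball_anti hBa subset_rfl R hva)
  have h2 := mem_ball_trans (geodesic_mem hp hb hab.le le_rfl) (ball_anti hBa subset_rfl R hvb)
  have h3 := (hp a ha).level (ρ a) le_rfl _ (mem_ball_trans h2 h1)
  have h4 := hρ a b hab hb
  omega

end Geodesics

theorem exists_isSpider (hE : Expands G) {h l₀ K R D : ℕ} {κ : ℕ → ℕ} {u : V} (hR : 1 ≤ R)
    (hD : D = h * (3 * R)) (hu : u ∉ Z)
    (hκ : ∀ t ≤ D, (touch G (ball G Z {u} t) Z).card ≤ κ t)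
    (hK : ∀ v ∉ Z, (nbhd G v).card < K) (hn : 2 * K ^ D ≤ Fintype.card V)
    (hdeg : 2 ^ l₀ + κ 0 + h ≤ (nbhd G u).card)
    (hl : ∀ l ≥ l₀, ∀ t < growthTime (l + 1), 16 * (l + 3) ^ 2 * (κ t + h * (t + 1)) ≤ 2 ^ l) :
    ∃ (σ : Fin h → Finset V) (e : Fin h → V), IsSpider G Z h D R u σ e := by
  obtain ⟨ρ, hρdef⟩ : ∃ ρ : ℕ → ℕ, ∀ a, ρ a = (h - a) * (3 * R) := ⟨_, fun _ => rfl⟩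
  have hρ0 : ρ 0 = D := by rw [hρdef, hD, Nat.sub_zero]
  have hanti : Antitone ρ := fun a b hab => by
    rw [hρdef, hρdef]
    gcongr
  have hgap : ∀ a b, a < b → b < h → ρ b + 2 * R < ρ a := by
    intro a b hab hb
    rw [hρdef, hρdef]
    have : (h - b + 1) * (3 * R) ≤ (h - a) * (3 * R) := Nat.mul_le_mul_right _ (by omega)
    have e : (h - b + 1) * (3 * R) = (h - b) * (3 * R) + 3 * R := by ring
    omega
  have hρ2 : ∀ a < h, 2 ≤ ρ a := by
    intro a ha
    rw [hρdef]
    have : 1 * (3 * R) ≤ (h - a) * (3 * R) := Nat.mul_le_mul_right _ (by omega)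
    omega
  obtain ⟨p, hp⟩ := exists_geodesics hE hu (by rwa [hρ0]) hanti hρ2 hK (by rwa [hρ0]) hdeg hl
  have hbi : (univ.biUnion fun a : Fin h => (Icc 1 (ρ a)).image (p a)) = stems p ρ h := by
    ext v
    simp only [mem_biUnion, mem_univ, true_and, mem_image, mem_Icc, mem_stems]
    constructor
    · rintro ⟨a, j, ⟨h1, h2⟩, h3⟩
      exact ⟨a, a.2, j, h1, h2, h3⟩
    · rintro ⟨d, hd, j, h1, h2, h3⟩
      exact ⟨⟨d, hd⟩, j, ⟨h1, h2⟩, h3⟩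
  have hle : ∀ a, ρ a ≤ D := fun a => (hanti (Nat.zero_le a)).trans hρ0.le
  refine ⟨fun a => (Icc 1 (ρ a)).image (p a), fun a => p a (ρ a), hu, fun a => ?_, fun a => ?_,
    fun a ha => ?_, fun a b hab => ?_, fun a => ?_, fun a => ?_, fun a t ht => ?_,
    fun a b hab => ?_⟩
  · obtain ⟨w, hw, hs⟩ := (hp a a.2).exists_walk le_rfl
    exact ⟨w, hw.trans (hle a), hs⟩
  · intro v hv
    obtain ⟨j, hj, rfl⟩ := mem_image.1 hv
    have hj := (mem_Icc.1 hj).2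
    exact ball_mono (hj.trans (hle a)) (ball_anti subset_union_left subset_rfl _
      ((hp a a.2).mem j hj))
  · have : u ∈ stems p ρ h := by
      rw [← hbi]
      exact mem_biUnion.2 ⟨a, mem_univ _, ha⟩
    exact notMem_stems hp this
  · have key : ∀ a b : Fin h, a < b →
        Disjoint ((Icc 1 (ρ a)).image (p a)) ((Icc 1 (ρ b)).image (p b)) := by
      intro a b hab
      rw [disjoint_left]
      intro v hva hvb
      obtain ⟨j, hj, rfl⟩ := mem_image.1 hvb
      refine geodesic_notMem hu hp b.2 le_rfl (mem_Icc.1 hj).2 (mem_union_right _ ?_)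
      exact mem_biUnion.2 ⟨a, mem_range.2 hab, hva⟩
    rcases lt_or_gt_of_ne hab with h | h
    · exact key a b h
    · exact (key b a h).symm
  · exact card_image_le.trans (by simpa using hle a)
  · have := hρ2 a a.2
    exact mem_image_of_mem _ (mem_Icc.2 ⟨by omega, le_rfl⟩)
  · rw [hbi]
    refine (card_le_card (filter_subset_filter _ (insert_eq u (stems p ρ h)).subset)).trans
      ((card_touch_union_le _ _ _).trans (Nat.add_le_add ?_ ?_))
    · exact (card_le_card touch_subset).trans (by simp)
    · refine card_touch_geodesics_le hu hp (R := R) (fun a b h1 h2 => ?_) a.2 ht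
        (union_subset_union subset_rfl (subset_insert _ _))
      have := hgap a b h1 h2
      omega
  · rw [hbi]
    have hsub : Z ∪ stems p ρ h ⊆ Z ∪ insert u (stems p ρ h) :=
      union_subset_union subset_rfl (subset_insert _ _)
    rcases lt_or_gt_of_ne hab with h | h
    · exact geodesic_ends_apart hu hp hgap h b.2 hsub
    · exact (geodesic_ends_apart hu hp hgap h a.2 hsub).symm

end Spiders

section Connect

variable {V : Type*} {G : SimpleGraph V} {Z : Finset V}

/-- The part of a spider that is blocked for its own legs. -/
noncomputable def core {h : ℕ} (c : V) (σ : Fin h → Finset V) : Finset V :=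
  insert c (univ.biUnion σ)

lemma stem_subset_core {ι : Type*} {h : ℕ} {c : ι → V} {σ : ι → Fin h → Finset V} (i : ι)
    (a : Fin h) : σ i a ⊆ core (c i) (σ i) := fun _ hv =>
  mem_insert_of_mem (mem_biUnion.2 ⟨a, mem_univ _, hv⟩)

variable [Fintype V]

/-- A family of spiders with far apart centres, together with reserved balls of radius `R₀` around
the ends of their legs. -/
structure IsFamily {ι : Type*} (G : SimpleGraph V) (Z : Finset V) (h D R₀ R : ℕ) (c : ι → V)
    (σ : ι → Fin h → Finset V) (e : ι → Fin h → V) : Prop where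
  spider : ∀ i, IsSpider G Z h D R (c i) (σ i) (e i)
  far : ∀ i x, i ≠ x → c x ∉ ball G Z {c i} (2 * (D + R + 1))
  le : R₀ ≤ R

/-- The reserved ball around the end of a leg. -/
noncomputable def reserved {ι : Type*} (G : SimpleGraph V) (Z : Finset V) {h : ℕ} (R₀ : ℕ)
    (c : ι → V) (σ : ι → Fin h → Finset V) (e : ι → Fin h → V) (i : ι) (a : Fin h) : Finset V :=
  ball G (Z ∪ core (c i) (σ i)) {e i a} R₀

namespace IsFamily

variable {ι : Type*} {h D R₀ R : ℕ} {c : ι → V} {σ : ι → Fin h → Finset V} {e : ι → Fin h → V}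

lemma injective (hF : IsFamily G Z h D R₀ R c σ e) : Function.Injective c := by
  intro i x hix
  by_contra hne
  refine hF.far i x hne ?_
  rw [← hix]
  exact mem_ball_self _ _

lemma core_subset (hF : IsFamily G Z h D R₀ R c σ e) (i : ι) :
    core (c i) (σ i) ⊆ ball G Z {c i} (D + R₀) := by
  intro v hv
  rcases mem_insert.1 hv with hv | hv
  · rw [hv]
    exact mem_ball_self _ _
  · obtain ⟨a, -, ha⟩ := mem_biUnion.1 hv
    exact ball_mono (by omega) ((hF.spider i).stem_subset a ha)

lemma end_mem_ball (hF : IsFamily G Z h D R₀ R c σ e) (i : ι) (a : Fin h) :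
    e i a ∈ ball G Z {c i} D :=
  (hF.spider i).stem_subset a ((hF.spider i).end_mem a)

lemma end_notMem (hF : IsFamily G Z h D R₀ R c σ e) (i : ι) (a : Fin h) : e i a ∉ Z :=
  notMem_of_mem_ball (hF.spider i).notMem (hF.end_mem_ball i a)

lemma reserved_subset (hF : IsFamily G Z h D R₀ R c σ e) (i : ι) (a : Fin h) :
    reserved G Z R₀ c σ e i a ⊆ ball G Z {c i} (D + R₀) := fun _ hv =>
  mem_ball_trans (hF.end_mem_ball i a) (ball_anti subset_union_left subset_rfl _ hv)

lemma notMem_far (hF : IsFamily G Z h D R₀ R c σ e) {i j : ι} (hij : i ≠ j) {v : V}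
    (hv : v ∈ ball G Z {c i} (D + R)) : v ∉ ball G Z {c j} (D + R₀) := by
  intro hv'
  have h1 := mem_ball_trans hv (mem_ball_symm (hF.spider j).notMem hv')
  have := hF.le
  exact hF.far i j hij (ball_mono (by omega) h1)

/-- The set protected from connections that do not use the given leg. -/
noncomputable def prot (G : SimpleGraph V) (Z : Finset V) (R₀ : ℕ) (c : ι → V)
    (σ : ι → Fin h → Finset V) (e : ι → Fin h → V) (i : ι) (a : Fin h) : Finset V :=
  reserved G Z R₀ c σ e i a ∪ σ i a

lemma stem_avoids (hF : IsFamily G Z h D R₀ R c σ e) {i : ι} {a : Fin h} {v : V} (hv : v ∈ σ i a) :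
    (∀ j, c j ≠ v) ∧ ∀ j d, (j, d) ≠ (i, a) → v ∉ prot G Z R₀ c σ e j d := by
  have hv' : v ∈ ball G Z {c i} (D + R) :=
    ball_mono (by omega) ((hF.spider i).stem_subset a hv)
  refine ⟨fun j hj => ?_, fun j d hne hm => ?_⟩
  · by_cases hij : i = j
    · exact (hF.spider i).centre_notMem a (by rw [hij, hj]; exact hij ▸ hv)
    · exact hF.notMem_far hij hv' (hj ▸ mem_ball_self _ _)
  · by_cases hij : i = j
    · obtain rfl := hij
      have hda : d ≠ a := fun h => hne (by rw [h])
      have hdis := (hF.spider i).stem_disjoint d a hda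
      rcases mem_union.1 hm with hm | hm
      · rcases mem_or_notMem_of_mem_ball hm with hm | hm
        · rw [mem_singleton] at hm
          exact disjoint_left.1 hdis (hm ▸ (hF.spider i).end_mem d) hv
        · exact hm (mem_union_right _ (stem_subset_core i a hv))
      · exact disjoint_left.1 hdis hm hv
    · rcases mem_union.1 hm with hm | hm
      · exact hF.notMem_far hij hv' (hF.reserved_subset j d hm)
      · exact hF.notMem_far hij hv' (hF.core_subset j (stem_subset_core j d hm))

/-- The set blocked for a connection between two legs. -/
noncomputable def blocked [Fintype ι] (G : SimpleGraph V) (Z : Finset V) (R₀ : ℕ) (c : ι → V)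
    (σ : ι → Fin h → Finset V) (e : ι → Fin h → V) (q q' : ι × Fin h) (W : Finset V) : Finset V :=
  Z ∪ W ∪ (univ.biUnion fun i => core (c i) (σ i)) ∪
    (univ.filter fun s => s ≠ q ∧ s ≠ q').biUnion fun s => reserved G Z R₀ c σ e s.1 s.2

variable [Fintype ι] {q q' : ι × Fin h} {W : Finset V}

lemma mem_blocked {v : V} : v ∈ blocked G Z R₀ c σ e q q' W ↔ v ∈ Z ∨ v ∈ W ∨
    (∃ i, v ∈ core (c i) (σ i)) ∨
      ∃ j d, (j, d) ≠ q ∧ (j, d) ≠ q' ∧ v ∈ reserved G Z R₀ c σ e j d := by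
  simp only [blocked, mem_union, mem_biUnion, mem_univ, true_and, mem_filter, Prod.exists,
    or_assoc, and_assoc]

lemma blocked_comm : blocked G Z R₀ c σ e q q' W = blocked G Z R₀ c σ e q' q W := by
  ext v
  simp only [mem_blocked]
  grind

lemma card_blocked_le (hF : IsFamily G Z h D R₀ R c σ e) {K : ℕ}
    (hK : ∀ v ∉ Z, (nbhd G v).card < K) : (blocked G Z R₀ c σ e q q' W).card ≤
      Z.card + W.card + Fintype.card ι * (1 + h * D) + Fintype.card ι * h * K ^ R₀ := by
  refine (card_union_le _ _).trans (Nat.add_le_add ((card_union_le _ _).trans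
    (Nat.add_le_add (card_union_le _ _) ?_)) ?_)
  · refine card_biUnion_le_card_mul _ _ _ fun i _ => (card_insert_le _ _).trans ?_
    have : (univ.biUnion (σ i)).card ≤ h * D := by
      simpa using card_biUnion_le_card_mul univ (σ i) D fun a _ => (hF.spider i).card_stem a
    omega
  · refine (card_biUnion_le_card_mul _ _ (K ^ R₀) fun s _ => ?_).trans
      (Nat.mul_le_mul_right _ ((card_le_univ _).trans (by simp)))
    exact (card_le_card (ball_anti subset_union_left subset_rfl _)).trans
      (card_ball_le hK (hF.end_notMem _ _) _)

lemma blocked_superset (i : ι) :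
    Z ∪ core (c i) (σ i) ⊆ blocked G Z R₀ c σ e q q' W := fun _ hv => by
  rw [mem_blocked]
  rcases mem_union.1 hv with h | h
  · exact Or.inl h
  · exact Or.inr (Or.inr (Or.inl ⟨i, h⟩))

/-- What a ball around the end of a leg sees of the blocked set. -/
lemma touch_blocked_subset (hF : IsFamily G Z h D R₀ R c σ e) {i : ι} {a : Fin h}
    (hW : Disjoint W (reserved G Z R₀ c σ e i a)) {t : ℕ} (ht : t < R) :
    touch G (ball G (blocked G Z R₀ c σ e (i, a) q' W) {e i a} t)
        (blocked G Z R₀ c σ e (i, a) q' W) ⊆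
      touch G (ball G Z {e i a} t) Z ∪
        touch G (ball G (Z ∪ core (c i) (σ i)) {e i a} t) (core (c i) (σ i)) ∪
          if t < R₀ then ∅ else W := by
  intro y hy
  obtain ⟨hy, x, hx, hxy⟩ := mem_touch.1 hy
  have hxi := ball_anti (blocked_superset i) subset_rfl t hx
  have hxZ := ball_anti subset_union_left subset_rfl t hxi
  by_cases hyZ : y ∈ Z
  · exact mem_union_left _ (mem_union_left _ (mem_touch.2 ⟨hyZ, x, hxZ, hxy⟩))
  by_cases hyc : y ∈ core (c i) (σ i)
  · exact mem_union_left _ (mem_union_right _ (mem_touch.2 ⟨hyc, x, hxi, hxy⟩))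
  have hyi : y ∈ ball G (Z ∪ core (c i) (σ i)) {e i a} (t + 1) :=
    mem_ball_succ_of_adj hxi hxy (by rw [mem_union, not_or]; exact ⟨hyZ, hyc⟩)
  have hyc' : y ∈ ball G Z {c i} (D + R) :=
    mem_ball_trans (hF.end_mem_ball i a)
      (ball_mono (by omega) (ball_anti subset_union_left subset_rfl (t + 1) hyi))
  rcases mem_blocked.1 hy with h | h | ⟨j, h⟩ | ⟨j, d, hne, -, h⟩
  · exact absurd h hyZ
  · refine mem_union_right _ ?_
    split_ifs with ht0
    · exact absurd (ball_mono ht0 hyi) (disjoint_left.1 hW h)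
    · exact h
  · by_cases hij : i = j
    · exact absurd (hij ▸ h) hyc
    · exact absurd (hF.core_subset j h) (hF.notMem_far hij hyc')
  · by_cases hij : i = j
    · obtain rfl := hij
      have had : a ≠ d := fun had => hne (by rw [had])
      exact absurd (ball_mono hF.le h)
        (disjoint_left.1 ((hF.spider i).apart a d had) (ball_mono ht hyi))
    · exact absurd (hF.reserved_subset j d h) (hF.notMem_far hij hyc')

lemma card_touch_blocked_le (hF : IsFamily G Z h D R₀ R c σ e) {κ : ℕ → ℕ} {i : ι} {a : Fin h}
    (hκ : ∀ t < R, (touch G (ball G Z {e i a} t) Z).card ≤ κ t)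
    (hW : Disjoint W (reserved G Z R₀ c σ e i a)) {t : ℕ} (ht : t < R) :
    (touch G (ball G (blocked G Z R₀ c σ e (i, a) q' W) {e i a} t)
        (blocked G Z R₀ c σ e (i, a) q' W)).card ≤
      κ t + (1 + h * (2 * t + 3)) + if t < R₀ then 0 else W.card := by
  refine (card_le_card (hF.touch_blocked_subset hW ht)).trans ((card_union_le _ _).trans
    (Nat.add_le_add ((card_union_le _ _).trans (Nat.add_le_add (hκ t ht)
      ((hF.spider i).touch_le a t ht))) ?_))
  split_ifs <;> simp

/-- Balls around the ends of legs grow to more than half of the graph. -/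
lemma large_ball (hF : IsFamily G Z h D R₀ R c σ e) (hE : Expands G) {κ : ℕ → ℕ}
    {m M l₀ l₁ l₂ y : ℕ} {i : ι} {a : Fin h} (hR₀ : R₀ = growthTime l₁) (hR : R = growthTime l₂)
    (hκ : ∀ t < R, (touch G (ball G Z {e i a} t) Z).card ≤ κ t)
    (hW : Disjoint W (reserved G Z R₀ c σ e i a)) (hWm : W.card ≤ m)
    (hM : (blocked G Z R₀ c σ e (i, a) q' W).card ≤ M)
    (hl₀ : ∀ l ≥ l₀, ∀ t < growthTime (l + 1),
      32 * (l + 3) ^ 2 * (κ t + (1 + h * (2 * t + 3))) ≤ 2 ^ l)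
    (hl₁ : 16 * (l₁ + 3) ^ 2 * (2 * m) ≤ 2 ^ l₁) (hl₂ : 16 * (l₂ + 3) ^ 2 * M ≤ 2 ^ l₂)
    (hdeg : 2 ^ l₀ + κ 0 + (1 + h * 3) ≤ (nbhd G (e i a)).card)
    (hy : Fintype.card V ≤ 2 ^ y) :
    Fintype.card V < 2 * (ball G (blocked G Z R₀ c σ e (i, a) q' W) {e i a}
      (growthTime y)).card := by
  set B := blocked G Z R₀ c σ e (i, a) q' W with hB
  have hcount := fun t (ht : t < R) => hF.card_touch_blocked_le (q' := q') hκ hW ht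
  have hRpos : 1 ≤ R := hR ▸ one_le_growthTime l₂
  have hR0pos : 1 ≤ R₀ := hR₀ ▸ one_le_growthTime l₁
  have h1 : 2 ^ l₀ ≤ (ball G B {e i a} 1).card := by
    have h2 := card_nbhd_le_ball_one (G := G) (B := B) (e i a)
    have h3 := hcount 0 hRpos
    rw [if_pos (Nat.succ_le_iff.1 hR0pos)] at h3
    simp only [ball, mul_zero, zero_add, add_zero, ← hB] at h2 h3 ⊢
    omega
  have hly : l₀ ≤ y := by
    have : 2 ^ l₀ ≤ 2 ^ y := h1.trans ((card_le_univ _).trans hy)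
    exact (Nat.pow_le_pow_iff_right (by norm_num)).1 this
  have hlt : ∀ {l l' t}, growthTime l ≤ t → t < growthTime (l' + 1) → l ≤ l' := by
    intro l l' t h2 h3
    by_contra hc
    have := growthTime_mono (show l' + 1 ≤ l by omega)
    omega
  refine ball_gt_half hE h1 hy hly (thin_of_touch fun t _ l hl htl => ?_)
  rcases lt_or_ge t R with ht | ht
  · refine (Nat.mul_le_mul_left _ (hcount t ht)).trans ?_
    have h2 := hl₀ l hl t htl
    split_ifs with ht0
    · refine le_trans ?_ h2
      rw [add_zero]
      gcongr
      norm_num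
    · have h3 := sq_mul_le_two_pow hl₁ (hlt (hR₀ ▸ not_lt.1 ht0) htl)
      have h4 : 16 * (l + 3) ^ 2 * (2 * W.card) ≤ 16 * (l + 3) ^ 2 * (2 * m) := by gcongr
      nlinarith
  · refine le_trans (Nat.mul_le_mul_left _ ((card_le_card touch_subset).trans hM))
      (sq_mul_le_two_pow hl₂ (hlt (hR ▸ ht) htl))

end IsFamily

open IsFamily in
theorem balSub_of_isFamily {ι : Type*} [Fintype ι] {h D R₀ R : ℕ} {c : ι → V}
    {σ : ι → Fin h → Finset V} {e : ι → Fin h → V} (hF : IsFamily G Z h D R₀ R c σ e)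
    (hE : Expands G) {κ : ℕ → ℕ} {m M l₀ l₁ l₂ y K τ : ℕ} (hh : 2 ≤ h)
    (hR₀ : R₀ = growthTime l₁) (hR : R = growthTime l₂)
    (hκ : ∀ i a, ∀ t < R, (touch G (ball G Z {e i a} t) Z).card ≤ κ t)
    (hK : ∀ v ∉ Z, (nbhd G v).card < K)
    (hM : Z.card + m + Fintype.card ι * (1 + h * D) + Fintype.card ι * h * K ^ R₀ ≤ M)
    (hl₀ : ∀ l ≥ l₀, ∀ t < growthTime (l + 1),
      32 * (l + 3) ^ 2 * (κ t + (1 + h * (2 * t + 3))) ≤ 2 ^ l)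
    (hl₁ : 16 * (l₁ + 3) ^ 2 * (2 * m) ≤ 2 ^ l₁) (hl₂ : 16 * (l₂ + 3) ^ 2 * M ≤ 2 ^ l₂)
    (hdeg : ∀ v, 2 ^ l₀ + κ 0 + (1 + h * 3) ≤ (nbhd G v).card)
    (hy : Fintype.card V ≤ 2 ^ y) (hτ : τ = 2 * growthTime y + 2 * D)
    (hm : m = unitAvoidCount τ h) (hι : unitCount τ h ≤ Fintype.card ι) :
    ∃ ℓ, BalSub G h ℓ := by
  refine balSub_of_units hh hι (prot := prot G Z R₀ c σ e) hF.injective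
    fun i x hix a b W hW hdis => ?_
  rw [disjoint_union_right] at hdis
  set B := blocked G Z R₀ c σ e (i, a) (x, b) W with hB
  have hM' : ∀ q q', (blocked G Z R₀ c σ e q q' W).card ≤ M := fun q q' =>
    (hF.card_blocked_le hK).trans (le_trans (by gcongr; omega) hM)
  have hi := hF.large_ball (q' := (x, b)) hE hR₀ hR (hκ i a)
    (hdis.1.mono_right subset_union_left) (by omega) (hM' _ _) hl₀ hl₁ hl₂ (hdeg _) hy
  have hx := hF.large_ball (q' := (i, a)) hE hR₀ hR (hκ x b)
    (hdis.2.mono_right subset_union_left) (by omega) (hM' _ _) hl₀ hl₁ hl₂ (hdeg _) hy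
  rw [blocked_comm] at hx
  obtain ⟨q, hq, hql, hqs⟩ := exists_path_of_large_balls hi hx
  obtain ⟨w, hw, hws⟩ := (hF.spider i).walk a
  obtain ⟨w', hw', hws'⟩ := (hF.spider x).walk b
  obtain ⟨S, hS, hS'⟩ := exists_link
    (SimpleGraph.Walk.bypass_isPath ((w.append q).append w'.reverse))
  have hlen := SimpleGraph.Walk.length_bypass_le_length ((w.append q).append w'.reverse)
  simp only [SimpleGraph.Walk.length_append, SimpleGraph.Walk.length_reverse] at hlen
  have hmem : ∀ v ∈ S, v ∈ σ i a ∨ v ∈ σ x b ∨ v ∉ B := by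
    intro v hv
    obtain ⟨h1, h2, h3⟩ := hS' v hv
    have h4 := SimpleGraph.Walk.support_bypass_subset_support _ h1
    rw [SimpleGraph.Walk.mem_support_append_iff, SimpleGraph.Walk.mem_support_append_iff,
      SimpleGraph.Walk.support_reverse, List.mem_reverse] at h4
    rcases h4 with (h4 | h4) | h4
    · exact (hws v h4).elim (fun h => absurd h h2) Or.inl
    · rcases hqs v h4 with h | h | h
      · exact Or.inl (h ▸ (hF.spider i).end_mem a)
      · exact Or.inr (Or.inl (h ▸ (hF.spider x).end_mem b))
      · exact Or.inr (Or.inr h)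
    · exact (hws' v h4).elim (fun h => absurd h h3) fun h => Or.inr (Or.inl h)
  refine ⟨_, by omega, S, hS, disjoint_left.2 fun v hv hvW => ?_, fun j hj => ?_,
    fun j d h1 h2 => disjoint_left.2 fun v hv hvp => ?_⟩
  · rcases hmem v hv with h | h | h
    · exact disjoint_left.1 hdis.1 hvW (mem_union_right _ h)
    · exact disjoint_left.1 hdis.2 hvW (mem_union_right _ h)
    · exact h (mem_blocked.2 (Or.inr (Or.inl hvW)))
  · rcases hmem _ hj with h | h | h
    · exact (hF.stem_avoids h).1 j rfl
    · exact (hF.stem_avoids h).1 j rfl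
    · exact h (blocked_superset j (mem_union_right _ (mem_insert_self _ _)))
  · rcases hmem v hv with h | h | h
    · exact (hF.stem_avoids h).2 j d h1 hvp
    · exact (hF.stem_avoids h).2 j d h2 hvp
    · rcases mem_union.1 hvp with hvp | hvp
      · exact h (mem_blocked.2 (Or.inr (Or.inr (Or.inr ⟨j, d, h1, h2, hvp⟩))))
      · exact h (blocked_superset j (mem_union_right _ (stem_subset_core j d hvp)))

end Connect

section LowDegree

variable {V : Type*} [Fintype V] {G : SimpleGraph V} {Z : Finset V}

lemma card_touch_lt_of_notMem_crowded {h R t : ℕ} {v : V} (hv : v ∉ crowded G Z h R) (hvZ : v ∉ Z)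
    (ht : t ≤ R) : (touch G (ball G Z {v} t) Z).card < hubCount (2 * t + 2) h := by
  by_contra hc
  exact hv (mem_filter.2 ⟨mem_univ _, hvZ, t, ht, not_lt.1 hc⟩)

/-- A large expander in which few vertices have high degree has a balanced subdivision. -/
theorem balSub_of_low_degree (hE : Expands G) {h K R₀ R D N C l₀ l₁ l₂ y τ m M : ℕ} (hh : 2 ≤ h)
    (hR₀ : R₀ = growthTime l₁) (hR : R = growthTime l₂) (hl₁₂ : l₁ ≤ l₂) (hD : D = h * (3 * R))
    (hK : ∀ v ∉ Z, (nbhd G v).card < K) (hK0 : 0 < K)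
    (hN : N = unitCount τ h) (hM : Z.card + m + N * (1 + h * D) + N * h * K ^ R₀ ≤ M)
    (hl₀ : ∀ l ≥ l₀, ∀ t < growthTime (l + 1),
      32 * (l + 3) ^ 2 * (hubCount (2 * t + 2) h + (1 + h * (2 * t + 3))) ≤ 2 ^ l)
    (hl₁ : 16 * (l₁ + 3) ^ 2 * (2 * m) ≤ 2 ^ l₁) (hl₂ : 16 * (l₂ + 3) ^ 2 * M ≤ 2 ^ l₂)
    (hdeg : ∀ v, 2 ^ l₀ + hubCount 2 h + (1 + h * 3) ≤ (nbhd G v).card)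
    (hy : Fintype.card V ≤ 2 ^ y) (hτ : τ = 2 * growthTime y + 2 * D)
    (hm : m = unitAvoidCount τ h)
    (hC : (D + 1) * (Z.card ^ hubCount (2 * D + 2) h * (avoidCount (2 * D + 2) h + 1) *
      K ^ (2 * D)) ≤ C) (hn : 2 * K ^ D ≤ Fintype.card V)
    (hX : N * K ^ (2 * (D + R + 1)) + Z.card + C * K ^ D ≤ Fintype.card V) :
    ∃ ℓ, BalSub G h ℓ := by
  by_cases hcr : 0 < Z.card ∧ C ≤ (crowded G Z h D).card
  · exact balSub_of_crowded hh hK hK0 hcr.1 (hC.trans hcr.2)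
  have hcr' : (crowded G Z h D).card ≤ C := by
    rcases Nat.eq_zero_or_pos Z.card with h0 | h0
    · have hemp : crowded G Z h D = ∅ := filter_eq_empty_iff.2 fun v _ hv => by
        obtain ⟨-, t, -, ht⟩ := hv
        have h1 := card_le_card (touch_subset (G := G) (X := ball G Z {v} t) (B := Z))
        have h2 : 0 < hubCount (2 * t + 2) h := by unfold hubCount; positivity
        omega
      simp [hemp]
    · by_contra hc
      exact hcr ⟨h0, by omega⟩
  set X := univ \ (Z ∪ (crowded G Z h D).biUnion fun v => ball G Z {v} D) with hXdef
  have hXmem : ∀ u ∈ X, u ∉ Z ∧ ∀ v ∈ ball G Z {u} D, v ∉ crowded G Z h D := by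
    intro u hu
    have hu := (mem_sdiff.1 hu).2
    rw [mem_union, not_or] at hu
    exact ⟨hu.1, fun v hv hvc => hu.2 (mem_biUnion.2 ⟨v, hvc, mem_ball_symm hu.1 hv⟩)⟩
  have hXcard : N * K ^ (2 * (D + R + 1)) ≤ X.card := by
    have h1 : ((crowded G Z h D).biUnion fun v => ball G Z {v} D).card ≤ C * K ^ D :=
      (card_biUnion_le_card_mul _ _ _ fun v hv =>
        card_ball_le hK (mem_filter.1 hv).2.1 D).trans (Nat.mul_le_mul_right _ hcr')
    have h2 := card_union_le Z ((crowded G Z h D).biUnion fun v => ball G Z {v} D)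
    have h3 := card_sdiff_add_card_eq_card
      (subset_univ (Z ∪ (crowded G Z h D).biUnion fun v => ball G Z {v} D))
    rw [← hXdef, card_univ] at h3
    omega
  obtain ⟨F, hF⟩ : ∃ F : V → V → Prop, ∀ x y, F x y ↔ y ∈ ball G Z {x} (2 * (D + R + 1)) :=
    ⟨_, fun _ _ => Iff.rfl⟩
  obtain ⟨P, hPX, hP, hPc⟩ := exists_separated (X := X) (N := F) (k := K ^ (2 * (D + R + 1)))
    (fun x hx y hy => (hF y x).2 (mem_ball_symm (hXmem x hx).1 ((hF x y).1 hy)))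
    (fun x => (hF x x).2 (mem_ball_self x _)) (fun x hx =>
      (card_le_card fun y hy => (hF x y).1 (mem_filter.1 hy).2).trans
        (card_ball_le hK (hXmem x hx).1 _))
  have hNP : N ≤ P.card := Nat.le_of_mul_le_mul_right (hXcard.trans hPc) (by positivity)
  obtain ⟨Q, hQP, hQ⟩ := exists_subset_card_eq hNP
  have hRD : R ≤ D := hD ▸ (show R ≤ 3 * R by omega).trans (Nat.le_mul_of_pos_left _ (by omega))
  have hspider : ∀ u : Q, ∃ (σ : Fin h → Finset V) (e : Fin h → V),
      IsSpider G Z h D R u σ e := by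
    intro u
    obtain ⟨huZ, hu⟩ := hXmem u (hPX (hQP u.2))
    refine exists_isSpider hE (κ := fun t => hubCount (2 * t + 2) h) (hR ▸ one_le_growthTime l₂)
      hD huZ (fun t ht => (card_touch_lt_of_notMem_crowded (hu u (mem_ball_self _ _)) huZ ht).le)
      hK hn (l₀ := l₀) ?_ fun l hl t ht => le_trans ?_ (hl₀ l hl t ht)
    · have := hdeg u
      simp only [mul_zero, zero_add]
      omega
    · have h1 : h * (t + 1) ≤ h * (2 * t + 3) := Nat.mul_le_mul_left _ (by omega)
      exact Nat.mul_le_mul (Nat.mul_le_mul_right _ (by norm_num)) (by omega)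
  choose σ e hσ using hspider
  have hFam : IsFamily G Z h D R₀ R (fun u : Q => (u : V)) σ e :=
    ⟨hσ, fun i x hix hx => hP i (hQP i.2) x (hQP x.2) (Subtype.coe_ne_coe.2 hix) ((hF _ _).2 hx),
      by rw [hR₀, hR]; exact growthTime_mono hl₁₂⟩
  have hcard : Fintype.card Q = N := by rw [Fintype.card_coe, hQ]
  refine balSub_of_isFamily hFam hE (κ := fun t => hubCount (2 * t + 2) h) hh hR₀ hR
    (fun i a t ht => ?_) hK (by rwa [hcard]) hl₀ hl₁ hl₂ (by simpa using hdeg) hy hτ hm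
    (by rw [hcard, hN])
  exact (card_touch_lt_of_notMem_crowded
    ((hXmem i (hPX (hQP i.2))).2 _ (hFam.end_mem_ball i a)) (hFam.end_notMem i a)
    (by omega)).le

end LowDegree

section Parameters

lemma exists_pow_le_two_pow (k : ℕ) : ∃ r₀ : ℕ, ∀ r ≥ r₀, r ^ k ≤ 2 ^ r := by
  have h := (isLittleO_pow_const_const_pow_of_one_lt (R := ℝ) k (r := 2) (by norm_num)).bound
    (c := 1) one_pos
  obtain ⟨r₀, hr₀⟩ := Filter.eventually_atTop.1 h
  refine ⟨r₀, fun r hr => ?_⟩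
  have := hr₀ r hr
  simp only [Real.norm_eq_abs, one_mul, Nat.abs_cast, abs_pow, Nat.abs_ofNat] at this
  exact_mod_cast this

lemma mul_pow_le_pow_succ {r c a b : ℕ} (hr : 2 ^ 100 ≤ r) (hc : c ≤ 2 ^ 100) (hab : a < b) :
    c * r ^ a ≤ r ^ b :=
  calc c * r ^ a ≤ r * r ^ a := Nat.mul_le_mul_right _ (hc.trans hr)
    _ = r ^ (a + 1) := by ring
    _ ≤ r ^ b := Nat.pow_le_pow_right (lt_of_lt_of_le (by positivity) hr) hab

variable {V : Type*} [Fintype V] {G : SimpleGraph V}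

lemma initial_growth {h l₀ : ℕ} (h0 : 2 ^ 26 * (l₀ + 4) ^ 8 * h ^ 3 ≤ 2 ^ l₀) (hl₀ : 8 ≤ l₀)
    (hh : 1 ≤ h) : ∀ l ≥ l₀, ∀ t < growthTime (l + 1),
      32 * (l + 3) ^ 2 * (hubCount (2 * t + 2) h + (1 + h * (2 * t + 3))) ≤ 2 ^ l := by
  have step : ∀ l ≥ l₀, 2 ^ 26 * (l + 4) ^ 8 * h ^ 3 ≤ 2 ^ l := by
    intro l hl
    induction l, hl using Nat.le_induction with
    | base => exact h0
    | succ l hl ih =>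
      have h1 : (12 * (l + 1 + 4)) ^ 8 ≤ (13 * (l + 4)) ^ 8 :=
        Nat.pow_le_pow_left (by omega) 8
      have h2 : (l + 1 + 4) ^ 8 ≤ 2 * (l + 4) ^ 8 := by
        rw [mul_pow, mul_pow] at h1
        norm_num at h1 ⊢
        omega
      calc 2 ^ 26 * (l + 1 + 4) ^ 8 * h ^ 3 ≤ 2 ^ 26 * (2 * (l + 4) ^ 8) * h ^ 3 := by gcongr
        _ = 2 * (2 ^ 26 * (l + 4) ^ 8 * h ^ 3) := by ring
        _ ≤ 2 * 2 ^ l := by gcongr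
        _ = 2 ^ (l + 1) := by ring
  intro l hl t ht
  refine le_trans ?_ (step l hl)
  have ht' : 2 * t + 3 ≤ 64 * (l + 4) ^ 3 := by
    unfold growthTime at ht
    have : l + 1 + 3 = l + 4 := by ring
    rw [this] at ht
    have : 1 ≤ (l + 4) ^ 3 := Nat.one_le_pow _ _ (by omega)
    omega
  have e1 : 1 + h * (2 * t + 3) ≤ 2 ^ 8 * (2 * t + 3) ^ 2 * h ^ 3 := by
    have a1 : h ≤ h ^ 3 := Nat.le_self_pow (by norm_num) h
    have a2 : 2 * t + 3 ≤ (2 * t + 3) ^ 2 := Nat.le_self_pow (by norm_num) _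
    have a3 := Nat.mul_le_mul a2 a1
    have a4 : 1 * 1 ≤ (2 * t + 3) * h := Nat.mul_le_mul (by omega) hh
    nlinarith
  calc 32 * (l + 3) ^ 2 * (hubCount (2 * t + 2) h + (1 + h * (2 * t + 3)))
      ≤ 32 * (l + 4) ^ 2 * (2 ^ 8 * (2 * t + 3) ^ 2 * h ^ 3 + 2 ^ 8 * (2 * t + 3) ^ 2 * h ^ 3) := by
        unfold hubCount
        gcongr
        omega
    _ = 2 ^ 14 * (l + 4) ^ 2 * (2 * t + 3) ^ 2 * h ^ 3 := by ring
    _ ≤ 2 ^ 14 * (l + 4) ^ 2 * (64 * (l + 4) ^ 3) ^ 2 * h ^ 3 := by gcongr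
    _ = 2 ^ 26 * (l + 4) ^ 8 * h ^ 3 := by ring

/-- For each `h` there is an exponent `l₀` with `h ^ 1000 ≤ 2 ^ l₀ ≤ h ^ 2000`. -/
lemma exists_exponent {h : ℕ} (hh : 2 ≤ h) :
    ∃ l₀, h ^ 1000 ≤ 2 ^ l₀ ∧ 2 ^ l₀ ≤ h ^ 2000 ∧ 8 ≤ l₀ ∧ l₀ ≤ 1000 * h := by
  refine ⟨1000 * (Nat.log 2 h + 1), ?_, ?_, by omega, ?_⟩
  · rw [mul_comm, pow_mul]
    exact Nat.pow_le_pow_left (Nat.lt_pow_succ_log_self (by norm_num) h).le _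
  · rw [mul_comm, pow_mul, show 2000 = 2 * 1000 by norm_num, pow_mul]
    refine Nat.pow_le_pow_left ?_ _
    have := Nat.pow_log_le_self 2 (show h ≠ 0 by omega)
    rw [pow_succ, sq]
    exact Nat.mul_le_mul this hh
  · have := Nat.log_lt_self 2 (show h ≠ 0 by omega)
    omega

lemma balSub_of_small (hE : Expands G) [Nonempty V] {h y : ℕ} (hh : 2 ^ 100 ≤ h)
    (hy : Fintype.card V ≤ 2 ^ y) (hyh : y < h ^ 100)
    (hdeg : ∀ v, h ^ 2002 ≤ (nbhd G v).card) : ∃ ℓ, BalSub G h ℓ := by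
  have hh2 : 2 ≤ h := le_trans (by norm_num) hh
  obtain ⟨l₀, hl1, hl2, -, hl4⟩ := exists_exponent hh2
  have e0 : 1 ≤ h ^ 100 := Nat.one_le_pow _ _ (by omega)
  have e1 : growthTime y ≤ h ^ 304 := by
    unfold growthTime
    calc 16 * (y + 3) ^ 3 ≤ 16 * (4 * h ^ 100) ^ 3 := by gcongr; omega
      _ = 2 ^ 10 * h ^ 300 := by ring
      _ ≤ h ^ 304 := mul_pow_le_pow_succ hh (by norm_num) (by norm_num)
  have e2 : 2 * growthTime y + 1 ≤ h ^ 305 := by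
    have := mul_pow_le_pow_succ (c := 3) (a := 304) (b := 305) hh (by norm_num) (by norm_num)
    have : 1 ≤ h ^ 304 := Nat.one_le_pow _ _ (by omega)
    omega
  have e3 : hubCount (2 * growthTime y) h + avoidCount (2 * growthTime y) h ≤ h ^ 614 := by
    unfold hubCount avoidCount
    calc 2 ^ 8 * (2 * growthTime y + 1) ^ 2 * h ^ 3 + 2 * (2 * growthTime y + 1) ^ 2 * h ^ 2
        ≤ 2 ^ 8 * (h ^ 305) ^ 2 * h ^ 3 + 2 * (h ^ 305) ^ 2 * h ^ 3 := by
          gcongr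
          · omega
          · omega
      _ = 258 * h ^ 613 := by ring
      _ ≤ h ^ 614 := mul_pow_le_pow_succ hh (by norm_num) (by norm_num)
  have e4 : 16 * (l₀ + 3) ^ 2 * (hubCount (2 * growthTime y) h + avoidCount (2 * growthTime y) h) ≤
      2 ^ l₀ := by
    refine le_trans ?_ hl1
    calc _ ≤ 16 * (1003 * h) ^ 2 * h ^ 614 := by gcongr; omega
      _ = (16 * 1003 ^ 2) * h ^ 616 := by ring
      _ ≤ h ^ 1000 := mul_pow_le_pow_succ hh (by norm_num) (by norm_num)
  have e5 : h ^ 2000 + h ^ 614 ≤ h ^ 2002 := by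
    have h1 := mul_pow_le_pow_succ (c := 2) (a := 2000) (b := 2002) hh (by norm_num) (by norm_num)
    have h2 : h ^ 614 ≤ h ^ 2000 := Nat.pow_le_pow_right (by omega) (by norm_num)
    omega
  refine balSub_of_high_degree hE hh2 hy rfl rfl e4 (Q₀ := univ) ?_ fun v _ => ?_
  · obtain ⟨v⟩ := ‹Nonempty V›
    have h1 := hdeg v
    have h2 := card_le_univ (nbhd G v)
    rw [card_univ]
    omega
  · have := hdeg v
    omega

lemma unitCount_le {r h τ : ℕ} (hr : 2 ^ 100 ≤ r) (hhr : h ≤ r)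
    (hτ : τ + 1 ≤ r ^ 309) (h2 : r ^ 700 ≤ 2 ^ r) : unitCount τ h ≤ 2 ^ r ^ 8 := by
  have hr1 : 1 ≤ r := le_trans (by norm_num) hr
  have pw : ∀ {a b}, a ≤ b → r ^ a ≤ r ^ b := fun hab => Nat.pow_le_pow_right hr1 hab
  have pr : ∀ {a}, a ≤ 700 → r ^ a ≤ 2 ^ r := fun ha => (pw ha).trans h2
  have cc : colourCount τ h ≤ 2 ^ r ^ 3 := by
    unfold colourCount
    calc ((τ + 1) ^ h) ^ h ≤ ((2 ^ r) ^ r) ^ r := by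
          gcongr
          · exact Nat.one_le_pow _ _ (by positivity)
          · exact Nat.one_le_two_pow
          · exact hτ.trans (pr (by norm_num))
      _ = 2 ^ r ^ 3 := by rw [← pow_mul, ← pow_mul]; congr 1; ring
  have h3 : h ^ 3 ≤ r ^ 3 := by gcongr
  have c3 : colourCount τ h * h ^ 3 ≤ 2 ^ r ^ 4 := by
    calc _ ≤ 2 ^ r ^ 3 * 2 ^ r := Nat.mul_le_mul cc (h3.trans (pr (by norm_num)))
      _ = 2 ^ (r ^ 3 + r) := by rw [pow_add]
      _ ≤ 2 ^ r ^ 4 := by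
        have := mul_pow_le_pow_succ (c := 2) (a := 3) (b := 4) hr (by norm_num) (by norm_num)
        have h4 : r ≤ r ^ 3 := Nat.le_self_pow (by norm_num) r
        exact Nat.pow_le_pow_right (by norm_num) (by omega)
  have c4 : (colourCount τ h * h ^ 3) ^ h ^ 3 ≤ 2 ^ r ^ 7 := by
    calc _ ≤ (2 ^ r ^ 4) ^ r ^ 3 := by gcongr; exact Nat.one_le_two_pow
      _ = 2 ^ r ^ 7 := by rw [← pow_mul]; congr 1; ring
  have c5 : 2 * h ^ 3 ≤ 2 ^ r := by
    calc 2 * h ^ 3 ≤ 2 * r ^ 3 := by gcongr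
      _ ≤ r ^ 4 := mul_pow_le_pow_succ hr (by norm_num) (by norm_num)
      _ ≤ _ := pr (by norm_num)
  unfold unitCount
  calc _ ≤ 2 ^ r ^ 4 + 2 ^ r ^ 3 * 2 ^ r ^ 7 * 2 ^ r := by gcongr
    _ = 2 ^ r ^ 4 + 2 ^ (r ^ 3 + r ^ 7 + r) := by rw [pow_add, pow_add]
    _ ≤ 2 ^ (r ^ 3 + r ^ 7 + r) + 2 ^ (r ^ 3 + r ^ 7 + r) := by
      gcongr
      · norm_num
      · have : r ^ 4 ≤ r ^ 7 := pw (by norm_num)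
        omega
    _ = 2 ^ (r ^ 3 + r ^ 7 + r + 1) := by ring
    _ ≤ 2 ^ r ^ 8 := by
        have := mul_pow_le_pow_succ (c := 4) (a := 7) (b := 8) hr (by norm_num) (by norm_num)
        have h4 : r ≤ r ^ 7 := Nat.le_self_pow (by norm_num) r
        have h5 : r ^ 3 ≤ r ^ 7 := pw (by norm_num)
        exact Nat.pow_le_pow_right (by norm_num) (by omega)

lemma balSub_of_large (hE : Expands G) {h y r : ℕ} (hh : 2 ^ 100 ≤ h) (hhr : h ≤ r)
    (h2 : r ^ 700 ≤ 2 ^ r) (hy : Fintype.card V ≤ 2 ^ y) (hy' : 2 ^ (y - 1) ≤ Fintype.card V)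
    (hry : r ^ 100 ≤ y) (hyr : y < (r + 1) ^ 100)
    (hdeg : ∀ v, h ^ 2002 ≤ (nbhd G v).card) : ∃ ℓ, BalSub G h ℓ := by
  have hh2 : 2 ≤ h := le_trans (by norm_num) hh
  have hr : 2 ^ 100 ≤ r := hh.trans hhr
  have hr1 : 2 ≤ r := hh2.trans hhr
  have pw : ∀ {a b}, a ≤ b → r ^ a ≤ r ^ b := fun hab => Nat.pow_le_pow_right (by omega) hab
  have pr : ∀ {a}, a ≤ 700 → r ^ a ≤ 2 ^ r := fun ha => (pw ha).trans h2
  have one : ∀ a, 1 ≤ r ^ a := fun a => Nat.one_le_pow _ _ (by omega)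
  have ab : ∀ {c a b}, c ≤ 2 ^ 100 → a < b → c * r ^ a ≤ r ^ b :=
    fun hc hab => mul_pow_le_pow_succ hr hc hab
  have two : ∀ {a b : ℕ}, a ≤ b → 2 ^ a ≤ 2 ^ b := fun h => Nat.pow_le_pow_right (by norm_num) h
  have hr3 : r + 3 ≤ r ^ 2 := by nlinarith
  obtain ⟨l₀, hl1, hl2, hl3, hl4⟩ := exists_exponent hh2
  have y1 : y + 3 ≤ r ^ 102 := by
    have e1 : (r + 1) ^ 100 ≤ (2 * r) ^ 100 := by gcongr; omega
    rw [mul_pow] at e1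
    have e2 := ab (c := 2 ^ 100) (a := 100) (b := 101) le_rfl (by norm_num)
    have e3 := ab (c := 4) (a := 101) (b := 102) (by norm_num) (by norm_num)
    have e4 := one 101
    omega
  have gy : growthTime y ≤ r ^ 307 := by
    unfold growthTime
    calc 16 * (y + 3) ^ 3 ≤ 16 * (r ^ 102) ^ 3 := by gcongr
      _ = 16 * r ^ 306 := by ring
      _ ≤ r ^ 307 := ab (by norm_num) (by norm_num)
  have gr : growthTime r ≤ r ^ 7 := by
    unfold growthTime
    calc 16 * (r + 3) ^ 3 ≤ 16 * (r ^ 2) ^ 3 := by gcongr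
      _ = 16 * r ^ 6 := by ring
      _ ≤ r ^ 7 := ab (by norm_num) (by norm_num)
  have r12 : r ^ 12 + 3 ≤ r ^ 13 := by
    have e3 := ab (c := 4) (a := 12) (b := 13) (by norm_num) (by norm_num)
    have e4 := one 12
    omega
  obtain ⟨R, hR⟩ : ∃ R, R = growthTime (r ^ 12) := ⟨_, rfl⟩
  have gR : R ≤ r ^ 40 := by
    rw [hR]
    unfold growthTime
    calc 16 * (r ^ 12 + 3) ^ 3 ≤ 16 * (r ^ 13) ^ 3 := by gcongr
      _ = 16 * r ^ 39 := by ring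
      _ ≤ r ^ 40 := ab (by norm_num) (by norm_num)
  obtain ⟨D, hD⟩ : ∃ D, D = h * (3 * R) := ⟨_, rfl⟩
  have gD : D ≤ r ^ 42 := by
    calc D ≤ r * (3 * r ^ 40) := by rw [hD]; gcongr
      _ = 3 * r ^ 41 := by ring
      _ ≤ r ^ 42 := ab (by norm_num) (by norm_num)
  obtain ⟨τ, hτ⟩ : ∃ τ, τ = 2 * growthTime y + 2 * D := ⟨_, rfl⟩
  have e307 : r ^ 42 ≤ r ^ 307 := pw (by norm_num)
  have e308 := ab (c := 5) (a := 307) (b := 309) (by norm_num) (by norm_num)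
  have o307 := one 307
  have gτ : τ + 1 ≤ r ^ 309 := by omega
  have gτ' : 2 * growthTime y + 1 ≤ r ^ 309 := by omega
  have gb : hubCount (2 * growthTime y) h + avoidCount (2 * growthTime y) h ≤ r ^ 622 := by
    unfold hubCount avoidCount
    calc 2 ^ 8 * (2 * growthTime y + 1) ^ 2 * h ^ 3 + 2 * (2 * growthTime y + 1) ^ 2 * h ^ 2
        ≤ 2 ^ 8 * (r ^ 309) ^ 2 * r ^ 3 + 2 * (r ^ 309) ^ 2 * r ^ 3 := by
          refine Nat.add_le_add (by gcongr) (Nat.mul_le_mul (by gcongr) ?_)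
          exact (Nat.pow_le_pow_left hhr 2).trans (pw (by norm_num))
      _ = 258 * r ^ 621 := by ring
      _ ≤ r ^ 622 := ab (by norm_num) (by norm_num)
  have gm : unitAvoidCount τ h ≤ r ^ 622 := by
    unfold unitAvoidCount
    calc 2 * (τ + 1) ^ 2 * h ^ 3 ≤ 2 * (r ^ 309) ^ 2 * r ^ 3 := by gcongr
      _ = 2 * r ^ 621 := by ring
      _ ≤ r ^ 622 := ab (by norm_num) (by norm_num)
  have lr : ∀ b ≤ 2 * r ^ 622, 16 * (r + 3) ^ 2 * b ≤ 2 ^ r := fun b hb =>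
    calc 16 * (r + 3) ^ 2 * b ≤ 16 * (r ^ 2) ^ 2 * (2 * r ^ 622) := by gcongr
      _ = 32 * r ^ 626 := by ring
      _ ≤ r ^ 627 := ab (by norm_num) (by norm_num)
      _ ≤ 2 ^ r := pr (by norm_num)
  set Z : Finset V := univ.filter fun v => 2 ^ (r + 1) ≤ (nbhd G v).card with hZ
  rcases le_or_gt (hubCount (2 * growthTime y) h) Z.card with hZc | hZc
  · refine balSub_of_high_degree hE hh2 hy rfl rfl (lr _ (by omega)) hZc fun v hv => ?_
    have h3 := (mem_filter.1 hv).2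
    have h4 : r ^ 622 ≤ 2 ^ r := pr (by norm_num)
    rw [pow_succ] at h3
    omega
  have hK : ∀ v ∉ Z, (nbhd G v).card < 2 ^ (r + 1) := by
    intro v hv
    by_contra hc
    exact hv (mem_filter.2 ⟨mem_univ _, not_lt.1 hc⟩)
  have gZ : Z.card ≤ 2 ^ r := by
    have : r ^ 622 ≤ 2 ^ r := pr (by norm_num)
    omega
  have gK : ∀ {j k : ℕ}, j ≤ r ^ k → (2 ^ (r + 1)) ^ j ≤ 2 ^ r ^ (k + 2) := by
    intro j k hj
    rw [← pow_mul]
    refine two ?_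
    calc (r + 1) * j ≤ r ^ 2 * r ^ k := Nat.mul_le_mul (by omega) hj
      _ = r ^ (k + 2) := by ring
  have gN := unitCount_le hr hhr gτ h2
  have d43 : 2 * D + 3 ≤ r ^ 43 := by
    have e3 := ab (c := 5) (a := 42) (b := 43) (by norm_num) (by norm_num)
    have e4 := one 42
    omega
  have hhub : hubCount (2 * D + 2) h ≤ r ^ 90 := by
    unfold hubCount
    calc 2 ^ 8 * (2 * D + 2 + 1) ^ 2 * h ^ 3 ≤ 2 ^ 8 * (r ^ 43) ^ 2 * r ^ 3 := by gcongr
      _ = 2 ^ 8 * r ^ 89 := by ring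
      _ ≤ r ^ 90 := ab (by norm_num) (by norm_num)
  have havoid : avoidCount (2 * D + 2) h + 1 ≤ 2 ^ r := by
    unfold avoidCount
    calc 2 * (2 * D + 2 + 1) ^ 2 * h ^ 2 + 1 ≤ 2 * (r ^ 43) ^ 2 * r ^ 2 + r ^ 88 := by
          gcongr
          exact one _
      _ = 3 * r ^ 88 := by ring
      _ ≤ r ^ 90 := ab (by norm_num) (by norm_num)
      _ ≤ 2 ^ r := pr (by norm_num)
  have r1 : ∀ {k}, 1 ≤ k → r ≤ r ^ k := fun hk => Nat.le_self_pow (by omega) r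
  have gM : Z.card + unitAvoidCount τ h + unitCount τ h * (1 + h * D) +
      unitCount τ h * h * (2 ^ (r + 1)) ^ growthTime r ≤ 2 ^ r ^ 10 := by
    have hD1 : 1 + h * D ≤ 2 ^ r := by
      have e1 : h * D ≤ r ^ 43 :=
        calc h * D ≤ r * r ^ 42 := by gcongr
          _ = r ^ 43 := by ring
      have e2 := ab (c := 2) (a := 43) (b := 44) (by norm_num) (by norm_num)
      have e3 := one 43
      have e4 : r ^ 44 ≤ 2 ^ r := pr (by norm_num)
      omega
    have hr2 : h ≤ 2 ^ r := hhr.trans (Nat.lt_two_pow_self).le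
    have hm2 : unitAvoidCount τ h ≤ 2 ^ r := gm.trans (pr (by norm_num))
    have t1 : Z.card ≤ 2 ^ (r ^ 8 + r + r ^ 9) := gZ.trans (two (by omega))
    have t2 : unitAvoidCount τ h ≤ 2 ^ (r ^ 8 + r + r ^ 9) := hm2.trans (two (by omega))
    have t3 : unitCount τ h * (1 + h * D) ≤ 2 ^ (r ^ 8 + r + r ^ 9) := by
      refine (Nat.mul_le_mul gN hD1).trans ?_
      rw [← pow_add]
      exact two (by omega)
    have t4 : unitCount τ h * h * (2 ^ (r + 1)) ^ growthTime r ≤ 2 ^ (r ^ 8 + r + r ^ 9) := by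
      refine (Nat.mul_le_mul (Nat.mul_le_mul gN hr2) (gK gr)).trans ?_
      rw [← pow_add, ← pow_add]
    have t5 : 2 ^ (r ^ 8 + r + r ^ 9 + 2) ≤ 2 ^ r ^ 10 := by
      refine two ?_
      have e1 := ab (c := 5) (a := 9) (b := 10) (by norm_num) (by norm_num)
      have e2 : r ^ 8 ≤ r ^ 9 := pw (by norm_num)
      have e3 : r ≤ r ^ 9 := r1 (by norm_num)
      omega
    rw [pow_add _ _ 2] at t5
    omega
  have y2 : r ^ 97 ≤ y - 1 := by
    have e1 := ab (c := 2) (a := 97) (b := 100) (by norm_num) (by norm_num)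
    have e2 := one 97
    omega
  have hV : 2 ^ r ^ 97 ≤ Fintype.card V := (two y2).trans hy'
  refine balSub_of_low_degree (C := 2 ^ r ^ 93) hE hh2 rfl hR (r1 (by norm_num)) hD hK
    (by positivity) rfl gM
    (initial_growth ?_ hl3 (by omega)) (lr _ (by omega)) ?_ (fun v => ?_) hy hτ rfl ?_ ?_ ?_
  · refine le_trans ?_ hl1
    calc 2 ^ 26 * (l₀ + 4) ^ 8 * h ^ 3 ≤ 2 ^ 26 * (1004 * h) ^ 8 * h ^ 3 := by gcongr; omega
      _ = (2 ^ 26 * 1004 ^ 8) * h ^ 11 := by ring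
      _ ≤ (2 ^ 100 * 2 ^ 100) * h ^ 11 := Nat.mul_le_mul_right _ (by norm_num)
      _ ≤ h * h * h ^ 11 := by gcongr
      _ = h ^ 13 := by ring
      _ ≤ h ^ 1000 := Nat.pow_le_pow_right (by omega) (by norm_num)
  · calc 16 * (r ^ 12 + 3) ^ 2 * 2 ^ r ^ 10 ≤ 16 * (r ^ 13) ^ 2 * 2 ^ r ^ 10 := by gcongr
      _ = 16 * r ^ 26 * 2 ^ r ^ 10 := by ring
      _ ≤ 2 ^ r * 2 ^ r ^ 10 := by
        gcongr
        exact (ab (b := 27) (by norm_num) (by norm_num)).trans (pr (by norm_num))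
      _ = 2 ^ (r + r ^ 10) := by rw [pow_add]
      _ ≤ 2 ^ r ^ 12 := by
        refine two ?_
        have e1 := ab (c := 2) (a := 10) (b := 12) (by norm_num) (by norm_num)
        have e2 : r ≤ r ^ 10 := r1 (by norm_num)
        omega
  · refine le_trans ?_ (hdeg v)
    have e1 : hubCount 2 h ≤ h ^ 2000 := by
      unfold hubCount
      calc 2 ^ 8 * (2 + 1) ^ 2 * h ^ 3 = (2 ^ 8 * 9) * h ^ 3 := by ring
        _ ≤ h ^ 2000 := mul_pow_le_pow_succ hh (by norm_num) (by norm_num)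
    have e2 := mul_pow_le_pow_succ (c := 6) (a := 2000) (b := 2002) hh (by norm_num) (by norm_num)
    have e3 : h ≤ h ^ 2000 := Nat.le_self_pow (by norm_num) h
    omega
  · have c1 : Z.card ^ hubCount (2 * D + 2) h ≤ 2 ^ r ^ 91 := by
      calc _ ≤ (2 ^ r) ^ r ^ 90 := by gcongr; exact Nat.one_le_two_pow
        _ = 2 ^ r ^ 91 := by rw [← pow_mul]; congr 1; ring
    have c2 : D + 1 ≤ 2 ^ r := le_trans (by omega) (d43.trans (pr (by norm_num)))
    calc _ ≤ 2 ^ r * (2 ^ r ^ 91 * 2 ^ r * 2 ^ r ^ 45) :=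
          Nat.mul_le_mul c2 (Nat.mul_le_mul (Nat.mul_le_mul c1 havoid) (gK (by omega)))
      _ = 2 ^ (r + (r ^ 91 + r + r ^ 45)) := by rw [pow_add, pow_add, pow_add]
      _ ≤ 2 ^ r ^ 93 := by
        refine two ?_
        have e1 := ab (c := 5) (a := 91) (b := 93) (by norm_num) (by norm_num)
        have e2 : r ^ 45 ≤ r ^ 91 := pw (by norm_num)
        have e3 : r ≤ r ^ 91 := r1 (by norm_num)
        omega
  · refine le_trans ?_ hV
    calc 2 * (2 ^ (r + 1)) ^ D ≤ 2 ^ 1 * 2 ^ r ^ 44 := Nat.mul_le_mul (by norm_num) (gK gD)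
      _ = 2 ^ (1 + r ^ 44) := by rw [pow_add]
      _ ≤ 2 ^ r ^ 97 := by
        refine two ?_
        have e1 := ab (c := 2) (a := 44) (b := 97) (by norm_num) (by norm_num)
        have e3 := one 44
        omega
  · refine le_trans ?_ hV
    have e40 : r ^ 40 ≤ r ^ 42 := pw (by norm_num)
    have s1 : unitCount τ h * (2 ^ (r + 1)) ^ (2 * (D + R + 1)) ≤ 2 ^ r ^ 95 := by
      have e1 := ab (c := 6) (a := 42) (b := 43) (by norm_num) (by norm_num)
      have e2 := one 42
      calc _ ≤ 2 ^ r ^ 8 * 2 ^ r ^ 45 := Nat.mul_le_mul gN (gK (by omega))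
        _ = 2 ^ (r ^ 8 + r ^ 45) := by rw [pow_add]
        _ ≤ _ := by
          refine two ?_
          have e3 := ab (c := 2) (a := 45) (b := 95) (by norm_num) (by norm_num)
          have e4 : r ^ 8 ≤ r ^ 45 := pw (by norm_num)
          omega
    have s2 : Z.card ≤ 2 ^ r ^ 95 := gZ.trans (two (r1 (by norm_num)))
    have s3 : 2 ^ r ^ 93 * (2 ^ (r + 1)) ^ D ≤ 2 ^ r ^ 95 := by
      calc _ ≤ 2 ^ r ^ 93 * 2 ^ r ^ 44 := Nat.mul_le_mul le_rfl (gK gD)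
        _ = 2 ^ (r ^ 93 + r ^ 44) := by rw [pow_add]
        _ ≤ _ := by
          refine two ?_
          have e3 := ab (c := 2) (a := 93) (b := 95) (by norm_num) (by norm_num)
          have e4 : r ^ 44 ≤ r ^ 93 := pw (by norm_num)
          omega
    have s4 : 2 ^ (r ^ 95 + 2) ≤ 2 ^ r ^ 97 := by
      refine two ?_
      have e3 := ab (c := 3) (a := 95) (b := 97) (by norm_num) (by norm_num)
      have e4 := one 95
      omega
    rw [pow_add] at s4
    omega

theorem exists_balSub_of_expands : ∃ h₀ : ℕ, ∀ h ≥ h₀, ∀ {V : Type} [Fintype V] [Nonempty V]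
    (G : SimpleGraph V), Expands G → (∀ v, h ^ 2002 ≤ (nbhd G v).card) → ∃ ℓ, BalSub G h ℓ := by
  obtain ⟨r₀, hr₀⟩ := exists_pow_le_two_pow 700
  refine ⟨max r₀ (2 ^ 100), fun h hh V _ _ G hE hdeg => ?_⟩
  have hh₁ : r₀ ≤ h := (le_max_left _ _).trans hh
  have hh₂ : 2 ^ 100 ≤ h := (le_max_right _ _).trans hh
  obtain ⟨y, hy⟩ : ∃ y, y = Nat.clog 2 (Fintype.card V) := ⟨_, rfl⟩
  have hcard : Fintype.card V ≤ 2 ^ y := by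
    rw [hy]
    exact Nat.le_pow_clog (by norm_num) _
  rcases lt_or_ge y (h ^ 100) with hyh | hyh
  · exact balSub_of_small hE hh₂ hcard hyh hdeg
  have hpos : 1 ≤ h ^ 100 := Nat.one_le_pow _ _ (lt_of_lt_of_le (by positivity) hh₂)
  have hle : h ≤ y := (Nat.le_self_pow (by norm_num) h).trans hyh
  set r := Nat.findGreatest (fun r => r ^ 100 ≤ y) y with hr
  have hhr : h ≤ r := Nat.le_findGreatest hle hyh
  have hry : r ^ 100 ≤ y := Nat.findGreatest_spec (P := fun r => r ^ 100 ≤ y) hle hyh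
  have hyr : y < (r + 1) ^ 100 := by
    by_contra hc
    have h1 : (r + 1) ^ 100 ≤ y := not_lt.1 hc
    have h2 : r + 1 ≤ y := (Nat.le_self_pow (by norm_num) _).trans h1
    have h3 : r + 1 ≤ r := Nat.le_findGreatest (P := fun r => r ^ 100 ≤ y) h2 h1
    omega
  have hcard' : 2 ^ (y - 1) ≤ Fintype.card V := by
    have h1 : 1 < Fintype.card V := by
      by_contra hc
      rw [hy, Nat.clog_of_right_le_one (by omega)] at hyh
      omega
    rw [hy]
    exact (Nat.pow_pred_clog_lt_self (by norm_num) h1).le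
  exact balSub_of_large hE hh₂ hhr (hr₀ r (hh₁.trans hhr)) hcard hcard' hry hyr hdeg

/-- A graph of large average degree contains a large balanced subdivision of a complete graph
as a (not necessarily induced) subgraph. -/
theorem exists_balSub_of_dense : ∃ h₀ : ℕ, ∀ h ≥ h₀, ∀ {V : Type} [Fintype V] [Nonempty V]
    (G : SimpleGraph V), 4 * h ^ 2002 * Fintype.card V ≤ orderedEdges G univ →
      ∃ ℓ, BalSub G h ℓ := by
  obtain ⟨h₀, hh₀⟩ := exists_balSub_of_expands
  refine ⟨max h₀ 1, fun h hh V _ _ G hG => ?_⟩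
  have hpos : 1 ≤ h ^ 2002 := Nat.one_le_pow _ _ ((le_max_right _ _).trans hh)
  obtain ⟨S, hS, hE, hdeg⟩ := exists_expander G (by omega) hG
  have : Nonempty (S : Set V) := hS.to_subtype
  obtain ⟨ℓ, hℓ⟩ := hh₀ h ((le_max_left _ _).trans hh) (G.induce (S : Set V)) hE fun v =>
    Nat.le_of_mul_le_mul_left (hdeg v) (by norm_num)
  exact ⟨ℓ, hℓ.of_induce⟩

end Parameters

section Sampling

variable {V : Type*} [Fintype V]

lemma le_degree_of_densest {G : SimpleGraph V} {ρ : ℝ}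
    (huniv : ρ * Fintype.card V ≤ orderedEdges G univ)
    (hle : ∀ T : Finset V, (orderedEdges G T : ℝ) ≤ ρ * T.card) (v : V) :
    ρ ≤ 2 * (nbhd G v).card := by
  have h1 : (orderedEdges G univ : ℝ) ≤ orderedEdges G (univ.erase v) + 2 * (nbhd G v).card := by
    exact_mod_cast orderedEdges_univ_le_erase G v
  have h2 := hle (univ.erase v)
  have : Nonempty V := ⟨v⟩
  rw [card_erase_of_mem (mem_univ v), card_univ, Nat.cast_sub Fintype.card_pos] at h2
  push_cast at h2
  linarith

/-- A densest induced subgraph has minimum degree comparable to its hereditary average degree. -/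
lemma exists_densest (G : SimpleGraph V) {D : ℕ} (hD : 0 < D) [Nonempty V]
    (hG : D * Fintype.card V ≤ orderedEdges G univ) :
    ∃ S : Finset V, S.Nonempty ∧ ∃ d, D ≤ d ∧
      (∀ T, orderedEdges (G.induce (S : Set V)) T ≤ d * T.card) ∧
      ∀ v, d ≤ 4 * (nbhd (G.induce (S : Set V)) v).card := by
  obtain ⟨S, hS, hmax⟩ := exists_max_image (univ.filter fun S : Finset V => S.Nonempty)
    (fun S => (orderedEdges G S : ℝ) / S.card) ⟨univ, by simp⟩
  simp only [mem_filter, mem_univ, true_and] at hS hmax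
  set ρ := (orderedEdges G S : ℝ) / S.card with hρ
  have hpos : ∀ T : Finset V, T.Nonempty → (0 : ℝ) < T.card := fun T hT => by
    exact_mod_cast card_pos.2 hT
  have hle : ∀ T : Finset (S : Set V), (orderedEdges (G.induce (S : Set V)) T : ℝ) ≤ ρ * T.card := by
    intro T
    rcases T.eq_empty_or_nonempty with rfl | hT
    · simp [orderedEdges]
    have h1 := hmax (T.map (Function.Embedding.subtype _)) hT.map
    rw [div_le_iff₀ (hpos _ hT.map), card_map] at h1
    rw [orderedEdges_induce]
    exact h1
  have hρD : (D : ℝ) ≤ ρ := by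
    refine le_trans ?_ (hmax univ univ_nonempty)
    rw [le_div_iff₀ (hpos _ univ_nonempty), card_univ]
    exact_mod_cast hG
  have hD1 : (1 : ℝ) ≤ D := by exact_mod_cast hD
  refine ⟨S, hS, ⌈ρ⌉₊, ?_, fun T => ?_, fun v => ?_⟩
  · exact_mod_cast hρD.trans (Nat.le_ceil ρ)
  · have h1 : (orderedEdges (G.induce (S : Set V)) T : ℝ) ≤ ⌈ρ⌉₊ * T.card :=
      (hle T).trans (by gcongr; exact Nat.le_ceil ρ)
    exact_mod_cast h1
  · have h1 : orderedEdges (G.induce (S : Set V)) univ = orderedEdges G S := by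
      rw [orderedEdges_induce]
      congr 1
      ext x
      simp
    have h2 : ρ * Fintype.card (S : Set V) ≤ orderedEdges (G.induce (S : Set V)) univ := by
      rw [h1, hρ]
      simp [div_mul_cancel₀ _ (hpos S hS).ne']
    have h3 := le_degree_of_densest h2 hle v
    have h4 : (⌈ρ⌉₊ : ℝ) < ρ + 1 := Nat.ceil_lt_add_one (by linarith)
    have h5 : (⌈ρ⌉₊ : ℝ) ≤ 4 * (nbhd (G.induce (S : Set V)) v).card := by linarith
    exact_mod_cast h5

lemma card_nbhd_inter_le {G : SimpleGraph V} (hC : C4Free G) {x y : V} (hxy : x ≠ y) :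
    (nbhd G x ∩ nbhd G y).card ≤ 1 := by
  refine card_le_one.2 fun a ha b hb => ?_
  simp only [mem_inter, mem_nbhd] at ha hb
  by_contra hab
  exact hC ⟨x, a, y, b, ha.1.ne, hxy, hb.1.ne, ha.2.ne', hab, hb.2.ne,
    ha.1, ha.2.symm, hb.2, hb.1.symm⟩

lemma orderedEdges_eq_sum (G : SimpleGraph V) (X : Finset V) :
    orderedEdges G X = ∑ v ∈ X, (nbhd G v ∩ X).card := by
  unfold orderedEdges
  rw [card_filter, sum_product]
  refine sum_congr rfl fun v _ => ?_
  rw [← card_filter]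
  congr 1
  ext w
  simp [mem_nbhd, and_comm]

/-- A graph of bounded hereditary average degree has an orientation of bounded outdegree. -/
lemma exists_orientation (G : SimpleGraph V) {d : ℕ}
    (hd : ∀ X : Finset V, orderedEdges G X ≤ d * X.card) :
    ∃ O : V → Finset V, (∀ x, (O x).card ≤ d) ∧ (∀ x, ∀ y ∈ O x, G.Adj x y) ∧
      ∀ x y, G.Adj x y → y ∈ O x ∨ x ∈ O y := by
  suffices h : ∀ n, ∀ X : Finset V, X.card = n → ∃ O : V → Finset V, (∀ x, (O x).card ≤ d) ∧
      (∀ x, ∀ y ∈ O x, G.Adj x y) ∧ ∀ x ∈ X, ∀ y ∈ X, G.Adj x y → y ∈ O x ∨ x ∈ O y by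
    obtain ⟨O, h1, h2, h3⟩ := h _ univ rfl
    exact ⟨O, h1, h2, fun x y => h3 x (mem_univ x) y (mem_univ y)⟩
  intro n
  induction n with
  | zero =>
    intro X hX
    rw [card_eq_zero.1 hX]
    exact ⟨fun _ => ∅, by simp, by simp, by simp⟩
  | succ n ih =>
    intro X hX
    have hne : X.Nonempty := card_pos.1 (by omega)
    obtain ⟨v, hv, hvd⟩ : ∃ v ∈ X, (nbhd G v ∩ X).card ≤ d := by
      refine exists_le_of_sum_le hne ?_
      rw [← orderedEdges_eq_sum, sum_const, smul_eq_mul, mul_comm]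
      exact hd X
    obtain ⟨O, h1, h2, h3⟩ := ih (X.erase v) (by rw [card_erase_of_mem hv]; omega)
    refine ⟨Function.update O v (nbhd G v ∩ X), fun x => ?_, fun x y hy => ?_, fun x hx y hy h => ?_⟩
    · by_cases hx : x = v
      · subst hx; simpa using hvd
      · simpa [hx] using h1 x
    · by_cases hx : x = v
      · subst hx
        simp only [Function.update_self, mem_inter, mem_nbhd] at hy
        exact hy.1
      · rw [Function.update_of_ne hx] at hy
        exact h2 x y hy
    · by_cases hxv : x = v
      · subst hxv
        left
        simpa [mem_nbhd, hy] using h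
      by_cases hyv : y = v
      · subst hyv
        right
        simpa [mem_nbhd, hx] using h.symm
      rw [Function.update_of_ne hxv, Function.update_of_ne hyv]
      exact h3 x (mem_erase.2 ⟨hxv, hx⟩) y (mem_erase.2 ⟨hyv, hy⟩) h

/-- The number of maps to `Fin (p + 1)` vanishing on `T`. -/
lemma card_vanishing (p : ℕ) (T : Finset V) :
    ((univ.filter fun f : V → Fin (p + 1) => ∀ x ∈ T, f x = 0).card : ℝ) =
      ((p : ℝ) + 1) ^ Fintype.card V / ((p : ℝ) + 1) ^ T.card := by
  rw [eq_div_iff (by positivity)]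
  have h1 : (univ.filter fun f : V → Fin (p + 1) => ∀ x ∈ T, f x = 0) =
      Fintype.piFinset fun x => if x ∈ T then {0} else univ := by
    ext f
    simp only [mem_filter, mem_univ, true_and, Fintype.mem_piFinset]
    refine forall_congr' fun x => ?_
    by_cases hx : x ∈ T <;> simp [hx]
  have h2 : (Fintype.piFinset fun x : V => if x ∈ T then {(0 : Fin (p + 1))} else univ).card =
      (p + 1) ^ (univ \ T).card := by
    rw [Fintype.card_piFinset]
    have : ∀ x : V, (if x ∈ T then {(0 : Fin (p + 1))} else univ).card =
        if x ∈ T then 1 else p + 1 := by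
      intro x
      split_ifs <;> simp
    simp_rw [this]
    rw [prod_ite, prod_const_one, prod_const, one_mul]
    congr 2
    ext x
    simp
  rw [h1, h2, card_univ_sdiff]
  push_cast
  rw [← pow_add, Nat.sub_add_cancel (card_le_univ T)]

end Sampling

section Lifting

/-- The graph on `A` whose edges are witnessed by common neighbours in `B`. -/
def linkGraph {V : Type*} (G : SimpleGraph V) (A B : Finset V) : SimpleGraph {x // x ∈ A} where
  Adj x y := x ≠ y ∧ ∃ b ∈ B, G.Adj b x ∧ G.Adj b y
  symm := ⟨fun _ _ h => ⟨h.1.symm, h.2.imp fun _ hb => ⟨hb.1, hb.2.2, hb.2.1⟩⟩⟩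
  loopless := ⟨fun _ h => h.1 rfl⟩

/-- `A` and `B` are the two sides of an induced one-subdivision of `linkGraph G A B`. -/
structure IsLinked {V : Type*} (G : SimpleGraph V) (A B : Finset V) : Prop where
  disj : ∀ x ∈ A, x ∉ B
  indepA : ∀ x ∈ A, ∀ y ∈ A, ¬ G.Adj x y
  indepB : ∀ x ∈ B, ∀ y ∈ B, ¬ G.Adj x y
  two : ∀ b ∈ B, ∃ x ∈ A, ∃ y ∈ A, x ≠ y ∧ G.Adj b x ∧ G.Adj b y ∧
    ∀ z ∈ A, G.Adj b z → z = x ∨ z = y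

lemma IsLinked.eq_or_eq {V : Type*} {G : SimpleGraph V} {A B : Finset V} (hL : IsLinked G A B)
    {b x y z : V} (hb : b ∈ B) (hx : x ∈ A) (hy : y ∈ A) (hz : z ∈ A) (hxy : x ≠ y)
    (hbx : G.Adj b x) (hby : G.Adj b y) (hbz : G.Adj b z) : z = x ∨ z = y := by
  obtain ⟨u, -, v, -, -, -, -, h⟩ := hL.two b hb
  have h1 := h x hx hbx
  have h2 := h y hy hby
  have h3 := h z hz hbz
  grind

lemma IsRouting.eq_cases {V : Type*} {h ℓ : ℕ} {φ : Fin h → V} {f : Pairs h → ℕ → V}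
    (R : IsRouting φ f ℓ) {e e' : Pairs h} {i i' : ℕ} (hi : i ≤ ℓ) (hi' : i' ≤ ℓ)
    (heq : f e i = f e' i') : (e = e' ∧ i = i') ∨
      ((i = 0 ∨ i = ℓ) ∧ (i' = 0 ∨ i' = ℓ) ∧ ∃ k, f e i = φ k ∧ f e' i' = φ k) := by
  have key : ∀ e : Pairs h, ∀ i ≤ ℓ, (0 < i ∧ i < ℓ) ∨ ((i = 0 ∨ i = ℓ) ∧ ∃ k, f e i = φ k) := by
    intro e i hi
    rcases Nat.eq_zero_or_pos i with rfl | h0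
    · exact Or.inr ⟨Or.inl rfl, _, R.start_eq e⟩
    rcases hi.lt_or_eq with h1 | rfl
    · exact Or.inl ⟨h0, h1⟩
    · exact Or.inr ⟨Or.inr rfl, _, R.end_eq e⟩
  rcases key e i hi with h1 | ⟨h1, k, hk⟩ <;> rcases key e' i' hi' with h2 | ⟨h2, k', hk'⟩
  · exact Or.inl (R.inner_inj e e' i i' h1.1 h1.2 h2.1 h2.2 heq)
  · exact absurd (heq.trans hk') (R.ne_branch e i h1.1 h1.2 k')
  · exact absurd (heq.symm.trans hk) (R.ne_branch e' i' h2.1 h2.2 k)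
  · exact Or.inr ⟨h1, h2, k, hk, heq ▸ hk⟩

lemma IsRouting.path_inj {V : Type*} {h ℓ : ℕ} {φ : Fin h → V} {f : Pairs h → ℕ → V}
    (R : IsRouting φ f ℓ) {e : Pairs h} {i i' : ℕ} (hi : i ≤ ℓ) (hi' : i' ≤ ℓ)
    (heq : f e i = f e i') : i = i' := by
  have hne : f e 0 ≠ f e ℓ := by
    rw [R.start_eq, R.end_eq]
    exact fun h => e.2.ne (R.branch_inj h)
  rcases R.eq_cases hi hi' heq with h | ⟨rfl | rfl, rfl | rfl, -⟩
  · exact h.2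
  · rfl
  · exact absurd heq hne
  · exact absurd heq.symm hne
  · rfl

lemma IsRouting.edge_inj {V : Type*} {h ℓ : ℕ} {φ : Fin h → V} {f : Pairs h → ℕ → V}
    (R : IsRouting φ f ℓ) {e e' : Pairs h} {i i' : ℕ} (hi : i < ℓ) (hi' : i' < ℓ)
    (h0 : f e i = f e' i' ∨ f e i = f e' (i' + 1))
    (h1 : f e (i + 1) = f e' i' ∨ f e (i + 1) = f e' (i' + 1)) : e = e' ∧ i = i' := by
  have he : e = e' := by
    rcases Nat.eq_zero_or_pos i with rfl | hpos
    · rcases (show 1 ≤ ℓ by omega).lt_or_eq with hℓ | rfl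
      · rcases h1 with h1 | h1
        · rcases R.eq_cases (by omega) (by omega) h1 with h2 | ⟨h2, -⟩
          · exact h2.1
          · omega
        · rcases R.eq_cases (by omega) (by omega) h1 with h2 | ⟨h2, -⟩
          · exact h2.1
          · omega
      · obtain rfl : i' = 0 := by omega
        have a0 := R.start_eq e
        have a1 := R.end_eq e
        have b0 := R.start_eq e'
        have b1 := R.end_eq e'
        rw [zero_add, a0, b0, b1, R.branch_inj.eq_iff, R.branch_inj.eq_iff] at h0
        rw [zero_add, a1, b0, b1, R.branch_inj.eq_iff, R.branch_inj.eq_iff] at h1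
        have c := e.2
        have c' := e'.2
        refine Subtype.ext (Prod.ext ?_ ?_) <;> omega
    · rcases h0 with h0 | h0
      · rcases R.eq_cases (by omega) (by omega) h0 with h2 | ⟨h2, -⟩
        · exact h2.1
        · omega
      · rcases R.eq_cases (by omega) (by omega) h0 with h2 | ⟨h2, -⟩
        · exact h2.1
        · omega
  subst he
  refine ⟨rfl, ?_⟩
  rcases h0 with h0 | h0
  · exact R.path_inj (by omega) (by omega) h0
  · have h2 := R.path_inj (by omega) (by omega) h0
    rcases h1 with h1 | h1 <;> have h3 := R.path_inj (by omega) (by omega) h1 <;> omega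

theorem IsLinked.balancedSubdivision_embedding {V : Type*} {G : SimpleGraph V} {A B : Finset V}
    (hL : IsLinked G A B) {h ℓ : ℕ} (hℓ : 1 ≤ ℓ) (hb : BalSub (linkGraph G A B) h ℓ) :
    Nonempty (balancedSubdivision h (2 * ℓ) ↪g G) := by
  obtain ⟨φ, f, R, hf⟩ := hb
  have hmid : ∀ (e : Pairs h) (i : ℕ), ∃ b, i < ℓ → b ∈ B ∧ G.Adj b (f e i) ∧
      G.Adj b (f e (i + 1)) := by
    intro e i
    by_cases hi : i < ℓ
    · obtain ⟨-, b, hb⟩ := hf e i hi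
      exact ⟨b, fun _ => hb⟩
    · exact ⟨f e i, fun h => absurd h hi⟩
  choose m hm using hmid
  have hne : ∀ e, ∀ i < ℓ, ((f e i : {x // x ∈ A}) : V) ≠ f e (i + 1) := fun e i hi hc =>
    (hf e i hi).1 (Subtype.ext hc)
  have adj_m : ∀ e, ∀ i < ℓ, ∀ x : {x // x ∈ A}, G.Adj x (m e i) ↔ x = f e i ∨ x = f e (i + 1) := by
    intro e i hi x
    obtain ⟨h1, h2, h3⟩ := hm e i hi
    constructor
    · intro hx
      rcases hL.eq_or_eq h1 (f e i).2 (f e (i + 1)).2 x.2 (hne e i hi) h2 h3 hx.symm with h4 | h4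
      · exact Or.inl (Subtype.ext h4)
      · exact Or.inr (Subtype.ext h4)
    · rintro (rfl | rfl)
      · exact h2.symm
      · exact h3.symm
  have m_inj : ∀ e e', ∀ i < ℓ, ∀ i' < ℓ, m e i = m e' i' → e = e' ∧ i = i' := by
    intro e e' i hi i' hi' heq
    obtain ⟨h1, h2, h3⟩ := hm e i hi
    rw [heq] at h2 h3
    exact R.edge_inj hi hi' ((adj_m e' i' hi' _).1 h2.symm) ((adj_m e' i' hi' _).1 h3.symm)
  obtain ⟨P, hPe, hPo⟩ : ∃ P : Pairs h → ℕ → V, (∀ e i, P e (2 * i) = f e i) ∧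
      ∀ e i, P e (2 * i + 1) = m e i := by
    refine ⟨fun e j => if j % 2 = 0 then f e (j / 2) else m e (j / 2), fun e i => ?_, fun e i => ?_⟩
    · simp
    · have h1 : (2 * i + 1) % 2 = 1 := by omega
      have h2 : (2 * i + 1) / 2 = i := by omega
      simp [h1, h2]
  have par : ∀ j : ℕ, 0 < j → j < 2 * ℓ →
      (∃ i, 0 < i ∧ i < ℓ ∧ j = 2 * i) ∨ ∃ i < ℓ, j = 2 * i + 1 := by
    intro j h0 h1
    rcases Nat.even_or_odd' j with ⟨i, rfl | rfl⟩
    · exact Or.inl ⟨i, by omega, by omega, rfl⟩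
    · exact Or.inr ⟨i, by omega, rfl⟩
  have adj_branch : ∀ u (e : Pairs h) (j : ℕ), 0 < j → j < 2 * ℓ → (G.Adj (φ u) (P e j) ↔
      (u = e.1.1 ∧ j = 1) ∨ (u = e.1.2 ∧ j = 2 * ℓ - 1)) := by
    intro u e j h0 h1
    rcases par j h0 h1 with ⟨i, h2, h3, rfl⟩ | ⟨i, h2, rfl⟩
    · rw [hPe]
      exact ⟨fun h => absurd h (hL.indepA _ (φ u).2 _ (f e i).2), fun h => by omega⟩
    · rw [hPo, adj_m e i h2]
      constructor
      · rintro (h3 | h3)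
        · rcases Nat.eq_zero_or_pos i with rfl | hi
          · rw [R.start_eq] at h3
            exact Or.inl ⟨R.branch_inj h3, rfl⟩
          · exact absurd h3.symm (R.ne_branch e i hi h2 u)
        · rcases (show i + 1 ≤ ℓ from h2).lt_or_eq with hi | hi
          · exact absurd h3.symm (R.ne_branch e (i + 1) (by omega) hi u)
          · rw [hi, R.end_eq] at h3
            exact Or.inr ⟨R.branch_inj h3, by omega⟩
      · rintro (⟨rfl, h3⟩ | ⟨rfl, h3⟩)
        · obtain rfl : i = 0 := by omega
          exact Or.inl (R.start_eq e).symm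
        · obtain rfl : ℓ = i + 1 := by omega
          exact Or.inr (R.end_eq e).symm
  have adj_even_odd : ∀ (e e' : Pairs h) (i i' : ℕ), 0 < i → i < ℓ → i' < ℓ →
      (G.Adj (f e i) (m e' i') ↔ e = e' ∧ (i = i' ∨ i = i' + 1)) := by
    intro e e' i i' h0 h1 h2
    rw [adj_m e' i' h2]
    constructor
    · rintro (h3 | h3)
      · rcases R.eq_cases h1.le h2.le h3 with h4 | ⟨h4, -⟩
        · exact ⟨h4.1, Or.inl h4.2⟩
        · omega
      · rcases R.eq_cases h1.le h2 h3 with h4 | ⟨h4, -⟩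
        · exact ⟨h4.1, Or.inr h4.2⟩
        · omega
    · rintro ⟨rfl, rfl | rfl⟩
      · exact Or.inl rfl
      · exact Or.inr rfl
  have adj_inner : ∀ (e e' : Pairs h) (j j' : ℕ), 0 < j → j < 2 * ℓ → 0 < j' → j' < 2 * ℓ →
      (G.Adj (P e j) (P e' j') ↔ e = e' ∧ (j' = j + 1 ∨ j = j' + 1)) := by
    intro e e' j j' h0 h1 h0' h1'
    rcases par j h0 h1 with ⟨i, h2, h3, rfl⟩ | ⟨i, h2, rfl⟩ <;>
      rcases par j' h0' h1' with ⟨i', h2', h3', rfl⟩ | ⟨i', h2', rfl⟩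
    · rw [hPe, hPe]
      exact ⟨fun h => absurd h (hL.indepA _ (f e i).2 _ (f e' i').2), fun h => by omega⟩
    · rw [hPe, hPo, adj_even_odd e e' i i' h2 h3 h2']
      exact and_congr_right fun _ => by omega
    · rw [hPe, hPo, G.adj_comm, adj_even_odd e' e i' i h2' h3' h2, eq_comm]
      exact and_congr_right fun _ => by omega
    · rw [hPo, hPo]
      exact ⟨fun h => absurd h (hL.indepB _ (hm e i h2).1 _ (hm e' i' h2').1), fun h => by omega⟩
  have P_branch : ∀ u (e : Pairs h) (j : ℕ), 0 < j → j < 2 * ℓ → (φ u : V) ≠ P e j := by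
    intro u e j h0 h1 hc
    rcases par j h0 h1 with ⟨i, h2, h3, rfl⟩ | ⟨i, h2, rfl⟩
    · rw [hPe] at hc
      exact R.ne_branch e i h2 h3 u (Subtype.ext hc.symm)
    · rw [hPo] at hc
      exact hL.disj _ (φ u).2 (hc ▸ (hm e i h2).1)
  have P_inj : ∀ (e e' : Pairs h) (j j' : ℕ), 0 < j → j < 2 * ℓ → 0 < j' → j' < 2 * ℓ →
      P e j = P e' j' → e = e' ∧ j = j' := by
    intro e e' j j' h0 h1 h0' h1' hc
    rcases par j h0 h1 with ⟨i, h2, h3, rfl⟩ | ⟨i, h2, rfl⟩ <;>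
      rcases par j' h0' h1' with ⟨i', h2', h3', rfl⟩ | ⟨i', h2', rfl⟩
    · rw [hPe, hPe] at hc
      have := R.inner_inj e e' i i' h2 h3 h2' h3' (Subtype.ext hc)
      exact ⟨this.1, by omega⟩
    · rw [hPe, hPo] at hc
      exact absurd (hc ▸ (hm e' i' h2').1) (hL.disj _ (f e i).2)
    · rw [hPe, hPo] at hc
      exact absurd (hc ▸ (hm e i h2).1) (hL.disj _ (f e' i').2)
    · rw [hPo, hPo] at hc
      have := m_inj e e' i h2 i' h2' hc
      exact ⟨this.1, by omega⟩
  have bd : ∀ i : Fin (2 * ℓ - 1), (i : ℕ) + 1 < 2 * ℓ := fun i => by omega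
  refine ⟨⟨⟨Sum.elim (fun u => φ u) fun p => P p.1 (p.2 + 1), ?_⟩, ?_⟩⟩
  · rintro (u | ⟨e, i⟩) (v | ⟨e', j⟩) huv
    · exact congrArg _ (R.branch_inj (Subtype.ext huv))
    · exact absurd huv (P_branch u e' _ (Nat.succ_pos _) (bd j))
    · exact absurd huv.symm (P_branch v e _ (Nat.succ_pos _) (bd i))
    · obtain ⟨rfl, h2⟩ := P_inj e e' _ _ (Nat.succ_pos _) (bd i) (Nat.succ_pos _) (bd j) huv
      obtain rfl : i = j := by omega
      rfl
  · rintro (u | ⟨e, i⟩) (v | ⟨e', j⟩)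
    · simp only [balancedSubdivision, SimpleGraph.fromRel_adj, or_self, and_false, iff_false]
      exact hL.indepA _ (φ u).2 _ (φ v).2
    · simp only [balancedSubdivision, SimpleGraph.fromRel_adj, or_false, ne_eq, reduceCtorEq,
        not_false_eq_true, true_and]
      refine (adj_branch u e' _ (Nat.succ_pos _) (bd j)).trans ?_
      refine or_congr (and_congr_right fun _ => ?_) (and_congr_right fun _ => ?_) <;> omega
    · simp only [balancedSubdivision, SimpleGraph.fromRel_adj, false_or, ne_eq, reduceCtorEq,
        not_false_eq_true, true_and]
      refine (G.adj_comm _ _).trans ((adj_branch v e _ (Nat.succ_pos _) (bd i)).trans ?_)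
      refine or_congr (and_congr_right fun _ => ?_) (and_congr_right fun _ => ?_) <;> omega
    · simp only [balancedSubdivision, SimpleGraph.fromRel_adj]
      refine (adj_inner e e' _ _ (Nat.succ_pos _) (bd i) (Nat.succ_pos _) (bd j)).trans ?_
      constructor
      · rintro ⟨rfl, h2⟩
        refine ⟨?_, ?_⟩
        · rintro ⟨⟩
          omega
        · rcases h2 with h2 | h2
          · exact Or.inl ⟨rfl, by omega⟩
          · exact Or.inr ⟨rfl, by omega⟩
      · rintro ⟨-, ⟨rfl, h2⟩ | ⟨rfl, h2⟩⟩
        · exact ⟨rfl, by omega⟩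
        · exact ⟨rfl, by omega⟩

end Lifting

section Selection

variable {V : Type*} [Fintype V]

/-- The vertices on which a sample must not vanish for `b` to be linked to exactly `a` and `a'`. -/
noncomputable def sideSet (G : SimpleGraph V) (O : V → Finset V) (L : Finset V) (b a a' : V) :
    Finset V :=
  insert b (nbhd G b ∪ (O a ∪ O a') ∪
    ((nbhd G b ∩ nbhd G a ∪ nbhd G b ∩ nbhd G a') ∩ L).biUnion (nbhd G)) \ {a, a'}

/-- The sample given by the zeros of `f` makes `b` a link between `a` and `a'`, and no neighbour of
`b` in `L` is also a link. -/
structure IsSelected (G : SimpleGraph V) (O : V → Finset V) (L : Finset V) {p : ℕ}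
    (f : V → Fin (p + 1)) (b a a' : V) : Prop where
  left : f a = 0
  right : f a' = 0
  side : ∀ z ∈ sideSet G O L b a a', f z ≠ 0
  pair : ∀ c ∈ L, G.Adj b c → ¬ G.Adj c a → ¬ G.Adj c a' → ∀ x y, G.Adj c x → G.Adj c y → x ≠ y →
    f x = 0 → f y ≠ 0

/-- The ordered pairs of distinct nonadjacent neighbours of `b`. -/
noncomputable def linkPairs (G : SimpleGraph V) (b : V) : Finset (V × V) :=
  (nbhd G b ×ˢ nbhd G b).filter fun t => t.1 ≠ t.2 ∧ ¬ G.Adj t.1 t.2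

lemma mem_linkPairs {G : SimpleGraph V} {b : V} {t : V × V} : t ∈ linkPairs G b ↔
    (G.Adj b t.1 ∧ G.Adj b t.2) ∧ t.1 ≠ t.2 ∧ ¬ G.Adj t.1 t.2 := by
  simp [linkPairs, mem_nbhd]

/-- The branch side of the subdivision given by a sample. -/
noncomputable def branchSide (O : V → Finset V) {p : ℕ} (f : V → Fin (p + 1)) : Finset V :=
  univ.filter fun a => f a = 0 ∧ ∀ z ∈ O a, f z ≠ 0

/-- The link side of the subdivision given by a sample. -/
noncomputable def linkSide (G : SimpleGraph V) (O : V → Finset V) (L : Finset V) {p : ℕ}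
    (f : V → Fin (p + 1)) : Finset V :=
  L.filter fun b => ∃ t ∈ linkPairs G b, IsSelected G O L f b t.1 t.2

lemma IsSelected.eq_or_eq {G : SimpleGraph V} {O : V → Finset V} {L : Finset V} {p : ℕ}
    {f : V → Fin (p + 1)} {b a a' z : V} (h : IsSelected G O L f b a a') (hz : G.Adj b z)
    (hf : f z = 0) : z = a ∨ z = a' := by
  by_contra hc
  refine h.side z ?_ hf
  simp only [sideSet, mem_sdiff, mem_insert, mem_union, mem_nbhd, hz, true_or, or_true,
    mem_singleton, true_and]
  exact hc

lemma isLinked_sides {G : SimpleGraph V} (hC : C4Free G) {O : V → Finset V}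
    (hO : ∀ x, ∀ y ∈ O x, G.Adj x y) (hO' : ∀ x y, G.Adj x y → y ∈ O x ∨ x ∈ O y)
    (L : Finset V) {p : ℕ} (f : V → Fin (p + 1)) :
    IsLinked G (branchSide O f) (linkSide G O L f) := by
  have hA : ∀ {x}, x ∈ branchSide O f ↔ f x = 0 ∧ ∀ z ∈ O x, f z ≠ 0 := by
    intro x
    simp [branchSide]
  have hB : ∀ {b}, b ∈ linkSide G O L f ↔
      b ∈ L ∧ ∃ t ∈ linkPairs G b, IsSelected G O L f b t.1 t.2 := by
    intro b
    rw [linkSide, mem_filter]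
  refine ⟨fun x hx hx' => ?_, fun x hx y hy hxy => ?_, fun b hb c hc hbc => ?_, fun b hb => ?_⟩
  · obtain ⟨-, t, ht, hs⟩ := hB.1 hx'
    rw [mem_linkPairs] at ht
    refine hs.side x ?_ (hA.1 hx).1
    simp only [sideSet, mem_sdiff, mem_insert, true_or, mem_singleton, true_and, not_or]
    exact ⟨ht.1.1.ne, ht.1.2.ne⟩
  · rcases hO' x y hxy with h | h
    · exact (hA.1 hx).2 y h (hA.1 hy).1
    · exact (hA.1 hy).2 x h (hA.1 hx).1
  · obtain ⟨-, ⟨a, a'⟩, ht, hs⟩ := hB.1 hb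
    obtain ⟨hcL, ⟨x, y⟩, ht', hs'⟩ := hB.1 hc
    rw [mem_linkPairs] at ht ht'
    obtain ⟨⟨h1, h2⟩, h3, -⟩ := ht
    obtain ⟨⟨h1', h2'⟩, h3', -⟩ := ht'
    simp only at h1 h2 h3 h1' h2' h3' hs hs'
    by_cases hadj : G.Adj c a ∨ G.Adj c a'
    · have hz : ∀ z, G.Adj c z → f z = 0 → z = a ∨ z = a' := by
        intro z hcz hfz
        by_contra hne
        refine hs.side z ?_ hfz
        simp only [sideSet, mem_sdiff, mem_insert, mem_union, mem_biUnion, mem_inter, mem_nbhd,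
          mem_singleton]
        refine ⟨Or.inr (Or.inr ⟨c, ⟨?_, hcL⟩, hcz⟩), hne⟩
        rcases hadj with h | h
        · exact Or.inl ⟨hbc, h.symm⟩
        · exact Or.inr ⟨hbc, h.symm⟩
      have hx := hz x h1' hs'.left
      have hy := hz y h2' hs'.right
      have hca : G.Adj c a ∧ G.Adj c a' := by
        rcases hx with rfl | rfl <;> rcases hy with rfl | rfl
        · exact absurd rfl h3'
        · exact ⟨h1', h2'⟩
        · exact ⟨h2', h1'⟩
        · exact absurd rfl h3'
      exact hC ⟨b, a, c, a', h1.ne, hbc.ne, h2.ne, hca.1.ne', h3, hca.2.ne, h1, hca.1.symm, hca.2,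
        h2.symm⟩
    · rw [not_or] at hadj
      exact hs.pair c hcL hbc hadj.1 hadj.2 x y h1' h2' h3' hs'.left hs'.right
  · obtain ⟨-, ⟨a, a'⟩, ht, hs⟩ := hB.1 hb
    rw [mem_linkPairs] at ht
    obtain ⟨⟨h1, h2⟩, h3, h4⟩ := ht
    simp only at h1 h2 h3 h4 hs
    refine ⟨a, hA.2 ⟨hs.left, fun z hz => hs.side z ?_⟩, a',
      hA.2 ⟨hs.right, fun z hz => hs.side z ?_⟩, h3, h1, h2, fun z hz hbz =>
        hs.eq_or_eq hbz (hA.1 hz).1⟩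
    · have hadj := hO _ _ hz
      simp only [sideSet, mem_sdiff, mem_insert, mem_union, hz, true_or, or_true, mem_singleton,
        true_and, not_or]
      exact ⟨hadj.ne', fun h => h4 (h ▸ hadj)⟩
    · have hadj := hO _ _ hz
      simp only [sideSet, mem_sdiff, mem_insert, mem_union, hz, true_or, or_true, mem_singleton,
        true_and, not_or]
      exact ⟨fun h => h4 (h ▸ hadj).symm, hadj.ne'⟩

lemma card_sideSet_le {G : SimpleGraph V} (hC : C4Free G) {O : V → Finset V} {L : Finset V}
    {d : ℕ} (hd : 1 ≤ d) (hO : ∀ x, (O x).card ≤ d) (hL : ∀ x ∈ L, (nbhd G x).card ≤ 8 * d)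
    {b a a' : V} (hb : b ∈ L) (hba : b ≠ a) (hba' : b ≠ a') :
    (sideSet G O L b a a').card ≤ 27 * d := by
  have h1 := card_nbhd_inter_le hC hba
  have h2 := card_nbhd_inter_le hC hba'
  have h3 : (((nbhd G b ∩ nbhd G a ∪ nbhd G b ∩ nbhd G a') ∩ L).biUnion (nbhd G)).card ≤
      2 * (8 * d) := by
    refine (card_biUnion_le_card_mul _ _ (8 * d) fun x hx => hL x (mem_inter.1 hx).2).trans ?_
    refine Nat.mul_le_mul_right _ ((card_le_card inter_subset_left).trans ?_)
    exact (card_union_le _ _).trans (by omega)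
  have h4 := hL b hb
  have h5 := hO a
  have h6 := hO a'
  unfold sideSet
  refine (card_le_card sdiff_subset).trans ((card_insert_le _ _).trans ?_)
  have h7 := card_union_le (nbhd G b ∪ (O a ∪ O a'))
    (((nbhd G b ∩ nbhd G a ∪ nbhd G b ∩ nbhd G a') ∩ L).biUnion (nbhd G))
  have h8 := card_union_le (nbhd G b) (O a ∪ O a')
  have h9 := card_union_le (O a) (O a')
  omega

lemma card_selected_ge {G : SimpleGraph V} (hC : C4Free G) {O : V → Finset V} {L : Finset V}
    {d p : ℕ} (hd : 1 ≤ d) (hO : ∀ x, (O x).card ≤ d) (hL : ∀ x ∈ L, (nbhd G x).card ≤ 8 * d)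
    (hp : 108 * d ≤ p + 1) (hp' : 2048 * d ^ 3 ≤ (p + 1) ^ 2) {b : V} (hb : b ∈ L) {t : V × V}
    (ht : t ∈ linkPairs G b) :
    ((p : ℝ) + 1) ^ Fintype.card V / ((p : ℝ) + 1) ^ 2 / 2 ≤
      (univ.filter fun f : V → Fin (p + 1) => IsSelected G O L f b t.1 t.2).card := by
  obtain ⟨a, a'⟩ := t
  rw [mem_linkPairs] at ht
  obtain ⟨⟨h1, h2⟩, h3, h4⟩ := ht
  simp only at h1 h2 h3 h4 ⊢
  set q : ℝ := (p : ℝ) + 1 with hq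
  set P : ℝ := q ^ Fintype.card V with hP
  have hq0 : 0 < q := by positivity
  have hP0 : 0 < P := by positivity
  set Z : Finset V → Finset (V → Fin (p + 1)) := fun T => univ.filter fun f => ∀ x ∈ T, f x = 0
    with hZ
  have cZ : ∀ T, ((Z T).card : ℝ) = P / q ^ T.card := fun T => card_vanishing p T
  set Q : Finset (V × V) := (nbhd G b ∩ L).biUnion fun c => (nbhd G c ×ˢ nbhd G c).filter
    fun s => s.1 ≠ s.2 ∧ ¬ G.Adj c a ∧ ¬ G.Adj c a' with hQ
  have cQ : Q.card ≤ 512 * d ^ 3 := by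
    calc Q.card ≤ (nbhd G b ∩ L).card * (8 * d) ^ 2 := by
          refine card_biUnion_le_card_mul _ _ _ fun c hc => (card_filter_le _ _).trans ?_
          rw [card_product, ← sq]
          exact Nat.pow_le_pow_left (hL c (mem_inter.1 hc).2) 2
      _ ≤ (8 * d) * (8 * d) ^ 2 :=
          Nat.mul_le_mul_right _ ((card_le_card inter_subset_left).trans (hL b hb))
      _ = 512 * d ^ 3 := by ring
  have cS := card_sideSet_le hC hd hO hL hb h1.ne h2.ne
  have hcover : Z {a, a'} ⊆ (univ.filter fun f : V → Fin (p + 1) => IsSelected G O L f b a a') ∪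
      ((sideSet G O L b a a').biUnion (fun z => Z {a, a', z}) ∪
        Q.biUnion fun s => Z {a, a', s.1, s.2}) := by
    intro f hf
    simp only [hZ, mem_filter, mem_univ, true_and, mem_insert, mem_singleton, forall_eq_or_imp,
      forall_eq] at hf
    simp only [hZ, mem_union, mem_filter, mem_univ, true_and, mem_biUnion, mem_insert,
      mem_singleton, forall_eq_or_imp, forall_eq]
    by_contra hc
    simp only [not_or, not_exists, not_and] at hc
    obtain ⟨c1, c2, c3⟩ := hc
    refine c1 ⟨hf.1, hf.2, fun z hz => c2 z hz hf.1 hf.2, ?_⟩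
    intro c hcL hbc hca hca' x y hx hy hxy hfx
    refine c3 (x, y) ?_ hf.1 hf.2 hfx
    simp only [hQ, mem_biUnion, mem_inter, mem_nbhd, mem_filter, mem_product]
    exact ⟨c, ⟨hbc, hcL⟩, ⟨hx, hy⟩, hxy, hca, hca'⟩
  have c2 : ({a, a'} : Finset V).card = 2 := card_pair h3
  have u1 : (((sideSet G O L b a a').biUnion fun z => Z {a, a', z}).card : ℝ) ≤
      27 * d * (P / q ^ 3) := by
    calc _ ≤ ∑ z ∈ sideSet G O L b a a', ((Z {a, a', z}).card : ℝ) := by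
          exact_mod_cast card_biUnion_le
      _ = ∑ z ∈ sideSet G O L b a a', P / q ^ 3 := by
          refine sum_congr rfl fun z hz => ?_
          simp only [sideSet, mem_sdiff, mem_insert, mem_singleton, not_or] at hz
          rw [cZ, card_eq_three.2 ⟨a, a', z, h3, Ne.symm hz.2.1, Ne.symm hz.2.2, rfl⟩]
      _ = (sideSet G O L b a a').card * (P / q ^ 3) := by rw [sum_const, nsmul_eq_mul]
      _ ≤ _ := by
          gcongr
          exact_mod_cast cS
  have u2 : ((Q.biUnion fun s => Z {a, a', s.1, s.2}).card : ℝ) ≤ 512 * d ^ 3 * (P / q ^ 4) := by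
    calc _ ≤ ∑ s ∈ Q, ((Z {a, a', s.1, s.2}).card : ℝ) := by
          exact_mod_cast card_biUnion_le
      _ = ∑ s ∈ Q, P / q ^ 4 := by
          refine sum_congr rfl fun s hs => ?_
          simp only [hQ, mem_biUnion, mem_inter, mem_nbhd, mem_filter, mem_product] at hs
          obtain ⟨c, -, ⟨hx, hy⟩, hxy, hca, hca'⟩ := hs
          have e : ({a, a', s.1, s.2} : Finset V).card = 4 := by
            have n1 : a ≠ s.1 := fun h => hca (h ▸ hx)
            have n2 : a ≠ s.2 := fun h => hca (h ▸ hy)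
            have n3 : a' ≠ s.1 := fun h => hca' (h ▸ hx)
            have n4 : a' ≠ s.2 := fun h => hca' (h ▸ hy)
            rw [card_insert_of_notMem (by simp [h3, n1, n2]),
              card_insert_of_notMem (by simp [n3, n4]), card_pair hxy]
          rw [cZ, e]
      _ = Q.card * (P / q ^ 4) := by rw [sum_const, nsmul_eq_mul]
      _ ≤ _ := by
          gcongr
          exact_mod_cast cQ
  have htot : ((Z {a, a'}).card : ℝ) ≤
      (univ.filter fun f : V → Fin (p + 1) => IsSelected G O L f b a a').card +
        (27 * d * (P / q ^ 3) + 512 * d ^ 3 * (P / q ^ 4)) := by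
    refine le_trans ?_ (add_le_add_right (add_le_add u1 u2) _)
    exact_mod_cast (card_le_card hcover).trans ((card_union_le _ _).trans
      (Nat.add_le_add_left (card_union_le _ _) _))
  rw [cZ, c2] at htot
  have v1 : 27 * d * (P / q ^ 3) ≤ P / q ^ 2 / 4 := by
    have e : (108 : ℝ) * d ≤ q := by rw [hq]; exact_mod_cast hp
    have e2 : P / q ^ 2 = q * (P / q ^ 3) := by field_simp
    rw [e2]
    have : 0 ≤ P / q ^ 3 := by positivity
    nlinarith
  have v2 : 512 * d ^ 3 * (P / q ^ 4) ≤ P / q ^ 2 / 4 := by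
    have e : (2048 : ℝ) * d ^ 3 ≤ q ^ 2 := by rw [hq]; exact_mod_cast hp'
    have e2 : P / q ^ 2 = q ^ 2 * (P / q ^ 4) := by field_simp
    rw [e2]
    have : 0 ≤ P / q ^ 4 := by positivity
    nlinarith
  linarith

lemma card_linkPairs_ge {G : SimpleGraph V} (hC : C4Free G) {d : ℕ} (hd : 16 ≤ d) {b : V}
    (hb : d ≤ 4 * (nbhd G b).card) : d ^ 2 ≤ 32 * (linkPairs G b).card := by
  set N := nbhd G b with hN
  have h1 : (N ×ˢ N).card ≤ (linkPairs G b).card + (N.card + N.card) := by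
    have hcover : N ×ˢ N ⊆ linkPairs G b ∪ (N.image (fun x => (x, x)) ∪
        N.biUnion fun x => (N ∩ nbhd G x).image fun y => (x, y)) := by
      rintro ⟨x, y⟩ hxy
      rw [mem_product] at hxy
      simp only [linkPairs, ← hN, mem_union, mem_filter, mem_product, hxy.1, hxy.2, mem_image,
        mem_biUnion, mem_inter, mem_nbhd, Prod.mk.injEq]
      by_cases h : x = y
      · exact Or.inr (Or.inl ⟨x, hxy.1, rfl, h⟩)
      by_cases h' : G.Adj x y
      · exact Or.inr (Or.inr ⟨x, hxy.1, y, ⟨hxy.2, h'⟩, rfl, rfl⟩)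
      · exact Or.inl ⟨⟨trivial, trivial⟩, h, h'⟩
    refine (card_le_card hcover).trans ((card_union_le _ _).trans (Nat.add_le_add_left ?_ _))
    refine (card_union_le _ _).trans (Nat.add_le_add card_image_le ?_)
    refine (card_biUnion_le_card_mul _ _ 1 fun x hx => card_image_le.trans ?_).trans
      (by rw [mul_one])
    exact card_nbhd_inter_le hC (mem_nbhd.1 hx).ne
  rw [card_product] at h1
  nlinarith

lemma card_selected_le {G : SimpleGraph V} {O : V → Finset V} {L : Finset V} {p : ℕ}
    (f : V → Fin (p + 1)) {b : V} (hb : b ∈ L) :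
    ((linkPairs G b).filter fun t => IsSelected G O L f b t.1 t.2).card ≤
      2 * if b ∈ linkSide G O L f then 1 else 0 := by
  rcases ((linkPairs G b).filter fun t => IsSelected G O L f b t.1 t.2).eq_empty_or_nonempty with
    h | ⟨⟨u, v⟩, h⟩
  · rw [h]
    simp
  · rw [mem_filter] at h
    have hmem : b ∈ linkSide G O L f := mem_filter.2 ⟨hb, _, h⟩
    rw [if_pos hmem]
    refine (card_le_card (t := {(u, v), (v, u)}) ?_).trans card_le_two
    rintro ⟨x, y⟩ hxy
    rw [mem_filter, mem_linkPairs] at hxy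
    obtain ⟨⟨⟨h1, h2⟩, h3, -⟩, hs⟩ := hxy
    simp only at h1 h2 h3
    have e1 := h.2.eq_or_eq h1 hs.left
    have e2 := h.2.eq_or_eq h2 hs.right
    simp only at e1 e2
    simp only [mem_insert, mem_singleton, Prod.mk.injEq]
    grind

/-- A `C₄`-free graph of large degree contains an induced one-subdivision of a dense graph. -/
theorem exists_isLinked {G : SimpleGraph V} [Nonempty V] (hC : C4Free G) {d : ℕ} (hd : 16 ≤ d)
    (hdens : ∀ X : Finset V, orderedEdges G X ≤ d * X.card)
    (hmin : ∀ v, d ≤ 4 * (nbhd G v).card) :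
    ∃ A B, IsLinked G A B ∧ A.Nonempty ∧ A.card * Nat.sqrt d ≤ 2 ^ 15 * B.card := by
  obtain ⟨O, hO, hO₁, hO₂⟩ := exists_orientation G hdens
  set s := Nat.sqrt d with hs
  have hs1 : 1 ≤ s := Nat.le_sqrt.2 (by omega)
  have hs2 : s * s ≤ d := Nat.sqrt_le d
  have hs3 : d < (s + 1) * (s + 1) := Nat.lt_succ_sqrt d
  set L : Finset V := univ.filter fun v => (nbhd G v).card ≤ 8 * d with hL
  set n := Fintype.card V with hn
  have hn1 : 1 ≤ n := Fintype.card_pos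
  have hLc : 7 * n ≤ 8 * L.card := by
    have h1 := hdens univ
    rw [orderedEdges_eq_sum, card_univ] at h1
    have h2 : (univ \ L).card * (8 * d) ≤ ∑ v, (nbhd G v ∩ univ).card := by
      rw [← smul_eq_mul, ← sum_const]
      refine (sum_le_sum fun v hv => ?_).trans (sum_le_sum_of_subset (subset_univ (univ \ L)))
      have h3 : ¬ (nbhd G v).card ≤ 8 * d := by simpa [hL] using hv
      rw [inter_univ]
      omega
    have h4 : d * (8 * (univ \ L).card) ≤ d * n := by
      calc _ = (univ \ L).card * (8 * d) := by ring
        _ ≤ _ := h2.trans h1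
    have h5 := Nat.le_of_mul_le_mul_left h4 (by omega)
    rw [card_univ_sdiff] at h5
    have h6 := card_le_univ L
    omega
  obtain ⟨p, hp⟩ : ∃ p, p + 1 = 64 * d * (s + 1) := by
    have : 1 ≤ 64 * d * (s + 1) := Nat.mul_pos (by omega) (by omega)
    exact ⟨64 * d * (s + 1) - 1, by omega⟩
  have hp1 : 108 * d ≤ p + 1 := by
    rw [hp]
    nlinarith
  have hp2 : 2048 * d ^ 3 ≤ (p + 1) ^ 2 := by
    rw [hp]
    calc 2048 * d ^ 3 = 2048 * d ^ 2 * d := by ring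
      _ ≤ 4096 * d ^ 2 * ((s + 1) * (s + 1)) := Nat.mul_le_mul (by omega) hs3.le
      _ = _ := by ring
  set q : ℝ := (p : ℝ) + 1 with hq
  set P : ℝ := q ^ n with hP
  have hq0 : 0 < q := by positivity
  have hP0 : 0 < P := by positivity
  have hn0 : (0 : ℝ) < n := by exact_mod_cast hn1
  have hd0 : (0 : ℝ) < d := by exact_mod_cast (show 0 < d by omega)
  have hAsum : ∑ f : V → Fin (p + 1), ((branchSide O f).card : ℝ) ≤ n * (P / q) := by
    calc _ ≤ ∑ f : V → Fin (p + 1), ∑ a : V, if f a = 0 then (1 : ℝ) else 0 := by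
          refine sum_le_sum fun f _ => ?_
          rw [← sum_filter, sum_const, nsmul_eq_mul, mul_one, Nat.cast_le]
          refine card_le_card fun a ha => ?_
          rw [branchSide, mem_filter] at ha
          exact mem_filter.2 ⟨mem_univ a, ha.2.1⟩
      _ = ∑ a : V, ∑ f : V → Fin (p + 1), if f a = 0 then (1 : ℝ) else 0 := sum_comm
      _ = ∑ a : V, P / q := by
          refine sum_congr rfl fun a _ => ?_
          rw [← sum_filter, sum_const, nsmul_eq_mul, mul_one]
          simpa using card_vanishing p {a}
      _ = n * (P / q) := by rw [sum_const, nsmul_eq_mul, card_univ]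
  have hBsum : L.card * (d ^ 2 / 32 * (P / q ^ 2 / 2)) ≤
      2 * ∑ f : V → Fin (p + 1), ((linkSide G O L f).card : ℝ) := by
    calc (L.card : ℝ) * (d ^ 2 / 32 * (P / q ^ 2 / 2))
        = ∑ b ∈ L, (d : ℝ) ^ 2 / 32 * (P / q ^ 2 / 2) := by rw [sum_const, nsmul_eq_mul]
      _ ≤ ∑ b ∈ L, ∑ t ∈ linkPairs G b,
            ((univ.filter fun f : V → Fin (p + 1) => IsSelected G O L f b t.1 t.2).card : ℝ) := by
          refine sum_le_sum fun b hb => ?_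
          calc _ ≤ ((linkPairs G b).card : ℝ) * (P / q ^ 2 / 2) := by
                gcongr
                have h1 : (d : ℝ) ^ 2 ≤ 32 * (linkPairs G b).card := by
                  exact_mod_cast card_linkPairs_ge hC hd (hmin b)
                linarith
            _ = ∑ t ∈ linkPairs G b, P / q ^ 2 / 2 := by rw [sum_const, nsmul_eq_mul]
            _ ≤ _ := sum_le_sum fun t ht => card_selected_ge hC (by omega) hO
                (fun x hx => (mem_filter.1 hx).2) hp1 hp2 hb ht
      _ = ∑ b ∈ L, ∑ f : V → Fin (p + 1),
            (((linkPairs G b).filter fun t => IsSelected G O L f b t.1 t.2).card : ℝ) := by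
          refine sum_congr rfl fun b _ => ?_
          simp_rw [card_filter]
          push_cast
          exact sum_comm
      _ = ∑ f : V → Fin (p + 1), ∑ b ∈ L,
            (((linkPairs G b).filter fun t => IsSelected G O L f b t.1 t.2).card : ℝ) := sum_comm
      _ ≤ ∑ f : V → Fin (p + 1), 2 * ((linkSide G O L f).card : ℝ) := by
          refine sum_le_sum fun f _ => ?_
          have h1 : ∑ b ∈ L, ((linkPairs G b).filter fun t => IsSelected G O L f b t.1 t.2).card ≤
              2 * (linkSide G O L f).card := by
            refine (sum_le_sum fun b hb => card_selected_le f hb).trans ?_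
            rw [← mul_sum, ← card_filter]
            exact Nat.mul_le_mul_left _ (card_le_card fun b hb => (mem_filter.1 hb).2)
          exact_mod_cast h1
      _ = _ := by rw [mul_sum]
  have hlt : ∑ f : V → Fin (p + 1), (d : ℝ) ^ 2 * (branchSide O f).card <
      ∑ f : V → Fin (p + 1), 256 * q * (linkSide G O L f).card := by
    rw [← mul_sum, ← mul_sum]
    have hLr : (7 : ℝ) * n ≤ 8 * L.card := by exact_mod_cast hLc
    have e1 : P / q = q * (P / q ^ 2) := by field_simp
    set X := P / q ^ 2 with hX
    have hX0 : 0 < X := by positivity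
    rw [e1] at hAsum
    have h1 : 7 * n / 8 * ((d : ℝ) ^ 2 / 32 * (X / 2)) ≤ L.card * (d ^ 2 / 32 * (X / 2)) := by
      gcongr
      linarith
    have h2 := mul_le_mul_of_nonneg_left (h1.trans hBsum) (show 0 ≤ 128 * q by positivity)
    have h3 := mul_le_mul_of_nonneg_left hAsum (show 0 ≤ (d : ℝ) ^ 2 by positivity)
    have h4 : 0 < (d : ℝ) ^ 2 * (n * (q * X)) := by positivity
    nlinarith
  obtain ⟨f, -, hf⟩ := exists_lt_of_sum_lt hlt
  have hqd : q = 64 * d * (s + 1) := by rw [hq]; exact_mod_cast hp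
  have hf' : d * (branchSide O f).card < 2 ^ 14 * (s + 1) * (linkSide G O L f).card := by
    rw [hqd] at hf
    have h1 : (d : ℝ) * (d * (branchSide O f).card) <
        d * (2 ^ 14 * (s + 1) * (linkSide G O L f).card) := by nlinarith
    exact_mod_cast lt_of_mul_lt_mul_left h1 hd0.le
  have hlink := isLinked_sides hC hO₁ hO₂ L f
  refine ⟨branchSide O f, linkSide G O L f, hlink, ?_, ?_⟩
  · have hpos : 0 < (linkSide G O L f).card := by
      by_contra hc
      rw [Nat.eq_zero_of_not_pos hc] at hf'
      simp at hf'
    obtain ⟨b, hb⟩ := card_pos.1 hpos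
    obtain ⟨x, hx, -⟩ := hlink.two b hb
    exact ⟨x, hx⟩
  · have h1 : s * (s * (branchSide O f).card) ≤ s * (2 ^ 15 * (linkSide G O L f).card) := by
      calc _ = s * s * (branchSide O f).card := by ring
        _ ≤ d * (branchSide O f).card := by gcongr
        _ ≤ 2 ^ 14 * (s + 1) * (linkSide G O L f).card := hf'.le
        _ ≤ 2 ^ 14 * (2 * s) * (linkSide G O L f).card := by gcongr; omega
        _ = _ := by ring
    have h2 := Nat.le_of_mul_le_mul_left h1 hs1
    rw [mul_comm]
    exact h2

lemma IsLinked.card_le_orderedEdges {V : Type*} {G : SimpleGraph V} (hC : C4Free G)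
    {A B : Finset V} (hL : IsLinked G A B) :
    B.card ≤ orderedEdges (linkGraph G A B) univ := by
  have hch : ∀ b : {b // b ∈ B}, ∃ t : {x // x ∈ A} × {x // x ∈ A}, t.1 ≠ t.2 ∧
      G.Adj b t.1 ∧ G.Adj b t.2 := by
    rintro ⟨b, hb⟩
    obtain ⟨x, hx, y, hy, hxy, h1, h2, -⟩ := hL.two b hb
    exact ⟨(⟨x, hx⟩, ⟨y, hy⟩), fun h => hxy (congrArg Subtype.val h), h1, h2⟩
  choose t ht using hch
  rw [← card_attach]
  refine card_le_card_of_injOn t (fun b _ => ?_) fun b _ c _ hbc => ?_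
  · obtain ⟨h1, h2⟩ := ht b
    exact mem_filter.2 ⟨mem_product.2 ⟨mem_univ _, mem_univ _⟩, h1, b, b.2, h2⟩
  · by_contra hne
    obtain ⟨h1, h2, h3⟩ := ht b
    obtain ⟨-, h2', h3'⟩ := ht c
    rw [← hbc] at h2' h3'
    exact hC ⟨b, (t b).1, c, (t b).2, h2.ne, fun h => hne (Subtype.ext h), h3.ne, h2'.ne',
      fun h => h1 (Subtype.ext h), h3'.ne, h2, h2'.symm, h3', h3.symm⟩

theorem exists_balancedSubdivision_embedding : ∃ h₀ : ℕ, ∀ h ≥ h₀, ∀ {V : Type} [Fintype V]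
    [Nonempty V] (G : SimpleGraph V), C4Free G →
      (2 ^ 17 * h ^ 2002) ^ 2 * Fintype.card V ≤ orderedEdges G univ →
        ∃ ℓ, 2 ≤ ℓ ∧ Nonempty (balancedSubdivision h ℓ ↪g G) := by
  obtain ⟨h₀, hh₀⟩ := exists_balSub_of_dense
  refine ⟨max h₀ 2, fun h hh V _ _ G hC hG => ?_⟩
  have hh2 : 2 ≤ h := (le_max_right _ _).trans hh
  have hpos : 1 ≤ h ^ 2002 := Nat.one_le_pow _ _ (by omega)
  have hpos' : 2 ^ 17 ≤ 2 ^ 17 * h ^ 2002 := Nat.le_mul_of_pos_right _ hpos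
  have hsq : 2 ^ 17 * h ^ 2002 ≤ (2 ^ 17 * h ^ 2002) ^ 2 := Nat.le_self_pow (by norm_num) _
  obtain ⟨S, hS, d, hd, hdens, hmin⟩ := exists_densest G (by omega) hG
  have : Nonempty (S : Set V) := hS.to_subtype
  have hC' : C4Free (G.induce (S : Set V)) := by
    rintro ⟨a, b, c, e, h1, h2, h3, h4, h5, h6, h7⟩
    have hv : ∀ {x y : (S : Set V)}, x ≠ y → (x : V) ≠ y := fun h h' => h (Subtype.ext h')
    exact hC ⟨a, b, c, e, hv h1, hv h2, hv h3, hv h4, hv h5, hv h6, h7⟩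
  obtain ⟨A, B, hL, hA, hAB⟩ := exists_isLinked hC' (by omega) hdens hmin
  have hsqrt : 2 ^ 17 * h ^ 2002 ≤ Nat.sqrt d := Nat.le_sqrt'.2 hd
  have hAB' : 4 * h ^ 2002 * A.card ≤ B.card := by
    have h1 : 2 ^ 15 * (4 * h ^ 2002 * A.card) ≤ 2 ^ 15 * B.card := by
      calc _ = A.card * (2 ^ 17 * h ^ 2002) := by ring
        _ ≤ A.card * Nat.sqrt d := by gcongr
        _ ≤ _ := hAB
    exact Nat.le_of_mul_le_mul_left h1 (by norm_num)
  have : Nonempty {x // x ∈ A} := hA.to_subtype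
  obtain ⟨ℓ, hℓ⟩ := hh₀ h ((le_max_left _ _).trans hh) (linkGraph (G.induce (S : Set V)) A B) (by
    rw [Fintype.card_coe]
    exact hAB'.trans (hL.card_le_orderedEdges hC'))
  have hℓ1 := hℓ.one_le hh2
  obtain ⟨ψ⟩ := hL.balancedSubdivision_embedding hℓ1 hℓ
  exact ⟨2 * ℓ, by omega, ⟨(SimpleGraph.Embedding.induce (S : Set V)).comp ψ⟩⟩

lemma orderedEdges_univ_eq (G : SimpleGraph V) : orderedEdges G univ = 2 * G.edgeSet.ncard := by
  rw [orderedEdges_eq_sum, Set.ncard_eq_toFinset_card', ← SimpleGraph.edgeFinset,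
    ← G.sum_degrees_eq_twice_card_edges]
  refine sum_congr rfl fun v _ => ?_
  rw [inter_univ, ← G.card_neighborFinset_eq_degree]
  congr 1
  ext w
  simp [mem_nbhd]

lemma ceil_pow_le {u : ℝ} (hu : 2 ≤ u) : ((2 ^ 17 * ⌈u⌉₊ ^ 2002 : ℕ) : ℝ) ^ 2 ≤ u ^ 50000 := by
  have h1 : (⌈u⌉₊ : ℝ) ≤ 2 * u := by
    have := Nat.ceil_lt_add_one (show 0 ≤ u by linarith)
    linarith
  have h2 : (2 : ℝ) ^ 4038 ≤ u ^ 45996 :=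
    calc (2 : ℝ) ^ 4038 ≤ 2 ^ 45996 := pow_le_pow_right₀ (by norm_num) (by norm_num)
      _ ≤ u ^ 45996 := pow_le_pow_left₀ (by norm_num) hu _
  rw [Nat.cast_mul, Nat.cast_pow, Nat.cast_pow, Nat.cast_ofNat]
  calc ((2 : ℝ) ^ 17 * (⌈u⌉₊ : ℝ) ^ 2002) ^ 2 ≤ (2 ^ 17 * (2 * u) ^ 2002) ^ 2 := by gcongr
    _ = 2 ^ 4038 * u ^ 4004 := by
      rw [mul_pow, mul_pow, mul_pow, ← pow_mul, ← pow_mul, ← pow_mul, ← mul_assoc, ← pow_add]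
    _ ≤ u ^ 45996 * u ^ 4004 := by gcongr
    _ = u ^ 50000 := by rw [← pow_add]

end Selection

end InducedSubdivision

/-- For all sufficiently large `k`: every `C₄`-free graph with average
degree `d ≥ k^2500` and no `k`-clique contains an induced proper balanced subdivision of
`K_h` with `h ≥ d^(1/50000)`. -/
theorem stmt16 :
    ∃ k₀ : ℕ, ∀ k : ℕ, k₀ ≤ k →
      ∀ (V : Type) [Fintype V] (G : SimpleGraph V),
        C4Free G →
        avgDeg G ≥ (k : ℝ) ^ (2500 : ℕ) →
        ¬ HasClique G k →
        ∃ h : ℕ, (h : ℝ) ≥ avgDeg G ^ ((1 : ℝ) / 50000) ∧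
          HasInducedBalancedSubdivision G h := by
  obtain ⟨h₀, hh₀⟩ := InducedSubdivision.exists_balancedSubdivision_embedding
  set m := max h₀ 2 with hm
  refine ⟨m ^ 20, fun k hk V _ G hC hd _ => ?_⟩
  have hm2 : (2 : ℝ) ≤ m := by exact_mod_cast le_max_right h₀ 2
  have hx : (m : ℝ) ^ 50000 ≤ avgDeg G :=
    calc (m : ℝ) ^ 50000 = ((m : ℝ) ^ 20) ^ 2500 := by rw [← pow_mul]
      _ ≤ (k : ℝ) ^ 2500 := pow_le_pow_left₀ (by positivity) (by exact_mod_cast hk) _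
      _ ≤ avgDeg G := hd
  have hx0 : 0 < avgDeg G := lt_of_lt_of_le (pow_pos (by linarith) _) hx
  have hV : Nonempty V := by
    by_contra hV
    rw [not_nonempty_iff] at hV
    simp [avgDeg] at hx0
  set u := avgDeg G ^ ((1 : ℝ) / 50000) with hu
  have hu0 : 0 ≤ u := Real.rpow_nonneg hx0.le _
  have hux : u ^ 50000 = avgDeg G := by
    rw [hu, ← Real.rpow_natCast, ← Real.rpow_mul hx0.le, Nat.cast_ofNat,
      one_div_mul_cancel (by norm_num), Real.rpow_one]
  have hmu : (m : ℝ) ≤ u := le_of_pow_le_pow_left₀ (n := 50000) (by norm_num) hu0 (hx.trans_eq hux.symm)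
  refine ⟨⌈u⌉₊, Nat.le_ceil u, hh₀ _ ?_ G hC ?_⟩
  · exact (le_max_left h₀ 2).trans (by exact_mod_cast hmu.trans (Nat.le_ceil u))
  · have hcard : (0 : ℝ) < Fintype.card V := by exact_mod_cast Fintype.card_pos
    have h := (InducedSubdivision.ceil_pow_le (hm2.trans hmu)).trans_eq hux
    rw [avgDeg, le_div_iff₀ hcard] at h
    rw [InducedSubdivision.orderedEdges_univ_eq]
    exact_mod_cast h
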